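/- arXiv:1802.10563 — 2 statements merged into one kernel-verified Lean document; each statement's English description precedes it below -/
import Mathlib

section
/- Let N be a norm on ℝ² whose restriction to ℝ² \ {0} is of class C^{2,δ} for some δ ∈ (0,1), and assume the N-unit circle has strictly positive Euclidean curvature at every point. Then for every Borel set A ⊆ ℝ² with dim A ≤ 1, for ℋ¹-almost every v ∈ S¹ one has dim(P_v(A)) = dim A. -/
open Set Metric MeasureTheory
open scoped ENNReal RealInnerProductSpace

noncomputable section

namespace SymbolicTree

variable {α : Type*}

/-- The cylinder of all sequences whose initial segment, read backwards, is the word `l`. -/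
def cyl (l : List α) : Set (ℕ → α) := {x | PiNat.res x l.length = l}

/-- The total weight of a family of words. -/
def wt (w : List α → ℝ≥0∞) (C : Set (List α)) : ℝ≥0∞ := ∑' l, C.indicator w l

/-- The union of the cylinders over a family of words. -/
def cov (C : Set (List α)) : Set (ℕ → α) := ⋃ l ∈ C, cyl l

/-- The net content of a set of sequences: the infimal weight of a cover by cylinders. -/
def content (w : List α → ℝ≥0∞) (E : Set (ℕ → α)) : ℝ≥0∞ :=
  ⨅ C : {C : Set (List α) // E ⊆ cov C}, wt w C

/-- The shortest words of a family with respect to the suffix order. -/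
def maxl (D : Set (List α)) : Set (List α) := {l ∈ D | ∀ l' ∈ D, l' <:+ l → l' = l}

theorem mem_cov {C : Set (List α)} {x : ℕ → α} : x ∈ cov C ↔ ∃ l ∈ C, x ∈ cyl l := by
  simp [cov]

theorem cov_mono {C D : Set (List α)} (h : C ⊆ D) : cov C ⊆ cov D :=
  biUnion_subset_biUnion_left h

theorem res_suffix_res (x : ℕ → α) {m n : ℕ} (h : m ≤ n) : PiNat.res x m <:+ PiNat.res x n := by
  induction n, h using Nat.le_induction with
  | base => exact List.suffix_refl _
  | succ n _ ih => exact ih.trans (by rw [PiNat.res_succ]; exact List.suffix_cons _ _)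

theorem res_mem_cyl (x : ℕ → α) (n : ℕ) : x ∈ cyl (PiNat.res x n) := by
  simp [cyl]

theorem suffix_of_mem_cyl {x : ℕ → α} {l l' : List α} (h : x ∈ cyl l) (h' : x ∈ cyl l')
    (hl : l.length ≤ l'.length) : l <:+ l' := by
  have := res_suffix_res x hl
  rwa [show PiNat.res x l.length = l from h, show PiNat.res x l'.length = l' from h'] at this

theorem cyl_anti {l l' : List α} (h : l <:+ l') : cyl l' ⊆ cyl l := by
  intro x hx
  have h1 := res_suffix_res x h.length_le
  rw [show PiNat.res x l'.length = l' from hx] at h1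
  exact (List.suffix_of_suffix_length_le h1 h (by simp)).eq_of_length (by simp)

theorem maxl_subset (D : Set (List α)) : maxl D ⊆ D := sep_subset _ _

theorem cov_maxl (D : Set (List α)) : cov (maxl D) = cov D := by
  refine (cov_mono (maxl_subset D)).antisymm ?_
  intro x hx
  obtain ⟨l, hl, hxl⟩ := mem_cov.1 hx
  classical
  have hex : ∃ n, PiNat.res x n ∈ D := ⟨l.length, by
    rwa [show PiNat.res x l.length = l from hxl]⟩
  refine mem_cov.2 ⟨PiNat.res x (Nat.find hex), ⟨Nat.find_spec hex, ?_⟩, res_mem_cyl x _⟩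
  intro l' hl' hs
  have hx' : x ∈ cyl l' := cyl_anti hs (res_mem_cyl x _)
  have : Nat.find hex ≤ l'.length := Nat.find_min' hex (by
    rwa [show PiNat.res x l'.length = l' from hx'])
  exact hs.eq_of_length (le_antisymm hs.length_le (by simpa using this))

variable {w : List α → ℝ≥0∞}

theorem wt_mono {C D : Set (List α)} (h : C ⊆ D) : wt w C ≤ wt w D :=
  ENNReal.tsum_le_tsum fun _ => indicator_le_indicator_of_subset h (fun _ => zero_le) _

theorem wt_union_add_inter (C D : Set (List α)) :
    wt w (C ∪ D) + wt w (C ∩ D) = wt w C + wt w D := by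
  simp only [wt, ← ENNReal.tsum_add]
  exact tsum_congr fun l => indicator_union_add_inter_apply w C D l

theorem wt_union_le (C D : Set (List α)) : wt w (C ∪ D) ≤ wt w C + wt w D :=
  (wt_union_add_inter C D) ▸ le_self_add

theorem content_le {E : Set (ℕ → α)} {C : Set (List α)} (h : E ⊆ cov C) :
    content w E ≤ wt w C := iInf_le (fun C : {C : Set (List α) // E ⊆ cov C} => wt w C) ⟨C, h⟩

theorem exists_cover_lt {E : Set (ℕ → α)} {c : ℝ≥0∞} (h : content w E < c) :
    ∃ C, E ⊆ cov C ∧ wt w C < c := by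
  obtain ⟨⟨C, hC⟩, h⟩ := iInf_lt_iff.1 h
  exact ⟨C, hC, h⟩

theorem le_content {E : Set (ℕ → α)} {c : ℝ≥0∞} (h : ∀ C, E ⊆ cov C → c ≤ wt w C) :
    c ≤ content w E := le_iInf fun C => h C.1 C.2

theorem content_mono {E F : Set (ℕ → α)} (h : E ⊆ F) : content w E ≤ content w F :=
  le_content fun _ hC => content_le (h.trans hC)

theorem content_union_le (E F : Set (ℕ → α)) : content w (E ∪ F) ≤ content w E + content w F := by
  nth_rw 2 [content]
  nth_rw 2 [content]
  simp only [ENNReal.iInf_add, ENNReal.add_iInf]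
  exact le_iInf fun C => le_iInf fun D => (content_le (union_subset
    (D.2.trans (cov_mono subset_union_left)) (C.2.trans (cov_mono subset_union_right)))).trans
    (wt_union_le _ _)

theorem content_empty : content w (∅ : Set (ℕ → α)) = 0 :=
  le_antisymm ((content_le (empty_subset (cov ∅))).trans (by simp [wt])) zero_le

theorem content_biUnion_le {ι : Type*} (s : Finset ι) (E : ι → Set (ℕ → α)) :
    content w (⋃ i ∈ s, E i) ≤ ∑ i ∈ s, content w (E i) := by
  classical
  induction s using Finset.induction_on with
  | empty => simp [content_empty]
  | insert a s ha ih =>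
    rw [Finset.set_biUnion_insert, Finset.sum_insert ha]
    exact (content_union_le _ _).trans (by gcongr)

theorem content_inter_cyl_le (E : Set (ℕ → α)) (l : List α) : content w (E ∩ cyl l) ≤ w l := by
  refine (content_le (C := {l}) ?_).trans ?_
  · simp [cov]
  · classical
    rw [wt, tsum_eq_single l (fun l' hl' => by simp [hl'])]
    simp

theorem wt_maxl_union_add_content_le {A C : Set (List α)} {F : Set (ℕ → α)} (hA : F ⊆ cov A)
    (hC : F ⊆ cov C) : wt w (maxl (A ∪ C)) + content w F ≤ wt w A + wt w C := by
  set Z := ((A ∪ C) \ maxl (A ∪ C)) ∪ (A ∩ C) with hZ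
  have hF : F ⊆ cov Z := by
    intro x hx
    obtain ⟨l, hl, hxl⟩ := mem_cov.1 (hA hx)
    obtain ⟨l', hl', hxl'⟩ := mem_cov.1 (hC hx)
    by_cases h1 : l ∈ maxl (A ∪ C)
    · by_cases h2 : l' ∈ maxl (A ∪ C)
      · have : l = l' := by
          rcases le_total l.length l'.length with h | h
          · exact h2.2 _ h1.1 (suffix_of_mem_cyl hxl hxl' h)
          · exact (h1.2 _ h2.1 (suffix_of_mem_cyl hxl' hxl h)).symm
        exact mem_cov.2 ⟨l, Or.inr ⟨hl, this ▸ hl'⟩, hxl⟩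
      · exact mem_cov.2 ⟨l', Or.inl ⟨Or.inr hl', h2⟩, hxl'⟩
    · exact mem_cov.2 ⟨l, Or.inl ⟨Or.inl hl, h1⟩, hxl⟩
  calc wt w (maxl (A ∪ C)) + content w F ≤ wt w (maxl (A ∪ C)) + wt w Z := by
        gcongr; exact content_le hF
    _ = wt w (maxl (A ∪ C) ∪ Z) + wt w (maxl (A ∪ C) ∩ Z) := (wt_union_add_inter _ _).symm
    _ ≤ wt w (A ∪ C) + wt w (A ∩ C) := by
        refine add_le_add (wt_mono ?_) (wt_mono ?_)
        · rintro l (hl | hl | hl)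
          exacts [hl.1, hl.1, Or.inl hl.1]
        · rintro l ⟨h1, h2 | h2⟩
          exacts [absurd h1 h2.2, h2]
    _ = wt w A + wt w C := wt_union_add_inter _ _

/-- The increasing sets lemma for net contents. -/
theorem content_iUnion_le {E : ℕ → Set (ℕ → α)} (hE : Monotone E) {c : ℝ≥0∞}
    (hc : ∀ n, content w (E n) ≤ c) : content w (⋃ n, E n) ≤ c := by
  rcases eq_or_ne c ∞ with rfl | hctop
  · exact le_top
  have hfin : ∀ n, content w (E n) ≠ ∞ := fun n => ne_top_of_le_ne_top hctop (hc n)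
  refine ENNReal.le_of_forall_pos_le_add fun ε hε _ => ?_
  obtain ⟨e, he0, hes⟩ := ENNReal.exists_pos_sum_of_countable' (ε := (ε : ℝ≥0∞))
    (by exact_mod_cast hε.ne') ℕ
  have hex : ∀ n, ∃ C, E n ⊆ cov C ∧ wt w C ≤ content w (E n) + e n := fun n => by
    obtain ⟨C, h1, h2⟩ := exists_cover_lt (ENNReal.lt_add_right (hfin n) (he0 n).ne')
    exact ⟨C, h1, h2.le⟩
  choose C hC hCw using hex
  set U : ℕ → Set (List α) := fun n => ⋃ i ≤ n, C i with hU
  have hUsucc : ∀ n, U (n + 1) = U n ∪ C (n + 1) := fun n => by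
    simp only [hU]; exact biUnion_le_succ C n
  have hEU : ∀ n, E n ⊆ cov (U n) := fun n =>
    (hC n).trans (cov_mono (subset_biUnion_of_mem (u := C) (show n ∈ {i | i ≤ n} from Nat.le_refl n)))
  have hD : ∀ n, wt w (maxl (U n)) ≤ content w (E n) + ∑ i ∈ Finset.range (n + 1), e i := by
    intro n
    induction n with
    | zero =>
      have : U 0 = C 0 := by simp [hU]
      rw [this]
      simpa using (wt_mono (maxl_subset _)).trans (hCw 0)
    | succ n ih =>
      have hsub : maxl (U (n + 1)) ⊆ maxl (maxl (U n) ∪ C (n + 1)) := by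
        rw [hUsucc]
        rintro l ⟨hl, hmax⟩
        refine ⟨hl.imp_left fun h => ⟨h, fun l' hl' => hmax l' (Or.inl hl')⟩, fun l' hl' => ?_⟩
        exact hmax l' (hl'.imp_left fun h => h.1)
      have key := wt_maxl_union_add_content_le (w := w) (A := maxl (U n)) (C := C (n + 1))
        (F := E n) (by rw [cov_maxl]; exact hEU n) ((hE n.le_succ).trans (hC (n + 1)))
      have h2 := (add_le_add_left (wt_mono (w := w) hsub) (content w (E n))).trans
        (key.trans (add_le_add ih (hCw (n + 1))))
      rw [Finset.sum_range_succ _ (n + 1)]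
      refine (ENNReal.add_le_add_iff_right (hfin n)).1 (h2.trans_eq ?_)
      ring
  refine (content_le (C := maxl (⋃ n, C n)) ?_).trans ?_
  · rw [cov_maxl]
    exact iUnion_subset fun n => (hC n).trans (cov_mono (subset_iUnion C n))
  · rw [wt, ENNReal.tsum_eq_iSup_sum]
    refine iSup_le fun F => ?_
    have hN : ∃ n, ∀ l ∈ F, l ∈ maxl (⋃ n, C n) → l ∈ maxl (U n) := by
      have h1 : ∀ l, ∃ n, l ∈ maxl (⋃ n, C n) → l ∈ C n := fun l => by
        by_cases hl : l ∈ maxl (⋃ n, C n)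
        · obtain ⟨n, hn⟩ := mem_iUnion.1 hl.1
          exact ⟨n, fun _ => hn⟩
        · exact ⟨0, fun h => absurd h hl⟩
      choose n hn using h1
      refine ⟨F.sup n, fun l hl hmax => ⟨?_, fun l' hl' => hmax.2 l' ?_⟩⟩
      · exact mem_biUnion (show n l ∈ {i | i ≤ F.sup n} from Finset.le_sup (f := n) hl) (hn l hmax)
      · exact iUnion₂_subset (fun i _ => subset_iUnion C i) hl'
    obtain ⟨n, hn⟩ := hN
    calc ∑ l ∈ F, (maxl (⋃ n, C n)).indicator w l ≤ ∑ l ∈ F, (maxl (U n)).indicator w l := by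
          refine Finset.sum_le_sum fun l hl => ?_
          by_cases h : l ∈ maxl (⋃ n, C n)
          · rw [indicator_of_mem h, indicator_of_mem (hn l hl h)]
          · rw [indicator_of_notMem h]; exact zero_le
      _ ≤ wt w (maxl (U n)) := ENNReal.sum_le_tsum F
      _ ≤ content w (E n) + ∑ i ∈ Finset.range (n + 1), e i := hD n
      _ ≤ c + ε := add_le_add (hc n) ((ENNReal.sum_le_tsum _).trans hes.le)

theorem isClopen_cyl [TopologicalSpace α] [DiscreteTopology α] (l : List α) :
    IsClopen (cyl l) := by
  rcases (cyl l).eq_empty_or_nonempty with h | ⟨x, hx⟩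
  · rw [h]; exact isClopen_empty
  · have : cyl l = PiNat.cylinder (E := fun _ => α) x l.length := by
      rw [PiNat.cylinder_eq_res, show PiNat.res x l.length = l from hx]; rfl
    rw [this, PiNat.cylinder_eq_pi]
    exact ⟨isClosed_set_pi fun _ _ => isClosed_discrete _,
      isOpen_set_pi (Finset.finite_toSet _) fun _ _ => isOpen_discrete _⟩

theorem isOpen_cov [TopologicalSpace α] [DiscreteTopology α] (C : Set (List α)) :
    IsOpen (cov C) := isOpen_biUnion fun l _ => (isClopen_cyl l).2

/-- Capacitability of analytic sets for net contents. -/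
theorem exists_isCompact_le_content [TopologicalSpace α] [DiscreteTopology α]
    {f : (ℕ → ℕ) → ℕ → α} (hf : Continuous f) {c : ℝ≥0∞} (hc : c < content w (range f)) :
    ∃ K ⊆ range f, IsCompact K ∧ c ≤ content w K := by
  have hstep : ∀ (k : ℕ) (S : {S : Set (ℕ → ℕ) // c < content w (f '' S)}),
      ∃ m, c < content w (f '' (S.1 ∩ {σ | σ k ≤ m})) := by
    intro k S
    by_contra! h
    refine (S.2.trans_le ?_).false
    have : f '' S.1 = ⋃ m, f '' (S.1 ∩ {σ | σ k ≤ m}) := by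
      rw [← image_iUnion, ← inter_iUnion]
      congr
      exact (inter_eq_left.2 fun σ _ => mem_iUnion.2 ⟨σ k, le_refl (σ k)⟩).symm
    rw [this]
    refine content_iUnion_le (fun m m' hm => image_mono ?_) h
    exact inter_subset_inter_right _ fun σ (hσ : σ k ≤ m) => hσ.trans hm
  choose m hm using hstep
  let g : ℕ → {S : Set (ℕ → ℕ) // c < content w (f '' S)} := fun n =>
    Nat.rec ⟨univ, by rwa [image_univ]⟩ (fun k S => ⟨S.1 ∩ {σ | σ k ≤ m k S}, hm k S⟩) n
  set b : ℕ → ℕ := fun k => m k (g k) with hb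
  have hg : ∀ k, (g k).1 = {σ | ∀ i < k, σ i ≤ b i} := by
    intro k
    induction k with
    | zero => simp [g]
    | succ k ih =>
      have : (g (k + 1)).1 = (g k).1 ∩ {σ | σ k ≤ b k} := rfl
      rw [this, ih]
      ext σ
      simp only [mem_inter_iff, mem_ofPred_eq]
      exact ⟨fun h i hi => (Nat.lt_succ_iff_lt_or_eq.1 hi).elim (h.1 i) fun e => e ▸ h.2,
        fun h => ⟨fun i hi => h i (hi.trans k.lt_succ_self), h k k.lt_succ_self⟩⟩
  set D : Set (ℕ → ℕ) := pi univ fun i => Iic (b i) with hD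
  have hDc : IsCompact D := isCompact_univ_pi fun i => (finite_Iic _).isCompact
  refine ⟨f '' D, image_subset_range f D, hDc.image hf, le_content fun C hC => ?_⟩
  have hV : IsClosed (f ⁻¹' cov C)ᶜ := ((isOpen_cov C).preimage hf).isClosed_compl
  obtain ⟨k, hk⟩ : ∃ k, (g k).1 ⊆ f ⁻¹' cov C := by
    by_contra! h
    simp only [not_subset] at h
    choose σ hσ hσV using h
    have hτ : ∀ k, (fun i => min (σ k i) (b i)) ∈ D := fun k i _ => min_le_right (σ k i) (b i)
    obtain ⟨τ, hτD, φ, hφ, hlim⟩ := hDc.tendsto_subseq hτ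
    have hlim' : Filter.Tendsto (fun j => σ (φ j)) Filter.atTop (nhds τ) := by
      rw [tendsto_pi_nhds] at hlim ⊢
      intro i
      refine (hlim i).congr' ?_
      filter_upwards [Filter.eventually_gt_atTop i] with j hj
      have h1 := hσ (φ j)
      rw [hg] at h1
      exact min_eq_left (h1 i (hj.trans_le hφ.le_apply))
    have := hV.mem_of_tendsto hlim' (Filter.Eventually.of_forall fun j => hσV (φ j))
    exact this (hC (mem_image_of_mem f hτD))
  exact ((g k).2.trans_le (content_le (image_subset_iff.2 hk))).le

section Measure

/-- A sequence in the cylinder over a word. -/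
def point [Inhabited α] : List α → ℕ → α
  | [] => fun _ => default
  | a :: l => Function.update (point l) l.length a

theorem point_mem_cyl [Inhabited α] (l : List α) : point l ∈ cyl l := by
  induction l with
  | nil => simp [cyl]
  | cons a l ih =>
    have h : PiNat.res (Function.update (point l) l.length a) l.length = l := by
      refine Eq.trans ?_ ih
      refine PiNat.res_eq_res.2 fun m hm => ?_
      rw [Function.update_of_ne hm.ne]
    simp [cyl, point, h]

theorem cyl_nil : cyl ([] : List α) = univ := by
  ext x; simp [cyl]

theorem iUnion_cyl_cons (l : List α) : ⋃ a, cyl (a :: l) = cyl l := by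
  ext x
  simp [cyl, PiNat.res_succ]

theorem disjoint_cyl {l l' : List α} (h : l.length = l'.length) (hne : l ≠ l') :
    Disjoint (cyl l) (cyl l') := by
  refine disjoint_left.2 fun x hx hx' => hne ?_
  rw [← show PiNat.res x l.length = l from hx, h, show PiNat.res x l'.length = l' from hx']

variable [Fintype α]

/-- A flow through the tree of words dominated by a subadditive function. -/
def flow (m : List α → ℝ≥0∞) : List α → ℝ≥0∞
  | [] => m []
  | a :: l => flow m l * (m (a :: l) / ∑ b, m (b :: l))

theorem flow_le {m : List α → ℝ≥0∞} (hm : ∀ l, m l ≤ ∑ a, m (a :: l)) (l : List α) :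
    flow m l ≤ m l := by
  induction l with
  | nil => exact le_rfl
  | cons a l ih =>
    calc flow m (a :: l) ≤ (∑ b, m (b :: l)) * (m (a :: l) / ∑ b, m (b :: l)) := by
          rw [flow]; gcongr; exact ih.trans (hm l)
      _ ≤ m (a :: l) := ENNReal.mul_div_le

theorem sum_flow {m : List α → ℝ≥0∞} (hm : ∀ l, m l ≤ ∑ a, m (a :: l)) (hfin : ∀ l, m l ≠ ∞)
    (l : List α) : ∑ a, flow m (a :: l) = flow m l := by
  simp only [flow, ← Finset.mul_sum, div_eq_mul_inv, ← Finset.sum_mul]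
  rcases eq_or_ne (∑ b, m (b :: l)) 0 with h | h
  · have := (flow_le hm l).trans (hm l)
    rw [h] at this ⊢
    simp [le_antisymm this zero_le]
  · rw [ENNReal.mul_inv_cancel h (ENNReal.sum_ne_top.2 fun a _ => hfin _), mul_one]

variable [MeasurableSpace α]

/-- Atomic approximations, at depth `k` below the word `l`, of a measure with prescribed values
on cylinders. -/
def approx [Inhabited α] (ν : List α → ℝ≥0∞) : ℕ → List α → Measure (ℕ → α)
  | 0, l => ν l • Measure.dirac (point l)
  | k + 1, l => ∑ a, approx ν k (a :: l)

theorem approx_univ [Inhabited α] {ν : List α → ℝ≥0∞} (hν : ∀ l, ∑ a, ν (a :: l) = ν l)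
    (k : ℕ) (l : List α) : approx ν k l univ = ν l := by
  induction k generalizing l with
  | zero => simp [approx]
  | succ k ih => simp [approx, ih, hν]

variable [TopologicalSpace α] [DiscreteTopology α] [BorelSpace α]

theorem measurableSet_cyl (l : List α) : MeasurableSet (cyl l) :=
  (isClopen_cyl l).2.measurableSet

theorem approx_cyl_compl [Inhabited α] (ν : List α → ℝ≥0∞) (k : ℕ) (l : List α) :
    approx ν k l (cyl l)ᶜ = 0 := by
  induction k generalizing l with
  | zero => simp [approx, Measure.dirac_apply' _ (measurableSet_cyl l).compl, point_mem_cyl]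
  | succ k ih =>
    simp only [approx, Measure.coe_finsetSum, Finset.sum_apply, Finset.sum_eq_zero_iff]
    exact fun a _ => measure_mono_null
      (compl_subset_compl.2 (cyl_anti (List.suffix_cons a l))) (ih (a :: l))

theorem approx_cyl [Inhabited α] {ν : List α → ℝ≥0∞} (hν : ∀ l, ∑ a, ν (a :: l) = ν l)
    (t l : List α) (k : ℕ) (hk : t.length ≤ k) : approx ν k l (cyl (t ++ l)) = ν (t ++ l) := by
  induction t using List.reverseRecOn generalizing l k with
  | nil =>
    rw [List.nil_append, ← approx_univ hν k l]
    exact measure_congr (ae_eq_univ.2 (approx_cyl_compl ν k l))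
  | append_singleton t a ih =>
    obtain ⟨k, rfl⟩ : ∃ k', k = k' + 1 := ⟨k - 1, by simp at hk; omega⟩
    simp only [approx, Measure.coe_finsetSum, Finset.sum_apply, List.append_assoc,
      List.singleton_append]
    rw [Finset.sum_eq_single a]
    · exact ih (a :: l) k (by simpa using hk)
    · intro b _ hb
      refine measure_mono_null ?_ (approx_cyl_compl ν k (b :: l))
      refine (cyl_anti (List.suffix_append t (a :: l))).trans ?_
      exact (disjoint_cyl (by simp) (by simpa using hb.symm)).subset_compl_right
    · simp

/-- Existence of a measure with prescribed values on cylinders. -/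
theorem exists_measure_cyl [Nonempty α] {ν : List α → ℝ≥0∞} (hν : ∀ l, ∑ a, ν (a :: l) = ν l)
    (hfin : ν [] ≠ ∞) :
    ∃ μ : Measure (ℕ → α), IsFiniteMeasure μ ∧ ∀ l, μ (cyl l) = ν l := by
  inhabit α
  rcases eq_or_ne (ν []) 0 with h0 | h0
  · have : ∀ l, ν l = 0 := by
      intro l
      induction l with
      | nil => exact h0
      | cons a l ih =>
        rw [← hν l, Finset.sum_eq_zero_iff] at ih
        exact ih a (Finset.mem_univ a)
    exact ⟨0, inferInstance, fun l => by simp [this]⟩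
  set ν' : List α → ℝ≥0∞ := fun l => (ν [])⁻¹ * ν l with hν'
  have hsum : ∀ l, ∑ a, ν' (a :: l) = ν' l := fun l => by
    simp only [hν', ← Finset.mul_sum, hν]
  have hone : ν' [] = 1 := ENNReal.inv_mul_cancel h0 hfin
  let P : ℕ → ProbabilityMeasure (ℕ → α) := fun k =>
    ⟨approx ν' k [], ⟨by rw [approx_univ hsum, hone]⟩⟩
  obtain ⟨μ, -, hμ⟩ := isCompact_univ.ultrafilter_le_nhds (Ultrafilter.map P (Filter.hyperfilter ℕ))
    (by simp)
  have hlim : Filter.Tendsto P (Filter.hyperfilter ℕ) (nhds μ) := hμ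
  have hcyl : ∀ l, (μ : Measure (ℕ → α)) (cyl l) = ν' l := by
    intro l
    have h1 := ProbabilityMeasure.tendsto_measure_of_null_frontier_of_tendsto' hlim (E := cyl l)
      (by rw [(isClopen_cyl l).frontier_eq]; simp)
    refine tendsto_nhds_unique h1 (tendsto_const_nhds.congr' ?_)
    have h2 : ∀ᶠ k in (Filter.hyperfilter ℕ : Filter ℕ), l.length ≤ k :=
      Nat.hyperfilter_le_atTop (Filter.eventually_ge_atTop l.length)
    filter_upwards [h2] with k hk
    have h3 := approx_cyl hsum l [] k hk
    rw [List.append_nil] at h3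
    exact h3.symm
  refine ⟨ν [] • (μ : Measure (ℕ → α)), Measure.smul_finite _ hfin, fun l => ?_⟩
  simp only [Measure.smul_apply, smul_eq_mul, hcyl, hν']
  rw [← mul_assoc, ENNReal.mul_inv_cancel h0 hfin, one_mul]

/-- Frostman's lemma in the space of sequences, for closed sets. -/
theorem exists_measure_of_isClosed [Nonempty α] {K : Set (ℕ → α)} (hK : IsClosed K)
    (hw : ∀ l, w l ≠ ∞) :
    ∃ μ : Measure (ℕ → α), IsFiniteMeasure μ ∧ μ univ = content w K ∧ μ Kᶜ = 0 ∧
      ∀ l, μ (cyl l) ≤ w l := by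
  set m : List α → ℝ≥0∞ := fun l => content w (K ∩ cyl l) with hm
  have hmw : ∀ l, m l ≤ w l := content_inter_cyl_le K
  have hsub : ∀ l, m l ≤ ∑ a, m (a :: l) := fun l => by
    refine (content_mono ?_).trans (content_biUnion_le Finset.univ _)
    simp only [Finset.mem_univ, iUnion_true]
    rw [← inter_iUnion, iUnion_cyl_cons]
  have hmfin : ∀ l, m l ≠ ∞ := fun l => ne_top_of_le_ne_top (hw l) (hmw l)
  obtain ⟨μ, hμ, hcyl⟩ := exists_measure_cyl (sum_flow hsub hmfin) (hmfin [])
  refine ⟨μ, hμ, ?_, ?_, fun l => ?_⟩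
  · rw [← cyl_nil, hcyl, flow, hm]
    simp [cyl_nil]
  · have hcov : Kᶜ ⊆ ⋃ l ∈ {l : List α | Disjoint K (cyl l)}, cyl l := by
      intro x hx
      obtain ⟨_, ⟨y, n, rfl⟩, hxy, hsub⟩ :=
        (PiNat.isTopologicalBasis_cylinders (fun _ : ℕ => α)).exists_subset_of_mem_open hx
          hK.isOpen_compl
      rw [← PiNat.mem_cylinder_iff_eq.1 hxy, PiNat.cylinder_eq_res] at hsub
      refine mem_biUnion (x := PiNat.res x n) ?_ (res_mem_cyl x n)
      refine disjoint_left.2 fun z hz hz' => hsub ?_ hz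
      simpa [cyl] using hz'
    refine measure_mono_null hcov ((measure_biUnion_null_iff (to_countable _)).2 fun l hl => ?_)
    rw [hcyl]
    refine le_antisymm ((flow_le hsub l).trans ?_) zero_le
    rw [hm]
    simp only [Disjoint.inter_eq hl, content_empty, le_refl]
  · rw [hcyl]
    exact (flow_le hsub l).trans (hmw l)

/-- Frostman's lemma in the space of sequences, for analytic sets. -/
theorem exists_measure_of_analyticSet [Nonempty α] {E : Set (ℕ → α)} (hE : AnalyticSet E)
    (hw : ∀ l, w l ≠ ∞) (h0 : content w E ≠ 0) :
    ∃ K ⊆ E, IsCompact K ∧ ∃ μ : Measure (ℕ → α), IsFiniteMeasure μ ∧ μ K ≠ 0 ∧ μ Kᶜ = 0 ∧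
      ∀ l, μ (cyl l) ≤ w l := by
  rw [AnalyticSet] at hE
  rcases hE with rfl | ⟨f, hf, rfl⟩
  · exact absurd content_empty h0
  obtain ⟨c, hc0, hc⟩ := exists_between (pos_iff_ne_zero.2 h0)
  obtain ⟨K, hKE, hK, hcK⟩ := exists_isCompact_le_content hf hc
  obtain ⟨μ, hμ, huniv, hcompl, hcyl⟩ := exists_measure_of_isClosed hK.isClosed hw
  refine ⟨K, hKE, hK, μ, hμ, ?_, hcompl, hcyl⟩
  rw [measure_congr (ae_eq_univ.2 hcompl), huniv]
  exact (hc0.trans_le hcK).ne'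

end Measure

end SymbolicTree


namespace PlaneFrostman

open SymbolicTree

/-- The Euclidean plane. -/
local notation "Pl" => EuclideanSpace ℝ (Fin 2)

/-- The integer whose binary expansion is given by the first `n` digits of `d`. -/
def num (d : ℕ → Fin 2) : ℕ → ℤ
  | 0 => 0
  | n + 1 => 2 * num d n + ((d n : ℕ) : ℤ)

theorem eq_of_num_eq {d e : ℕ → Fin 2} {n : ℕ} (h : num d n = num e n) : ∀ i < n, d i = e i := by
  induction n with
  | zero => intro i hi; omega
  | succ n ih =>
    have h1 := (d n).is_lt
    have h2 := (e n).is_lt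
    simp only [num] at h
    have h3 : num d n = num e n := by omega
    have h4 : d n = e n := Fin.ext (by omega)
    intro i hi
    rcases Nat.lt_succ_iff_lt_or_eq.1 hi with hi | rfl
    · exact ih h3 i hi
    · exact h4

theorem num_eq_sum (d : ℕ → Fin 2) (n : ℕ) :
    (num d n : ℝ) = 2 ^ n * ∑ i ∈ Finset.range n, Real.ofDigitsTerm d i := by
  induction n with
  | zero => simp [num]
  | succ n ih =>
    rw [Finset.sum_range_succ, num]
    push_cast
    rw [ih, Real.ofDigitsTerm]
    push_cast
    field_simp
    ring

theorem num_le (d : ℕ → Fin 2) (n : ℕ) : (num d n : ℝ) ≤ 2 ^ n * Real.ofDigits d := by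
  rw [num_eq_sum, Real.ofDigits_eq_sum_add_ofDigits d n]
  gcongr
  have := Real.ofDigits_nonneg fun i => d (i + n)
  simp only [le_add_iff_nonneg_right]
  positivity

theorem le_num_add_one (d : ℕ → Fin 2) (n : ℕ) : 2 ^ n * Real.ofDigits d ≤ num d n + 1 := by
  rw [num_eq_sum, Real.ofDigits_eq_sum_add_ofDigits d n, mul_add, ← mul_assoc]
  push_cast
  rw [mul_inv_cancel₀ (by positivity), one_mul]
  gcongr
  exact Real.ofDigits_le_one _

/-- The point of the plane with given integer part and binary digits. -/
def code (q : Fin 2 → ℤ) (x : ℕ → Fin 2 × Fin 2) : Pl :=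
  !₂[q 0 + Real.ofDigits (fun i => (x i).1), q 1 + Real.ofDigits (fun i => (x i).2)]

theorem continuous_code (q : Fin 2 → ℤ) : Continuous (code q) := by
  unfold code
  have h1 : Continuous fun x : ℕ → Fin 2 × Fin 2 => Real.ofDigits fun i => (x i).1 :=
    Real.continuous_ofDigits.comp (by fun_prop)
  have h2 : Continuous fun x : ℕ → Fin 2 × Fin 2 => Real.ofDigits fun i => (x i).2 :=
    Real.continuous_ofDigits.comp (by fun_prop)
  refine (PiLp.continuous_toLp 2 _).comp (continuous_pi fun i => ?_)
  fin_cases i <;> simp <;> fun_prop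

theorem exists_code_eq (p : Pl) : ∃ q x, code q x = p := by
  have h (i : Fin 2) : Int.fract (p i) ∈ Icc (0 : ℝ) 1 :=
    ⟨Int.fract_nonneg _, (Int.fract_lt_one _).le⟩
  choose d hd using fun i => Real.ofDigits_SurjOn one_lt_two (h i)
  refine ⟨fun i => ⌊p i⌋, fun n => (d 0 n, d 1 n), ?_⟩
  ext i
  fin_cases i <;> simp [code, (hd _).2]

theorem dist_le_abs_add_abs (p q : Pl) : dist p q ≤ |p 0 - q 0| + |p 1 - q 1| := by
  rw [EuclideanSpace.dist_eq, Fin.sum_univ_two, Real.dist_eq, Real.dist_eq]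
  refine Real.sqrt_le_iff.2 ⟨by positivity, ?_⟩
  nlinarith [abs_nonneg (p 0 - q 0), abs_nonneg (p 1 - q 1)]

theorem ediam_code_image_cyl_le (q : Fin 2 → ℤ) (l : List (Fin 2 × Fin 2)) :
    ediam (code q '' cyl l) ≤ 2 * 2⁻¹ ^ l.length := by
  have key : ediam (code q '' cyl l) ≤ ENNReal.ofReal (2 * (2 ^ l.length)⁻¹) := by
    refine ediam_le ?_
    rintro _ ⟨x, hx, rfl⟩ _ ⟨y, hy, rfl⟩
    rw [edist_dist]
    refine ENNReal.ofReal_le_ofReal ((dist_le_abs_add_abs _ _).trans ?_)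
    have h := PiNat.res_eq_res.1 (Eq.trans (show PiNat.res x l.length = l from hx) (Eq.symm hy))
    have h1 := Real.abs_ofDigits_sub_ofDigits_le (x := fun i => (x i).1) (y := fun i => (y i).1)
      fun i hi => congrArg Prod.fst (h hi)
    have h2 := Real.abs_ofDigits_sub_ofDigits_le (x := fun i => (x i).2) (y := fun i => (y i).2)
      fun i hi => congrArg Prod.snd (h hi)
    simp only [code, PiLp.toLp_apply, Matrix.cons_val_zero, Matrix.cons_val_one,
      add_sub_add_left_eq_sub]
    push_cast at h1 h2
    linarith
  refine key.trans (le_of_eq ?_)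
  rw [ENNReal.ofReal_mul (by norm_num), ENNReal.ofReal_inv_of_pos (by positivity),
    ENNReal.ofReal_pow (by norm_num), ENNReal.inv_pow]
  simp

theorem measure_box_le {μ : Measure (ℕ → Fin 2 × Fin 2)} {ρ : ℝ≥0∞}
    (hμ : ∀ l, μ (cyl l) ≤ ρ ^ l.length) (q : Fin 2 → ℤ) (p : Pl) (n : ℕ) :
    μ {x | ∀ i, |code q x i - p i| ≤ (2 ^ n)⁻¹} ≤ 16 * ρ ^ n := by
  set c : Fin 2 → ℝ := fun i => 2 ^ n * (p i - q i)
  set F : Fin 2 → Finset ℤ := fun i => Finset.Icc (⌈c i⌉ - 2) (⌈c i⌉ + 1)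
  have hF (i) : (F i).card = 4 := by simp only [F, Int.card_Icc]; omega
  have hmem (i : Fin 2) (d : ℕ → Fin 2) (h : |q i + Real.ofDigits d - p i| ≤ (2 ^ n)⁻¹) :
      num d n ∈ F i := by
    have h1 := num_le d n
    have h2 := le_num_add_one d n
    have h3 : |2 ^ n * Real.ofDigits d - c i| ≤ 1 := by
      rw [show 2 ^ n * Real.ofDigits d - c i = 2 ^ n * (q i + Real.ofDigits d - p i) by
        simp only [c]; ring, abs_mul, abs_of_pos (by positivity)]
      calc _ ≤ (2 : ℝ) ^ n * (2 ^ n)⁻¹ := by gcongr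
        _ = 1 := mul_inv_cancel₀ (by positivity)
    rw [abs_le] at h3
    rw [Finset.mem_Icc]
    constructor
    · have : ⌈c i⌉ ≤ num d n + 2 := Int.ceil_le.2 (by push_cast; linarith)
      omega
    · have : ((num d n : ℤ) : ℝ) ≤ ((⌈c i⌉ + 1 : ℤ) : ℝ) := by
        push_cast; linarith [Int.le_ceil (c i)]
      exact_mod_cast this
  set S : ℤ × ℤ → Set (ℕ → Fin 2 × Fin 2) := fun g =>
    {x | num (fun i => (x i).1) n = g.1 ∧ num (fun i => (x i).2) n = g.2}
  have hS (g) : μ (S g) ≤ ρ ^ n := by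
    rcases (S g).eq_empty_or_nonempty with h | ⟨x, hx⟩
    · simp [h]
    · have : S g ⊆ cyl (PiNat.res x n) := by
        intro y hy
        rw [cyl, mem_ofPred_eq, PiNat.res_length, PiNat.res_eq_res]
        intro i hi
        exact Prod.ext (eq_of_num_eq (hy.1.trans hx.1.symm) i hi)
          (eq_of_num_eq (hy.2.trans hx.2.symm) i hi)
      simpa using (measure_mono this).trans (hμ _)
  calc μ {x | ∀ i, |code q x i - p i| ≤ (2 ^ n)⁻¹}
      ≤ μ (⋃ g ∈ F 0 ×ˢ F 1, S g) := by
        refine measure_mono fun x hx => ?_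
        refine mem_biUnion (x := (num (fun i => (x i).1) n, num (fun i => (x i).2) n)) ?_ ⟨rfl, rfl⟩
        exact Finset.mem_coe.2 (Finset.mem_product.2 ⟨hmem 0 _ (hx 0), hmem 1 _ (hx 1)⟩)
    _ ≤ ∑ g ∈ F 0 ×ˢ F 1, μ (S g) := measure_biUnion_finset_le _ _
    _ ≤ ∑ g ∈ F 0 ×ˢ F 1, ρ ^ n := Finset.sum_le_sum fun g _ => hS g
    _ = 16 * ρ ^ n := by
        rw [Finset.sum_const, Finset.card_product, hF, hF, nsmul_eq_mul]
        norm_num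

theorem rpow_two_inv_lt_one {s : ℝ} (hs : 0 < s) : (2⁻¹ : ℝ≥0∞) ^ s < 1 :=
  ENNReal.rpow_lt_one (by simp) hs

theorem hausdorffMeasure_code_image_eq_zero {s : ℝ} (hs : 0 < s) (q : Fin 2 → ℤ)
    {E : Set (ℕ → Fin 2 × Fin 2)}
    (h : content (fun l => ((2⁻¹ : ℝ≥0∞) ^ s) ^ l.length) E = 0) : μH[s] (code q '' E) = 0 := by
  set ρ : ℝ≥0∞ := (2⁻¹ : ℝ≥0∞) ^ s
  have hρ1 : ρ < 1 := rpow_two_inv_lt_one hs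
  have hρ0 : 0 < ρ := ENNReal.rpow_pos (by simp) (by simp)
  choose C hC hCw using fun n : ℕ =>
    exists_cover_lt (c := ρ ^ n) (h.trans_lt (ENNReal.pow_pos hρ0 n))
  have hw (n) (l : C n) : ρ ^ l.1.length < ρ ^ n := by
    refine lt_of_le_of_lt ?_ (hCw n)
    refine le_trans ?_ (ENNReal.le_tsum l.1)
    simp [l.2]
  have hlen (n) (l : C n) : n ≤ l.1.length := by
    by_contra! hlt
    exact absurd (hw n l) (not_lt.2 (pow_le_pow_right_of_le_one' hρ1.le hlt.le))
  have htend {r : ℝ≥0∞} (hr : r < 1) {c : ℝ≥0∞} (hc : c ≠ ∞) :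
      Filter.Tendsto (fun n : ℕ => c * r ^ n) Filter.atTop (nhds 0) := by
    have := ENNReal.Tendsto.const_mul (ENNReal.tendsto_pow_atTop_nhds_zero_of_lt_one hr)
      (Or.inr hc)
    rwa [mul_zero] at this
  have key := Measure.hausdorffMeasure_le_liminf_tsum s (code q '' E) (l := Filter.atTop)
    (fun n : ℕ => 2 * 2⁻¹ ^ n) (htend (by simp) (by simp))
    (fun n (l : C n) => code q '' cyl l.1)
    (Filter.Eventually.of_forall fun n l => (ediam_code_image_cyl_le q _).trans
      (by gcongr 2 * ?_; exact pow_le_pow_right_of_le_one' (by simp) (hlen n l)))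
    (Filter.Eventually.of_forall fun n => by
      rintro _ ⟨x, hx, rfl⟩
      obtain ⟨l, hl, hxl⟩ := mem_cov.1 (hC n hx)
      exact mem_iUnion.2 ⟨⟨l, hl⟩, x, hxl, rfl⟩)
  refine le_antisymm (key.trans ?_) zero_le
  have hb (n : ℕ) : ∑' l : C n, ediam (code q '' cyl l.1) ^ s ≤ 2 ^ s * ρ ^ n := by
    calc ∑' l : C n, ediam (code q '' cyl l.1) ^ s
        ≤ ∑' l : C n, 2 ^ s * ρ ^ l.1.length := by
          refine ENNReal.tsum_le_tsum fun l => ?_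
          refine (ENNReal.rpow_le_rpow (ediam_code_image_cyl_le q _) hs.le).trans (le_of_eq ?_)
          rw [ENNReal.mul_rpow_of_nonneg _ _ hs.le, ← ENNReal.rpow_natCast, ← ENNReal.rpow_mul,
            mul_comm (_ : ℝ) s, ENNReal.rpow_mul, ENNReal.rpow_natCast]
      _ = 2 ^ s * wt (fun l => ρ ^ l.length) (C n) := by
          rw [ENNReal.tsum_mul_left, wt, tsum_subtype (C n) fun l => ρ ^ l.length]
      _ ≤ 2 ^ s * ρ ^ n := by gcongr; exact (hCw n).le
  refine (Filter.liminf_le_liminf (Filter.Eventually.of_forall hb)).trans (le_of_eq ?_)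
  exact (htend hρ1 (ENNReal.rpow_ne_top_of_nonneg hs.le (by simp))).liminf_eq

/-- Frostman's lemma for Borel subsets of the plane. -/
theorem exists_measure {A : Set Pl} (hA : MeasurableSet A) {s : ℝ} (hs : 0 < s)
    (h : μH[s] A ≠ 0) :
    ∃ K ⊆ A, IsCompact K ∧ ∃ μ : Measure Pl, IsFiniteMeasure μ ∧ μ K ≠ 0 ∧ μ Kᶜ = 0 ∧
      (∀ x ∈ K, ∀ y ∈ K, ∀ i, |x i - y i| ≤ 1) ∧
      ∀ (p : Pl) (n : ℕ), μ {x | ∀ i, |x i - p i| ≤ (2 ^ n)⁻¹} ≤ 16 * ((2⁻¹ : ℝ≥0∞) ^ s) ^ n := by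
  have hcov : A ⊆ ⋃ q, code q '' (code q ⁻¹' A) := by
    intro p hp
    obtain ⟨q, x, rfl⟩ := exists_code_eq p
    exact mem_iUnion.2 ⟨q, x, hp, rfl⟩
  obtain ⟨q, hq⟩ : ∃ q, μH[s] (code q '' (code q ⁻¹' A)) ≠ 0 := by
    by_contra! hall
    exact h (measure_mono_null hcov (measure_iUnion_null hall))
  obtain ⟨K, hKA, hK, μ, hμ, hμK, hμKc, hcyl⟩ :=
    exists_measure_of_analyticSet (w := fun l => ((2⁻¹ : ℝ≥0∞) ^ s) ^ l.length)
      (((continuous_code q).measurable hA).analyticSet)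
      (fun l => ENNReal.pow_ne_top (rpow_two_inv_lt_one hs).ne_top)
      (fun h0 => hq (hausdorffMeasure_code_image_eq_zero hs q h0))
  have hc := continuous_code q
  have hKm : MeasurableSet (code q '' K) := (hK.image hc).isClosed.measurableSet
  refine ⟨code q '' K, image_subset_iff.2 hKA, hK.image hc, μ.map (code q), inferInstance,
    ?_, ?_, ?_, fun p n => ?_⟩
  · rw [Measure.map_apply hc.measurable hKm]
    exact fun h0 => hμK (measure_mono_null (subset_preimage_image _ _) h0)
  · rw [Measure.map_apply hc.measurable hKm.compl]
    exact measure_mono_null (by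
      rw [preimage_compl]; exact compl_subset_compl.2 (subset_preimage_image _ _)) hμKc
  · rintro _ ⟨x, -, rfl⟩ _ ⟨y, -, rfl⟩ i
    have h0 (d : ℕ → Fin 2) := Real.ofDigits_nonneg d
    have h1 (d : ℕ → Fin 2) := Real.ofDigits_le_one d
    have (d e : ℕ → Fin 2) : |Real.ofDigits d - Real.ofDigits e| ≤ 1 :=
      abs_le.2 ⟨by linarith [h0 d, h1 e], by linarith [h0 e, h1 d]⟩
    fin_cases i <;> simpa [code] using this _ _
  · rw [Measure.map_apply hc.measurable]
    · exact measure_box_le hcyl q p n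
    · refine IsClosed.measurableSet ?_
      simp only [ofPred_forall]
      exact isClosed_iInter fun i => isClosed_le (by fun_prop) continuous_const

end PlaneFrostman

namespace SlopeProjection

/-- The Euclidean plane. -/
local notation "Pl" => EuclideanSpace ℝ (Fin 2)

/-- The projection of the plane along the direction `(1, a)` to the second coordinate axis. -/
def proj (a : ℝ) (x : Pl) : ℝ := x 1 - a * x 0

theorem proj_sub (a : ℝ) (x y : Pl) : proj a (x - y) = proj a x - proj a y := by
  simp only [proj, PiLp.sub_apply]; ring

theorem continuous_proj : Continuous fun p : ℝ × Pl => proj p.1 p.2 := by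
  unfold proj; fun_prop

theorem exists_dyadic_scale {z : Pl} (hz : ∀ i, |z i| ≤ 1) (k : ℕ) :
    ∃ j ≤ k, (∀ i, |z i| ≤ (2 ^ j)⁻¹) ∧ (j = k ∨ ∃ i, (2 ^ (j + 1))⁻¹ < |z i|) := by
  induction k with
  | zero => exact ⟨0, le_rfl, by simpa using hz, Or.inl rfl⟩
  | succ k ih =>
    obtain ⟨j, hj, hzj, rfl | h⟩ := ih
    · by_cases h : ∀ i, |z i| ≤ (2 ^ (j + 1))⁻¹
      · exact ⟨j + 1, le_rfl, h, Or.inl rfl⟩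
      · push Not at h
        exact ⟨j, by omega, hzj, Or.inr h⟩
    · exact ⟨j, by omega, hzj, Or.inr h⟩

theorem volume_slopes_le_of_scale {z : Pl} {R : ℕ} (hR : 1 ≤ R) {i j k : ℕ} (hk : i + j = k)
    (h : j = k ∨ ∃ i, (2 ^ (j + 1))⁻¹ < |z i|) :
    (volume.restrict (Icc (-R : ℝ) R)) {a | |proj a z| ≤ (2 ^ k)⁻¹} ≤ 8 * R * 2⁻¹ ^ i := by
  have hR' : (1 : ℝ) ≤ R := by exact_mod_cast hR
  have hc : (8 * R * 2⁻¹ ^ i : ℝ≥0∞) = ENNReal.ofReal (8 * R * (2 ^ i)⁻¹) := by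
    rw [ENNReal.ofReal_mul (by positivity), ENNReal.ofReal_mul (by positivity),
      ENNReal.ofReal_inv_of_pos (by positivity), ENNReal.ofReal_pow (by norm_num), ENNReal.inv_pow]
    simp
  have htriv : i ≤ 1 → (volume.restrict (Icc (-R : ℝ) R)) {a | |proj a z| ≤ (2 ^ k)⁻¹} ≤
      8 * R * 2⁻¹ ^ i := by
    intro hi
    refine (measure_mono (subset_univ _)).trans ?_
    rw [Measure.restrict_apply_univ, Real.volume_Icc, hc]
    refine ENNReal.ofReal_le_ofReal ?_
    have : (2 : ℝ)⁻¹ ≤ (2 ^ i)⁻¹ := by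
      gcongr
      calc (2 : ℝ) ^ i ≤ 2 ^ 1 := by gcongr; norm_num
        _ = 2 := by norm_num
    nlinarith
  rcases h with h | ⟨m, hm⟩
  · exact htriv (by omega)
  by_cases h0 : (2 ^ (j + 1))⁻¹ ≤ 2 * R * |z 0|
  · have hz0 : 0 < |z 0| := by
      by_contra! hle
      have : (0 : ℝ) < (2 ^ (j + 1))⁻¹ := by positivity
      nlinarith
    refine (Measure.restrict_apply_le _ _).trans ?_
    have hsub : {a | |proj a z| ≤ (2 ^ k)⁻¹} ⊆
        closedBall (z 1 / z 0) ((2 ^ k)⁻¹ / |z 0|) := by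
      intro a ha
      rw [mem_closedBall, Real.dist_eq, le_div_iff₀ hz0, ← abs_mul, sub_mul,
        div_mul_cancel₀ _ (abs_pos.1 hz0), abs_sub_comm]
      exact ha
    refine (measure_mono hsub).trans ?_
    rw [Real.volume_closedBall, hc]
    refine ENNReal.ofReal_le_ofReal ?_
    rw [← mul_div_assoc, div_le_iff₀ hz0, ← hk, pow_add]
    have h1 : (0 : ℝ) < 2 ^ i := by positivity
    have h2 : (0 : ℝ) < 2 ^ j := by positivity
    rw [pow_succ] at h0
    calc 2 * ((2 : ℝ) ^ i * 2 ^ j)⁻¹ = 4 * (2 ^ i)⁻¹ * (2 ^ j * 2)⁻¹ := by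
          field_simp; norm_num
      _ ≤ 4 * (2 ^ i)⁻¹ * (2 * R * |z 0|) := by gcongr
      _ = 8 * R * (2 ^ i)⁻¹ * |z 0| := by ring
  · push Not at h0
    by_cases hi : i ≤ 1
    · exact htriv hi
    have hm1 : (2 ^ (j + 1))⁻¹ < |z 1| := by
      fin_cases m
      · have : |z 0| ≤ 2 * R * |z 0| := by nlinarith [abs_nonneg (z 0)]
        exact absurd (hm.trans_le this) (not_lt.2 h0.le)
      · exact hm
    have hempty : {a | |proj a z| ≤ (2 ^ k)⁻¹} ∩ Icc (-R : ℝ) R = ∅ := by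
      refine eq_empty_of_forall_notMem fun a ⟨ha, haR⟩ => ?_
      have ha' : |z 1 - a * z 0| ≤ (2 ^ k)⁻¹ := ha
      have h1 : |a * z 0| ≤ R * |z 0| := by
        rw [abs_mul]; gcongr; exact abs_le.2 haR
      have h2 : |z 1| ≤ |z 1 - a * z 0| + |a * z 0| := by
        simpa using abs_add_le (z 1 - a * z 0) (a * z 0)
      have h3 : ((2 : ℝ) ^ k)⁻¹ ≤ (2 ^ (j + 2))⁻¹ := by
        gcongr
        · norm_num
        · omega
      have h4 : ((2 : ℝ) ^ (j + 2))⁻¹ = (2 ^ (j + 1))⁻¹ / 2 := by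
        rw [pow_succ _ (j + 1), mul_inv]; ring
      linarith
    rw [Measure.restrict_apply' measurableSet_Icc, hempty, measure_empty]
    exact zero_le

theorem volume_slopes_le {z : Pl} (hz : ∀ i, |z i| ≤ 1) {R : ℕ} (hR : 1 ≤ R) (k : ℕ) :
    (volume.restrict (Icc (-R : ℝ) R)) {a | |proj a z| ≤ (2 ^ k)⁻¹} ≤
      ∑ p ∈ Finset.HasAntidiagonal.antidiagonal k, 8 * (R : ℝ≥0∞) * 2⁻¹ ^ p.1 *
        {z : Pl | ∀ i, |z i| ≤ (2 ^ p.2)⁻¹}.indicator (1 : Pl → ℝ≥0∞) z := by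
  obtain ⟨j, hj, hzj, h⟩ := exists_dyadic_scale hz k
  have hp : (k - j, j) ∈ Finset.HasAntidiagonal.antidiagonal k := by simp; omega
  refine le_trans ?_ (Finset.single_le_sum (f := fun p : ℕ × ℕ => (8 * R * 2⁻¹ ^ p.1 *
    {z : Pl | ∀ i, |z i| ≤ (2 ^ p.2)⁻¹}.indicator 1 z : ℝ≥0∞)) (fun _ _ => zero_le) hp)
  rw [indicator_of_mem (by exact hzj), Pi.one_apply, mul_one]
  exact volume_slopes_le_of_scale hR (by omega) h

theorem tsum_sum_antidiagonal (f g : ℕ → ℝ≥0∞) :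
    ∑' k, ∑ p ∈ Finset.HasAntidiagonal.antidiagonal k, f p.1 * g p.2 = (∑' i, f i) * ∑' j, g j := by
  calc ∑' k, ∑ p ∈ Finset.HasAntidiagonal.antidiagonal k, f p.1 * g p.2
      = ∑' k, ∑' p : Finset.HasAntidiagonal.antidiagonal k, f p.1.1 * g p.1.2 := by
        refine tsum_congr fun k => ?_
        exact (Finset.tsum_subtype (Finset.HasAntidiagonal.antidiagonal k)
          fun p : ℕ × ℕ => f p.1 * g p.2).symm
    _ = ∑' p : ℕ × ℕ, f p.1 * g p.2 := by
        rw [← ENNReal.tsum_sigma' fun q : Σ k, Finset.HasAntidiagonal.antidiagonal k => f q.2.1.1 * g q.2.1.2]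
        exact Finset.HasAntidiagonal.sigmaAntidiagonalEquivProd.tsum_eq fun p : ℕ × ℕ => f p.1 * g p.2
    _ = (∑' i, f i) * ∑' j, g j := by
        rw [ENNReal.tsum_prod (f := fun i j => f i * g j)]
        simp_rw [ENNReal.tsum_mul_left, ENNReal.tsum_mul_right]

theorem two_rpow_mul_lt_one {t s : ℝ} (h : t < s) : (2 : ℝ≥0∞) ^ t * 2⁻¹ ^ s < 1 := by
  rw [ENNReal.inv_rpow, ← div_eq_mul_inv,
    ENNReal.div_lt_iff (Or.inr (by simp)) (Or.inr (by simp)), one_mul]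
  exact ENNReal.rpow_lt_rpow_of_exponent_lt (by norm_num) (by norm_num) h

variable {μ : Measure Pl} [IsFiniteMeasure μ] {s t : ℝ} {K : Set Pl}

/-- The closed set of pairs at projected distance at most `2 ^ (-k)`. -/
def near (k : ℕ) : Set ((ℝ × Pl) × Pl) := {p | |proj p.1.1 (p.1.2 - p.2)| ≤ (2 ^ k)⁻¹}

theorem measurableSet_near (k : ℕ) : MeasurableSet (near k) := by
  refine IsClosed.measurableSet (isClosed_le ?_ continuous_const)
  exact (continuous_proj.comp (f := fun p : (ℝ × Pl) × Pl => (p.1.1, p.1.2 - p.2))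
    (by fun_prop)).abs

theorem lintegral_measure_strip_le {x : Pl} (hμK : μ Kᶜ = 0) (hx : ∀ y ∈ K, ∀ i, |x i - y i| ≤ 1)
    (hμ : ∀ n : ℕ, μ {y | ∀ i, |y i - x i| ≤ (2 ^ n)⁻¹} ≤ 16 * ((2⁻¹ : ℝ≥0∞) ^ s) ^ n)
    {R : ℕ} (hR : 1 ≤ R) (k : ℕ) :
    ∫⁻ a in Icc (-R : ℝ) R, μ {y | |proj a (x - y)| ≤ (2 ^ k)⁻¹} ≤
      ∑ p ∈ Finset.HasAntidiagonal.antidiagonal k, 8 * (R : ℝ≥0∞) * 2⁻¹ ^ p.1 * (16 * ((2⁻¹ : ℝ≥0∞) ^ s) ^ p.2) := by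
  set S : Set (ℝ × Pl) := {p | |proj p.1 (x - p.2)| ≤ (2 ^ k)⁻¹}
  have hS : MeasurableSet S := by
    refine IsClosed.measurableSet (isClosed_le ?_ continuous_const)
    exact (continuous_proj.comp (f := fun p : ℝ × Pl => (p.1, x - p.2)) (by fun_prop)).abs
  have hbox (n : ℕ) : MeasurableSet {y : Pl | ∀ i, |y i - x i| ≤ (2 ^ n)⁻¹} := by
    refine IsClosed.measurableSet ?_
    simp only [ofPred_forall]
    exact isClosed_iInter fun i => isClosed_le (by fun_prop) continuous_const
  calc ∫⁻ a in Icc (-R : ℝ) R, μ {y | |proj a (x - y)| ≤ (2 ^ k)⁻¹}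
      = ((volume.restrict (Icc (-R : ℝ) R)).prod μ) S := (Measure.prod_apply hS).symm
    _ = ∫⁻ y, (volume.restrict (Icc (-R : ℝ) R)) {a | |proj a (x - y)| ≤ (2 ^ k)⁻¹} ∂μ :=
        Measure.prod_apply_symm hS
    _ ≤ ∫⁻ y, ∑ p ∈ Finset.HasAntidiagonal.antidiagonal k, 8 * (R : ℝ≥0∞) * 2⁻¹ ^ p.1 *
          {y : Pl | ∀ i, |y i - x i| ≤ (2 ^ p.2)⁻¹}.indicator 1 y ∂μ := by
        refine lintegral_mono_ae ?_
        filter_upwards [measure_eq_zero_iff_ae_notMem.1 hμK] with y hy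
        rw [notMem_compl_iff] at hy
        refine (volume_slopes_le (z := x - y) (hx y hy) hR k).trans (le_of_eq ?_)
        refine Finset.sum_congr rfl fun p _ => ?_
        congr 1
        simp only [indicator, mem_ofPred_eq, PiLp.sub_apply, abs_sub_comm, Pi.one_apply]
        congr
    _ = ∑ p ∈ Finset.HasAntidiagonal.antidiagonal k, 8 * (R : ℝ≥0∞) * 2⁻¹ ^ p.1 *
          μ {y : Pl | ∀ i, |y i - x i| ≤ (2 ^ p.2)⁻¹} := by
        rw [lintegral_finsetSum _ fun p _ =>
          (measurable_one.indicator (hbox p.2)).const_mul _]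
        refine Finset.sum_congr rfl fun p _ => ?_
        rw [lintegral_const_mul _ (measurable_one.indicator (hbox p.2)),
          lintegral_indicator_one (hbox p.2)]
    _ ≤ _ := by
        gcongr with p hp
        exact hμ p.2

theorem ae_tsum_strip_ne_top (ht1 : t < 1) (hts : t < s) {x : Pl}
    (hμK : μ Kᶜ = 0) (hx : ∀ y ∈ K, ∀ i, |x i - y i| ≤ 1)
    (hμ : ∀ n : ℕ, μ {y | ∀ i, |y i - x i| ≤ (2 ^ n)⁻¹} ≤ 16 * ((2⁻¹ : ℝ≥0∞) ^ s) ^ n) :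
    ∀ᵐ a : ℝ, ∑' k : ℕ, ((2 : ℝ≥0∞) ^ t) ^ k * μ {y | |proj a (x - y)| ≤ (2 ^ k)⁻¹} ≠ ∞ := by
  have hmeas (k : ℕ) : Measurable fun a : ℝ => μ {y | |proj a (x - y)| ≤ (2 ^ k)⁻¹} :=
    (measurable_measure_prodMk_left (ν := μ) (measurableSet_near k)).comp
      (f := fun a : ℝ => (a, x)) (by fun_prop)
  have hR (n : ℕ) : ∀ᵐ a ∂volume.restrict (Icc (-((n + 1 : ℕ) : ℝ)) (n + 1 : ℕ)),
      ∑' k : ℕ, ((2 : ℝ≥0∞) ^ t) ^ k * μ {y | |proj a (x - y)| ≤ (2 ^ k)⁻¹} ≠ ∞ := by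
    have hlt : ∫⁻ a in Icc (-((n + 1 : ℕ) : ℝ)) (n + 1 : ℕ), ∑' k : ℕ, ((2 : ℝ≥0∞) ^ t) ^ k *
        μ {y | |proj a (x - y)| ≤ (2 ^ k)⁻¹} ≠ ∞ := by
      rw [lintegral_tsum fun k => ((hmeas k).const_mul _).aemeasurable]
      simp_rw [lintegral_const_mul _ (hmeas _)]
      refine ne_top_of_le_ne_top ?_ (ENNReal.tsum_le_tsum fun k =>
        mul_le_mul_right (lintegral_measure_strip_le hμK hx hμ (Nat.le_add_left 1 n) k) _)
      have heq (k : ℕ) : ((2 : ℝ≥0∞) ^ t) ^ k * ∑ p ∈ Finset.HasAntidiagonal.antidiagonal k,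
          8 * ((n + 1 : ℕ) : ℝ≥0∞) * 2⁻¹ ^ p.1 * (16 * ((2⁻¹ : ℝ≥0∞) ^ s) ^ p.2) =
          8 * ((n + 1 : ℕ) : ℝ≥0∞) * 16 * ∑ p ∈ Finset.HasAntidiagonal.antidiagonal k,
            (2 ^ t * 2⁻¹ ^ (1 : ℝ)) ^ p.1 * (2 ^ t * 2⁻¹ ^ s) ^ p.2 := by
        rw [Finset.mul_sum, Finset.mul_sum]
        refine Finset.sum_congr rfl fun p hp => ?_
        rw [← Finset.HasAntidiagonal.mem_antidiagonal.1 hp, pow_add, mul_pow, mul_pow, ENNReal.rpow_one]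
        ring
      simp_rw [heq]
      rw [ENNReal.tsum_mul_left, tsum_sum_antidiagonal (fun i => (2 ^ t * 2⁻¹ ^ (1 : ℝ)) ^ i)
        fun j => (2 ^ t * 2⁻¹ ^ s) ^ j, ENNReal.tsum_geometric, ENNReal.tsum_geometric]
      have hsub {r : ℝ≥0∞} (hr : r < 1) : (1 - r)⁻¹ ≠ ∞ :=
        ENNReal.inv_ne_top.2 (tsub_pos_of_lt hr).ne'
      exact ENNReal.mul_ne_top (by finiteness)
        (ENNReal.mul_ne_top (hsub (two_rpow_mul_lt_one ht1)) (hsub (two_rpow_mul_lt_one hts)))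
    filter_upwards [ae_lt_top (Measurable.tsum fun k => (hmeas k).const_mul _) hlt]
      with a ha using ha.ne
  have hcov : ⋃ n : ℕ, Icc (-((n + 1 : ℕ) : ℝ)) (n + 1 : ℕ) = univ := by
    refine eq_univ_of_forall fun a => mem_iUnion.2 ?_
    obtain ⟨n, hn⟩ := exists_nat_ge |a|
    exact ⟨n, abs_le.1 (hn.trans (by push_cast; linarith))⟩
  rw [← Measure.restrict_univ (μ := volume), ← hcov, ae_restrict_iUnion_iff]
  exact hR

omit [IsFiniteMeasure μ] in
theorem hausdorffMeasure_image_ne_zero (ht0 : 0 < t) {a : ℝ} {G : Set Pl} (hG : μ G ≠ 0)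
    {c : ℝ≥0∞} (hc0 : c ≠ 0) (hc : c ≠ ∞)
    (h : ∀ x ∈ G, ∀ k : ℕ, ((2 : ℝ≥0∞) ^ t) ^ k * μ {y | |proj a (x - y)| ≤ (2 ^ k)⁻¹} ≤ c) :
    μH[t] (proj a '' G) ≠ 0 := by
  have hcont : Continuous (proj a) := by unfold proj; fun_prop
  set θ : ℝ≥0∞ := 2 ^ t
  have hθ0 : θ ≠ 0 := (ENNReal.rpow_pos (by simp) (by simp)).ne'
  have hθ : θ ≠ ∞ := by simp [θ]
  have hθ1 : 1 < θ := ENNReal.one_lt_rpow (by norm_num) ht0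
  set σ : Measure ℝ := (c * θ)⁻¹ • (μ.restrict G).map (proj a)
  have hσ : ∀ S : Set ℝ, ediam S ≤ 1 → σ S ≤ ediam S ^ t := by
    intro S hS
    refine (measure_mono subset_closure).trans ?_
    rw [← ediam_closure] at hS ⊢
    have hSm : MeasurableSet (closure S) := isClosed_closure.measurableSet
    generalize closure S = S at hS hSm
    rw [Measure.smul_apply, smul_eq_mul, Measure.map_apply hcont.measurable hSm,
      Measure.restrict_apply (hcont.measurable hSm)]
    rcases (proj a ⁻¹' S ∩ G).eq_empty_or_nonempty with h0 | ⟨x, hxS, hxG⟩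
    · simp [h0]
    have hk (k : ℕ) (hk : ediam S ≤ ENNReal.ofReal (2⁻¹ ^ k)) :
        θ ^ k * μ (proj a ⁻¹' S ∩ G) ≤ c := by
      refine le_trans (mul_le_mul_right (measure_mono ?_) _) (h x hxG k)
      rintro y ⟨hyS, -⟩
      rw [mem_ofPred_eq, proj_sub, ← Real.dist_eq, ← inv_pow,
        ← ENNReal.ofReal_le_ofReal_iff (by positivity), ← edist_dist]
      exact (edist_le_ediam_of_mem (mem_preimage.1 hxS) (mem_preimage.1 hyS)).trans hk
    rw [mul_comm, ← div_eq_mul_inv, ENNReal.div_le_iff (mul_ne_zero hc0 hθ0)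
      (ENNReal.mul_ne_top hc hθ)]
    rcases eq_or_ne (ediam S) 0 with h0 | h0
    · have : μ (proj a ⁻¹' S ∩ G) = 0 := by
        by_contra hne
        have h1 (k : ℕ) : θ ^ k * μ (proj a ⁻¹' S ∩ G) ≤ c := hk k (by simp [h0])
        have h2 := ENNReal.Tendsto.mul_const (b := μ (proj a ⁻¹' S ∩ G))
          (ENNReal.tendsto_pow_atTop_nhds_top_iff.2 hθ1) (Or.inl (by simp))
        rw [ENNReal.top_mul hne] at h2
        exact hc (top_le_iff.1 (le_of_tendsto' h2 h1))
      simp [this]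
    · have htop : ediam S ≠ ∞ := ne_top_of_le_ne_top (by simp) hS
      obtain ⟨k, hk1, hk2⟩ := exists_nat_pow_near_of_lt_one (ENNReal.toReal_pos h0 htop)
        (by simpa using ENNReal.toReal_mono (by simp) hS) (y := (2⁻¹ : ℝ)) (by norm_num)
        (by norm_num)
      have hle := hk k ((ENNReal.le_ofReal_iff_toReal_le htop (by positivity)).2 hk2)
      have hθd : 1 ≤ θ ^ (k + 1) * ediam S ^ t := by
        have : ENNReal.ofReal (2⁻¹ ^ (k + 1)) ≤ ediam S := by
          rw [ENNReal.ofReal_le_iff_le_toReal htop]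
          exact hk1.le
        calc (1 : ℝ≥0∞) = θ ^ (k + 1) * ENNReal.ofReal (2⁻¹ ^ (k + 1)) ^ t := by
              rw [ENNReal.ofReal_pow (by norm_num), ENNReal.ofReal_inv_of_pos (by norm_num),
                ← ENNReal.rpow_natCast _ (k + 1), ← ENNReal.rpow_natCast _ (k + 1),
                ← ENNReal.rpow_mul, ← ENNReal.rpow_mul, mul_comm t, ENNReal.inv_rpow]
              rw [ENNReal.ofReal_ofNat, ENNReal.mul_inv_cancel] <;> simp
          _ ≤ _ := by gcongr
      calc μ (proj a ⁻¹' S ∩ G) ≤ θ ^ (k + 1) * ediam S ^ t * μ (proj a ⁻¹' S ∩ G) :=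
            le_mul_of_one_le_left' hθd
        _ = ediam S ^ t * θ * (θ ^ k * μ (proj a ⁻¹' S ∩ G)) := by rw [pow_succ]; ring
        _ ≤ ediam S ^ t * θ * c := by gcongr
        _ = ediam S ^ t * (c * θ) := by ring
  intro h0
  have hle := Measure.le_hausdorffMeasure t σ 1 one_pos hσ
  have hσ0 : σ (proj a '' G) = 0 := le_antisymm ((hle _).trans h0.le) zero_le
  rw [Measure.smul_apply, smul_eq_mul, mul_eq_zero] at hσ0
  rcases hσ0 with hσ0 | hσ0
  · exact ENNReal.mul_ne_top hc hθ (ENNReal.inv_eq_zero.1 hσ0)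
  · have := Measure.le_map_apply hcont.measurable.aemeasurable (proj a '' G) (μ := μ.restrict G)
    rw [hσ0, nonpos_iff_eq_zero] at this
    refine hG (measure_mono_null (t := proj a ⁻¹' (proj a '' G) ∩ G)
      (fun x hx => ⟨⟨x, hx, rfl⟩, hx⟩) ?_)
    exact le_antisymm ((Measure.le_restrict_apply _ _).trans this.le) zero_le

theorem ae_hausdorffMeasure_image_ne_zero (ht0 : 0 < t) (ht1 : t < 1) (hts : t < s)
    (hμ0 : μ K ≠ 0) (hμK : μ Kᶜ = 0) (hK : ∀ x ∈ K, ∀ y ∈ K, ∀ i, |x i - y i| ≤ 1)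
    (hμ : ∀ (p : Pl) (n : ℕ), μ {x | ∀ i, |x i - p i| ≤ (2 ^ n)⁻¹} ≤
      16 * ((2⁻¹ : ℝ≥0∞) ^ s) ^ n) :
    ∀ᵐ a : ℝ, μH[t] (proj a '' K) ≠ 0 := by
  have hae : ∀ᵐ x ∂μ, ∀ᵐ a : ℝ,
      ∑' k : ℕ, ((2 : ℝ≥0∞) ^ t) ^ k * μ {y | |proj a (x - y)| ≤ (2 ^ k)⁻¹} ≠ ∞ := by
    filter_upwards [measure_eq_zero_iff_ae_notMem.1 hμK] with x hx
    rw [notMem_compl_iff] at hx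
    exact ae_tsum_strip_ne_top ht1 hts hμK (hK x hx) (hμ x)
  rw [Measure.ae_ae_comm] at hae
  · filter_upwards [hae] with a ha
    set G : ℕ → Set Pl := fun n => {x ∈ K | ∀ k : ℕ,
      ((2 : ℝ≥0∞) ^ t) ^ k * μ {y | |proj a (x - y)| ≤ (2 ^ k)⁻¹} ≤ (n + 1 : ℕ)}
    obtain ⟨n, hn⟩ : ∃ n, μ (G n) ≠ 0 := by
      by_contra! hall
      refine hμ0 (measure_mono_null (t := _ ∪ ⋃ n, G n) (fun x hx => ?_)
        (measure_union_null (ae_iff.1 ha) (measure_iUnion_null hall)))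
      by_cases hfin : ∑' k : ℕ, ((2 : ℝ≥0∞) ^ t) ^ k * μ {y | |proj a (x - y)| ≤ (2 ^ k)⁻¹} ≠ ∞
      · obtain ⟨n, hn⟩ := ENNReal.exists_nat_gt hfin
        refine Or.inr (mem_iUnion.2 ⟨n, hx, fun k => (ENNReal.le_tsum k).trans (hn.le.trans ?_)⟩)
        exact_mod_cast Nat.le_succ n
      · exact Or.inl (not_not_intro (not_not.1 hfin))
    have := hausdorffMeasure_image_ne_zero ht0 hn (c := (n + 1 : ℕ)) (by simp)
      (ENNReal.natCast_ne_top _) fun x hx => hx.2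
    exact fun h0 => this (measure_mono_null (image_mono fun x hx => hx.1) h0)
  · have hmeas (k : ℕ) : Measurable fun p : Pl × ℝ =>
        μ {y | |proj p.2 (p.1 - y)| ≤ (2 ^ k)⁻¹} :=
      (measurable_measure_prodMk_left (ν := μ) (measurableSet_near k)).comp
        (f := fun p : Pl × ℝ => (p.2, p.1)) (by fun_prop)
    have : Measurable fun p : Pl × ℝ => ∑' k : ℕ, ((2 : ℝ≥0∞) ^ t) ^ k *
        μ {y | |proj p.2 (p.1 - y)| ≤ (2 ^ k)⁻¹} :=
      Measurable.tsum fun k => (hmeas k).const_mul _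
    exact this (measurableSet_singleton _).compl

/-- Marstrand's projection theorem for the projections parametrized by slopes. -/
theorem ae_dimH_le_dimH_image {A : Set Pl} (hA : MeasurableSet A) (hdim : dimH A ≤ 1) :
    ∀ᵐ a : ℝ, dimH A ≤ dimH (proj a '' A) := by
  have key (t : NNReal) (ht : (t : ℝ≥0∞) < dimH A) : ∀ᵐ a : ℝ, (t : ℝ≥0∞) ≤ dimH (proj a '' A) := by
    rcases eq_or_ne t 0 with rfl | ht0
    · simp
    have ht0' : (0 : ℝ) < t := by exact_mod_cast pos_iff_ne_zero.2 ht0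
    obtain ⟨s, hts, hs⟩ := ENNReal.lt_iff_exists_nnreal_btwn.1 ht
    have hts' : (t : ℝ) < s := by exact_mod_cast hts
    have ht1 : (t : ℝ) < 1 := by exact_mod_cast ht.trans_le hdim
    obtain ⟨K, hKA, -, μ, _, h0, hc, hK, hμ⟩ := PlaneFrostman.exists_measure hA
      (ht0'.trans hts') (s := s) (by rw [hausdorffMeasure_of_lt_dimH hs]; simp)
    filter_upwards [ae_hausdorffMeasure_image_ne_zero ht0' ht1 hts' h0 hc hK hμ] with a ha
    exact (le_dimH_of_hausdorffMeasure_ne_zero ha).trans (dimH_mono (image_mono hKA))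
  have : ∀ᵐ a : ℝ, ∀ q : ℚ, (Real.toNNReal q : ℝ≥0∞) < dimH A →
      (Real.toNNReal q : ℝ≥0∞) ≤ dimH (proj a '' A) :=
    ae_all_iff.2 fun q => by
      by_cases hq : (Real.toNNReal q : ℝ≥0∞) < dimH A
      · filter_upwards [key _ hq] with a ha _ using ha
      · exact Filter.Eventually.of_forall fun a h => absurd h hq
  filter_upwards [this] with a ha
  refine le_of_forall_lt fun c hc => ?_
  obtain ⟨q, -, hcq, hq⟩ := ENNReal.lt_iff_exists_rat_btwn.1 hc
  exact hcq.trans_le (ha q hq)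

end SlopeProjection

namespace NormProjection

/-- The Euclidean plane. -/
local notation "Pl" => EuclideanSpace ℝ (Fin 2)

open SlopeProjection Filter Topology

theorem inner_eq (x y : Pl) : ⟪x, y⟫ = x 0 * y 0 + x 1 * y 1 := by
  simp [PiLp.inner_apply, Fin.sum_univ_two, mul_comm]

theorem eq_smul_of_inner_eq_zero {v d w : Pl} (hv : v ≠ 0) (hd : ⟪v, d⟫ = 0) (hw : ⟪v, w⟫ = 0) :
    ⟪d, d⟫ • w = ⟪d, w⟫ • d := by
  have hcross : d 0 * w 1 - d 1 * w 0 = 0 := by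
    rw [inner_eq] at hd hw
    by_contra hne
    refine hv (PiLp.ext fun i => ?_)
    have h0 : (d 0 * w 1 - d 1 * w 0) * v 0 = 0 := by linear_combination w 1 * hd - d 1 * hw
    have h1 : (d 0 * w 1 - d 1 * w 0) * v 1 = 0 := by linear_combination d 0 * hw - w 0 * hd
    fin_cases i
    · exact (mul_eq_zero.1 h0).resolve_left hne
    · exact (mul_eq_zero.1 h1).resolve_left hne
  ext i
  simp only [inner_eq, PiLp.smul_apply, smul_eq_mul]
  fin_cases i
  · simp only [Fin.zero_eta]; linear_combination -d 1 * hcross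
  · simp only [Fin.mk_one]; linear_combination d 0 * hcross

variable {N : Pl → ℝ}

section Basic

variable (hN_smul : ∀ (c : ℝ) (x : Pl), N (c • x) = |c| * N x)
  (hN_add : ∀ x y : Pl, N (x + y) ≤ N x + N y) (hN_zero : ∀ x : Pl, N x = 0 → x = 0)

include hN_smul in
theorem map_zero : N 0 = 0 := by simpa using hN_smul 0 0

include hN_smul hN_add in
theorem nonneg (x : Pl) : 0 ≤ N x := by
  have h := hN_add x ((-1 : ℝ) • x)
  rw [hN_smul, neg_one_smul, add_neg_cancel, map_zero hN_smul] at h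
  norm_num at h
  linarith

include hN_smul hN_add hN_zero in
theorem pos {x : Pl} (hx : x ≠ 0) : 0 < N x :=
  (nonneg hN_smul hN_add x).lt_of_ne fun h => hx (hN_zero x h.symm)

include hN_smul hN_add hN_zero in
theorem minimizer_unique {γ : ℝ → Pl} (hγ_C2 : ContDiff ℝ 2 γ)
    (hγ_range : Set.range γ = {x : Pl | N x = 1}) (hγ_unit : ∀ t, ‖deriv γ t‖ = 1)
    (hγ_curv : ∀ t, deriv (deriv γ) t ≠ 0) {v u u' : Pl} (hu : ⟪v, u⟫ = 1) (hu' : ⟪v, u'⟫ = 1)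
    (hmin : ∀ w, ⟪v, w⟫ = 1 → N u ≤ N w) (hmin' : ∀ w, ⟪v, w⟫ = 1 → N u' ≤ N w) : u = u' := by
  have hv : v ≠ 0 := by rintro rfl; simp at hu
  have hu0 : u ≠ 0 := by rintro rfl; simp at hu
  by_contra hne
  set d := u' - u
  have hd : ⟪v, d⟫ = 0 := by simp [d, inner_sub_right, hu, hu']
  have hdd : ⟪d, d⟫ ≠ 0 := inner_self_ne_zero.2 (sub_ne_zero.2 (Ne.symm hne))
  have hn0 : 0 < N u := pos hN_smul hN_add hN_zero hu0
  have huu' : N u' = N u := le_antisymm (hmin' u hu) (hmin u' hu')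
  have hseg (τ : ℝ) (h0 : 0 ≤ τ) (h1 : τ ≤ 1) : N (u + τ • d) = N u := by
    refine le_antisymm ?_ (hmin _ (by simp [inner_add_right, inner_smul_right, hu, hd]))
    have : u + τ • d = (1 - τ) • u + τ • u' := by simp only [d]; module
    rw [this]
    refine (hN_add _ _).trans (le_of_eq ?_)
    rw [hN_smul, hN_smul, abs_of_nonneg (by linarith), abs_of_nonneg h0, huu']
    ring
  set m := u + (2⁻¹ : ℝ) • d
  have hm : ⟪v, m⟫ = 1 := by simp [m, inner_add_right, inner_smul_right, hu, hd]
  obtain ⟨t₀, ht₀⟩ : (N u)⁻¹ • m ∈ Set.range γ := by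
    rw [hγ_range, mem_ofPred_eq, hN_smul, hseg _ (by norm_num) (by norm_num),
      abs_of_pos (by positivity), inv_mul_cancel₀ hn0.ne']
  have hγc : Continuous γ := hγ_C2.continuous
  have hf0 : ⟪v, γ t₀⟫ = (N u)⁻¹ := by rw [ht₀, inner_smul_right, hm, mul_one]
  have hconst : (fun t => ⟪v, γ t⟫) =ᶠ[𝓝 t₀] fun _ => (N u)⁻¹ := by
    have hfc : Continuous fun t => ⟪v, γ t⟫ := by fun_prop
    have hf1 : ∀ᶠ t in 𝓝 t₀, 0 < ⟪v, γ t⟫ :=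
      hfc.continuousAt.eventually_const_lt (by beta_reduce; rw [hf0]; positivity)
    have hc : ContinuousAt (fun t => 2⁻¹ + ⟪d, ⟪v, γ t⟫⁻¹ • γ t - m⟫ / ⟪d, d⟫) t₀ := by
      have : ContinuousAt (fun t => ⟪v, γ t⟫⁻¹) t₀ :=
        hfc.continuousAt.inv₀ (by rw [hf0]; positivity)
      fun_prop
    have hc0 : 2⁻¹ + ⟪d, ⟪v, γ t₀⟫⁻¹ • γ t₀ - m⟫ / ⟪d, d⟫ = 2⁻¹ := by
      rw [hf0, ht₀, smul_smul, inv_mul_cancel₀ (by positivity)]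
      simp
    filter_upwards [hf1, hc.eventually_const_le (show (0 : ℝ) < _ by beta_reduce; rw [hc0]; norm_num),
      hc.eventually_le_const (show _ < (1 : ℝ) by beta_reduce; rw [hc0]; norm_num)] with t h1 h2 h3
    have hw : ⟪v, ⟪v, γ t⟫⁻¹ • γ t - m⟫ = 0 := by
      rw [inner_sub_right, inner_smul_right, hm, inv_mul_cancel₀ h1.ne', sub_self]
    have key := hseg _ h2 h3
    have hγ1 : N (γ t) = 1 := by
      have : γ t ∈ Set.range γ := ⟨t, rfl⟩
      rwa [hγ_range] at this
    have hpt : u + (2⁻¹ + ⟪d, ⟪v, γ t⟫⁻¹ • γ t - m⟫ / ⟪d, d⟫) • d = ⟪v, γ t⟫⁻¹ • γ t := by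
      have h := eq_smul_of_inner_eq_zero hv hd hw
      have : (⟪d, ⟪v, γ t⟫⁻¹ • γ t - m⟫ / ⟪d, d⟫) • d = ⟪v, γ t⟫⁻¹ • γ t - m := by
        rw [div_eq_inv_mul, mul_smul, ← h, smul_smul, inv_mul_cancel₀ hdd, one_smul]
      rw [add_smul, this]
      simp only [m]
      module
    rw [hpt, hN_smul, hγ1, mul_one, abs_of_pos (by positivity)] at key
    rw [← key, inv_inv]
  have hγd (t) : HasDerivAt γ (deriv γ t) t :=
    (hγ_C2.differentiable (by norm_num) t).hasDerivAt
  have hγ'C1 : ContDiff ℝ 1 (deriv γ) := by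
    have : ContDiff ℝ (1 + 1) γ := by simpa [one_add_one_eq_two] using hγ_C2
    exact (contDiff_succ_iff_deriv.1 this).2.2
  have hγdd (t) : HasDerivAt (deriv γ) (deriv (deriv γ) t) t :=
    (hγ'C1.differentiable (by norm_num) t).hasDerivAt
  have hd1 : deriv (fun t => ⟪v, γ t⟫) = fun t => ⟪v, deriv γ t⟫ := by
    ext t
    simpa using ((hasDerivAt_const t v).inner ℝ (hγd t)).deriv
  have h1 : ⟪v, deriv γ t₀⟫ = 0 := by
    rw [← congrFun hd1 t₀, hconst.deriv_eq, deriv_const]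
  have h2 : ⟪v, deriv (deriv γ) t₀⟫ = 0 := by
    have := hconst.deriv.deriv_eq
    rw [hd1] at this
    rw [← (by simpa using ((hasDerivAt_const t₀ v).inner ℝ (hγdd t₀)).deriv :
      deriv (fun t => ⟪v, deriv γ t⟫) t₀ = ⟪v, deriv (deriv γ) t₀⟫), this]
    simp
  have h3 : ⟪deriv γ t₀, deriv (deriv γ) t₀⟫ = 0 := by
    have h := ((hγdd t₀).inner ℝ (hγdd t₀)).deriv
    have hone : (fun t => ⟪deriv γ t, deriv γ t⟫) = fun _ => (1 : ℝ) := by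
      ext t; rw [real_inner_self_eq_norm_sq, hγ_unit]; norm_num
    rw [hone, deriv_const, real_inner_comm (deriv γ t₀)] at h
    linarith
  have h4 := eq_smul_of_inner_eq_zero hv h1 h2
  rw [h3, zero_smul, real_inner_self_eq_norm_sq, hγ_unit] at h4
  exact hγ_curv t₀ (by simpa using h4)

include hN_smul hN_add hN_zero in
theorem exists_direction {γ : ℝ → Pl} (hγ_C2 : ContDiff ℝ 2 γ)
    (hγ_range : Set.range γ = {x : Pl | N x = 1}) (hγ_unit : ∀ t, ‖deriv γ t‖ = 1)
    (hγ_curv : ∀ t, deriv (deriv γ) t ≠ 0) {v : Pl} (hv : ‖v‖ = 1) {p : Pl → Pl}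
    (hp : ∀ x : Pl, ⟪v, p x⟫ = 0 ∧ ∀ q : Pl, ⟪v, q⟫ = 0 → N (x - p x) ≤ N (x - q)) :
    ∃ u : Pl, ⟪v, u⟫ = 1 ∧ (∀ w, ⟪v, w⟫ = 1 → N u ≤ N w) ∧ ∀ x, p x = x - ⟪v, x⟫ • u := by
  have hmin (x : Pl) (hx : ⟪v, x⟫ ≠ 0) : ⟪v, ⟪v, x⟫⁻¹ • (x - p x)⟫ = 1 ∧
      ∀ w, ⟪v, w⟫ = 1 → N (⟪v, x⟫⁻¹ • (x - p x)) ≤ N w := by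
    refine ⟨?_, fun w hw => ?_⟩
    · rw [inner_smul_right, inner_sub_right, (hp x).1, sub_zero, inv_mul_cancel₀ hx]
    · have h := (hp x).2 (x - ⟪v, x⟫ • w) (by
        rw [inner_sub_right, inner_smul_right, hw, mul_one, sub_self])
      rw [sub_sub_cancel, hN_smul] at h
      rw [hN_smul, abs_inv, inv_mul_le_iff₀ (abs_pos.2 hx)]
      exact h
  have hvv : ⟪v, v⟫ = 1 := by rw [real_inner_self_eq_norm_sq, hv]; norm_num
  obtain ⟨h1, h2⟩ := hmin v (by rw [hvv]; norm_num)
  refine ⟨_, h1, h2, fun x => ?_⟩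
  by_cases hx : ⟪v, x⟫ = 0
  · have h := (hp x).2 x hx
    rw [sub_self, map_zero hN_smul] at h
    have := hN_zero _ (le_antisymm h (nonneg hN_smul hN_add _))
    rw [hx, zero_smul, sub_zero]
    exact (sub_eq_zero.1 this).symm
  · obtain ⟨h3, h4⟩ := hmin x hx
    rw [minimizer_unique hN_smul hN_add hN_zero hγ_C2 hγ_range hγ_unit hγ_curv h1 h3 h2 h4,
      smul_smul, mul_inv_cancel₀ hx, one_smul, sub_sub_cancel]

theorem hasDerivAt_line {e : Pl} (hN : DifferentiableAt ℝ N e) (w : Pl) :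
    HasDerivAt (fun τ : ℝ => N (e + τ • w)) ⟪gradient N e, w⟫ 0 := by
  have h1 : HasDerivAt (fun τ : ℝ => e + τ • w) w 0 := by
    simpa using ((hasDerivAt_id (0 : ℝ)).smul_const w).const_add e
  have h2 : HasFDerivAt N (InnerProductSpace.toDual ℝ Pl (gradient N e)) (e + (0 : ℝ) • w) := by
    rw [zero_smul, add_zero]
    exact hN.hasGradientAt.hasFDerivAt
  exact h2.comp_hasDerivAt (0 : ℝ) h1

include hN_smul hN_add hN_zero in
theorem gradient_ne_zero {e : Pl} (he : e ≠ 0) (hN : DifferentiableAt ℝ N e) :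
    gradient N e ≠ 0 := by
  intro h0
  have h1 : HasDerivAt (fun τ : ℝ => (1 + τ) * N e) (N e) 0 := by
    simpa using ((hasDerivAt_id (0 : ℝ)).const_add 1).mul_const (N e)
  have h2 : (fun τ : ℝ => N (e + τ • e)) =ᶠ[𝓝 0] fun τ => (1 + τ) * N e := by
    filter_upwards [lt_mem_nhds (show (-1 : ℝ) < 0 by norm_num)] with τ hτ
    rw [show e + τ • e = (1 + τ) • e by module, hN_smul, abs_of_pos (by linarith)]
  have h3 := (hasDerivAt_line hN e).unique (h1.congr_of_eventuallyEq h2)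
  rw [h0, inner_zero_left] at h3
  exact (pos hN_smul hN_add hN_zero he).ne h3

include hN_smul hN_add hN_zero in
theorem eq_smul_gradient {v u e : Pl} (hv : ‖v‖ = 1) (hu : ⟪v, u⟫ = 1)
    (hmin : ∀ w, ⟪v, w⟫ = 1 → N u ≤ N w) {c : ℝ} (hc : c ≠ 0) (he : e = c • u)
    (hN : DifferentiableAt ℝ N e) :
    v = ‖gradient N e‖⁻¹ • gradient N e ∨ v = -(‖gradient N e‖⁻¹ • gradient N e) := by
  have hvv : ⟪v, v⟫ = 1 := by rw [real_inner_self_eq_norm_sq, hv]; norm_num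
  have he0 : e ≠ 0 := by
    rintro rfl
    rcases smul_eq_zero.1 he.symm with h | rfl
    · exact hc h
    · simp at hu
  have hperp (w : Pl) (hw : ⟪v, w⟫ = 0) : ⟪gradient N e, w⟫ = 0 := by
    refine IsLocalMin.hasDerivAt_eq_zero (Eventually.of_forall fun τ => ?_) (hasDerivAt_line hN w)
    have h := hmin (u + (c⁻¹ * τ) • w) (by simp [inner_add_right, inner_smul_right, hu, hw])
    have h1 : e + τ • w = c • (u + (c⁻¹ * τ) • w) := by
      rw [smul_add, smul_smul, ← mul_assoc, mul_inv_cancel₀ hc, one_mul, he]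
    rw [zero_smul, add_zero, h1, he, hN_smul, hN_smul]
    gcongr
  have hg0 : gradient N e ≠ 0 := gradient_ne_zero hN_smul hN_add hN_zero he0 hN
  set g := gradient N e
  have hgv : g = ⟪v, g⟫ • v := by
    have h1 : ⟪v, g - ⟪v, g⟫ • v⟫ = 0 := by
      rw [inner_sub_right, inner_smul_right, hvv, mul_one, sub_self]
    have h2 := hperp _ h1
    rw [← sub_eq_zero, ← inner_self_eq_zero (𝕜 := ℝ), inner_sub_left, h2, inner_smul_left, h1]
    simp
  have hnorm : ‖g‖ = |⟪v, g⟫| := by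
    conv_lhs => rw [hgv]
    rw [norm_smul, hv, mul_one, Real.norm_eq_abs]
  have hvg : ⟪v, g⟫ ≠ 0 := fun h => hg0 (by rw [hgv, h, zero_smul])
  have hvg : v = ⟪v, g⟫⁻¹ • g := by
    conv_rhs => rw [hgv]
    rw [smul_smul, inner_smul_right, hvv, mul_one, inv_mul_cancel₀ hvg, one_smul]
  rw [hnorm]
  rcases abs_choice ⟪v, g⟫ with h | h <;> rw [h]
  · exact Or.inl hvg
  · right
    rwa [inv_neg, neg_smul, neg_neg]

end Basic

theorem hausdorffMeasure_image_eq_zero {f : ℝ → Pl} (hf : ContDiff ℝ 1 f) {Z : Set ℝ}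
    (hZ : volume Z = 0) : μH[1] (f '' Z) = 0 := by
  have hcov : f '' Z ⊆ ⋃ n : ℕ, f '' (Z ∩ closedBall 0 n) := by
    rw [← image_iUnion, ← inter_iUnion]
    refine image_mono fun x hx => ⟨hx, mem_iUnion.2 ?_⟩
    obtain ⟨n, hn⟩ := exists_nat_ge (dist x 0)
    exact ⟨n, hn⟩
  refine measure_mono_null hcov (measure_iUnion_null fun n => ?_)
  obtain ⟨C, hC⟩ := hf.locallyLipschitz.locallyLipschitzOn.exists_lipschitzOnWith_of_compact
    (isCompact_closedBall (0 : ℝ) n)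
  have h := (hC.mono (inter_subset_right (s := Z))).hausdorffMeasure_image_le zero_le_one
  rw [hausdorffMeasure_real, measure_mono_null inter_subset_left hZ, mul_zero] at h
  exact le_antisymm h zero_le

theorem contDiff_normalized_gradient (hN : ContDiffOn ℝ 2 N ({0}ᶜ : Set Pl))
    (h0 : ∀ a : ℝ, gradient N !₂[1, a] ≠ 0) :
    ContDiff ℝ 1 fun a : ℝ => ‖gradient N !₂[1, a]‖⁻¹ • gradient N !₂[1, a] := by
  have hcurve : ContDiff ℝ 1 fun a : ℝ => (!₂[1, a] : Pl) := by
    rw [contDiff_euclidean]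
    intro i
    fin_cases i <;> simp <;> fun_prop
  have hg : ContDiff ℝ 1 fun a : ℝ => gradient N !₂[1, a] := by
    unfold gradient
    refine (InnerProductSpace.toDual ℝ Pl).symm.contDiff.comp ?_
    rw [contDiff_iff_contDiffAt]
    intro a
    have hne : (!₂[1, a] : Pl) ∈ ({0}ᶜ : Set Pl) := by
      intro h
      simpa using congrArg (fun x : Pl => x 0) h
    exact ((hN.contDiffAt (isOpen_compl_singleton.mem_nhds hne)).fderiv_right
      (by norm_num [one_add_one_eq_two])).comp a hcurve.contDiffAt
  exact ((hg.norm ℝ h0).inv fun a => norm_ne_zero_iff.2 (h0 a)).smul hg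

theorem dimH_image_eq {v u : Pl} {p : Pl → Pl} (hp : ∀ x, p x = x - ⟪v, x⟫ • u) {a : ℝ}
    (ha : proj a u = 0) {A : Set Pl} (hA : dimH A ≤ dimH (proj a '' A)) :
    dimH (p '' A) = dimH A := by
  have hpL : ContDiff ℝ 1 p := by
    rw [funext hp]
    exact contDiff_id.sub ((contDiff_const.inner ℝ contDiff_id).smul contDiff_const)
  have hprojL : ContDiff ℝ 1 (proj a) := by
    unfold proj
    fun_prop
  refine le_antisymm (hpL.contDiffOn.dimH_image_le convex_univ (subset_univ A)) (hA.trans ?_)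
  have : proj a '' A = proj a '' (p '' A) := by
    rw [image_image]
    refine image_congr fun x _ => ?_
    simp only [hp, proj, PiLp.sub_apply, PiLp.smul_apply, smul_eq_mul] at ha ⊢
    linear_combination ⟪v, x⟫ * ha
  rw [this]
  exact hprojL.contDiffOn.dimH_image_le convex_univ (subset_univ _)

end NormProjection

/-- if `dim A ≤ 1` then for ℋ¹-a.e. direction `v ∈ S¹` the
closest-point projection of `A` onto the line orthogonal to `v` preserves
Hausdorff dimension. -/
theorem marstrand_projection_dimension_preserved
    (N : EuclideanSpace ℝ (Fin 2) → ℝ)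
    (hN_add : ∀ x y : EuclideanSpace ℝ (Fin 2), N (x + y) ≤ N x + N y)
    (hN_smul : ∀ (c : ℝ) (x : EuclideanSpace ℝ (Fin 2)), N (c • x) = |c| * N x)
    (hN_zero : ∀ x : EuclideanSpace ℝ (Fin 2), N x = 0 → x = 0)
    -- `N` restricted to `ℝ² \ {0}` is of class `C^{2,δ}` for some `δ ∈ (0,1)`:
    (δ : ℝ) (hδ0 : 0 < δ) (hδ1 : δ < 1)
    (hN_C2 : ContDiffOn ℝ 2 N ({0}ᶜ : Set (EuclideanSpace ℝ (Fin 2))))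
    (hN_holder : ∀ K : Set (EuclideanSpace ℝ (Fin 2)), K ⊆ {0}ᶜ → IsCompact K →
      ∃ M : ℝ, ∀ x ∈ K, ∀ y ∈ K,
        ‖iteratedFDerivWithin ℝ 2 N ({0}ᶜ : Set (EuclideanSpace ℝ (Fin 2))) x -
          iteratedFDerivWithin ℝ 2 N ({0}ᶜ : Set (EuclideanSpace ℝ (Fin 2))) y‖ ≤
            M * ‖x - y‖ ^ δ)
    -- the N-unit circle has an arc-length parametrization with everywhere
    -- nonvanishing second derivative (strictly positive curvature):
    (γ : ℝ → EuclideanSpace ℝ (Fin 2)) (L : ℝ) (hL : 0 < L)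
    (hγ_C2 : ContDiff ℝ 2 γ)
    (hγ_per : ∀ t, γ (t + L) = γ t)
    (hγ_range : Set.range γ = {x : EuclideanSpace ℝ (Fin 2) | N x = 1})
    (hγ_unit : ∀ t, ‖deriv γ t‖ = 1)
    (hγ_curv : ∀ t, deriv (deriv γ) t ≠ 0)
    -- `P v` is the closest-point projection (w.r.t. `N`) onto the line `H_v`:
    (P : EuclideanSpace ℝ (Fin 2) → EuclideanSpace ℝ (Fin 2) → EuclideanSpace ℝ (Fin 2))
    (hP : ∀ v ∈ sphere (0 : EuclideanSpace ℝ (Fin 2)) 1, ∀ x : EuclideanSpace ℝ (Fin 2),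
      ⟪v, P v x⟫ = 0 ∧
        ∀ q : EuclideanSpace ℝ (Fin 2), ⟪v, q⟫ = 0 → N (x - P v x) ≤ N (x - q))
    (A : Set (EuclideanSpace ℝ (Fin 2))) (hA : MeasurableSet A)
    (hdimA : dimH A ≤ 1) :
    ∀ᵐ v ∂((μH[1] : Measure (EuclideanSpace ℝ (Fin 2))).restrict
        (sphere (0 : EuclideanSpace ℝ (Fin 2)) 1)),
      dimH (P v '' A) = dimH A := by
  have hN_diff (e : EuclideanSpace ℝ (Fin 2)) (he : e ≠ 0) : DifferentiableAt ℝ N e :=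
    (hN_C2.contDiffAt (isOpen_compl_singleton.mem_nhds he)).differentiableAt (by norm_num)
  have hne (a : ℝ) : (!₂[1, a] : EuclideanSpace ℝ (Fin 2)) ≠ 0 := by
    intro h
    simpa using congrArg (fun x : EuclideanSpace ℝ (Fin 2) => x 0) h
  have hne' : (!₂[0, 1] : EuclideanSpace ℝ (Fin 2)) ≠ 0 := by
    intro h
    simpa using congrArg (fun x : EuclideanSpace ℝ (Fin 2) => x 1) h
  set Z : Set ℝ := {a | ¬ dimH A ≤ dimH (SlopeProjection.proj a '' A)}
  have hZ : volume Z = 0 := ae_iff.1 (SlopeProjection.ae_dimH_le_dimH_image hA hdimA)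
  set n : EuclideanSpace ℝ (Fin 2) → EuclideanSpace ℝ (Fin 2) :=
    fun e => ‖gradient N e‖⁻¹ • gradient N e
  have hn : ContDiff ℝ 1 fun a : ℝ => n !₂[1, a] :=
    NormProjection.contDiff_normalized_gradient hN_C2 fun a =>
      NormProjection.gradient_ne_zero hN_smul hN_add hN_zero (hne a) (hN_diff _ (hne a))
  have hfin : μH[1] ({n !₂[0, 1], -n !₂[0, 1]} : Set (EuclideanSpace ℝ (Fin 2))) = 0 := by
    have := Measure.nullSingletonClass_hausdorff (EuclideanSpace ℝ (Fin 2)) one_pos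
    exact (toFinite _).measure_zero _
  have hnull := measure_union_null (measure_union_null
    (NormProjection.hausdorffMeasure_image_eq_zero hn hZ)
    (NormProjection.hausdorffMeasure_image_eq_zero hn.neg hZ)) hfin
  rw [ae_restrict_iff' isClosed_sphere.measurableSet, ae_iff]
  refine measure_mono_null (fun v hv => ?_) hnull
  rw [mem_ofPred_eq, Classical.not_imp] at hv
  obtain ⟨hv, hbad⟩ := hv
  have hv1 : ‖v‖ = 1 := mem_sphere_zero_iff_norm.1 hv
  obtain ⟨u, hu, hmin, hPu⟩ := NormProjection.exists_direction hN_smul hN_add hN_zero hγ_C2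
    hγ_range hγ_unit hγ_curv hv1 (hP v hv)
  by_cases hu0 : u 0 = 0
  · have hu1 : u 1 ≠ 0 := by
      intro hu1
      have : u = 0 := PiLp.ext fun i => by fin_cases i <;> simpa
      simp [this] at hu
    have he : (!₂[0, 1] : EuclideanSpace ℝ (Fin 2)) = (u 1)⁻¹ • u := by
      ext i
      fin_cases i <;> simp [hu0, hu1]
    exact Or.inr (NormProjection.eq_smul_gradient hN_smul hN_add hN_zero hv1 hu hmin
      (inv_ne_zero hu1) he (hN_diff _ hne'))
  · have he : (!₂[1, u 1 / u 0] : EuclideanSpace ℝ (Fin 2)) = (u 0)⁻¹ • u := by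
      ext i
      fin_cases i <;> simp [hu0, div_eq_inv_mul]
    have ha : u 1 / u 0 ∈ Z := fun hle => hbad <|
      NormProjection.dimH_image_eq hPu (by simp [SlopeProjection.proj, hu0]) hle
    rcases NormProjection.eq_smul_gradient hN_smul hN_add hN_zero hv1 hu hmin
      (inv_ne_zero hu0) he (hN_diff _ (hne _)) with h | h
    · exact Or.inl (Or.inl ⟨_, ha, h.symm⟩)
    · exact Or.inl (Or.inr ⟨_, ha, h.symm⟩)
end
end

section
/- Let N be a norm on ℝ² whose restriction to ℝ² \ {0} is of class C^{2,δ} for some δ ∈ (0,1), and assume the N-unit circle has strictly positive Euclidean curvature at every point. Then for every Borel set A ⊆ ℝ² with s := dim A ≤ 1, the exceptional set satisfies dim {v ∈ S¹ : dim(P_v(A)) < s} ≤ s. -/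
open Set Metric MeasureTheory
open scoped ENNReal RealInnerProductSpace

noncomputable section

/-! ### Net contents of laminar families -/

namespace NetContent

variable {X : Type*}

/-- The outer measure generated by covering with members of `𝒟`, a set `Q` costing `τ Q`. -/
def netContent (𝒟 : Set (Set X)) (τ : Set X → ℝ≥0∞) (hτ : τ ∅ = 0) : OuterMeasure X :=
  OuterMeasure.ofFunction (fun Q => ⨅ _ : Q ∈ insert ∅ 𝒟, τ Q) (by simp [hτ])

variable {𝒟 : Set (Set X)} {τ : Set X → ℝ≥0∞} {hτ : τ ∅ = 0}

lemma netContent_le {Q : Set X} (hQ : Q ∈ 𝒟) : netContent 𝒟 τ hτ Q ≤ τ Q :=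
  (OuterMeasure.ofFunction_le Q).trans (iInf_le _ (mem_insert_of_mem _ hQ))

/-- The total cost of a family of sets. -/
def cost (τ : Set X → ℝ≥0∞) (U : Set (Set X)) : ℝ≥0∞ := ∑' Q, U.indicator τ Q

lemma netContent_le_cost (h𝒟 : 𝒟.Countable) {U : Set (Set X)} (hU : U ⊆ 𝒟) {E : Set X}
    (hE : E ⊆ ⋃₀ U) : netContent 𝒟 τ hτ E ≤ cost τ U := by
  rw [sUnion_eq_biUnion] at hE
  calc netContent 𝒟 τ hτ E ≤ netContent 𝒟 τ hτ (⋃ Q ∈ U, Q) := measure_mono hE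
    _ ≤ ∑' Q : U, netContent 𝒟 τ hτ Q := measure_biUnion_le _ (h𝒟.mono hU) _
    _ ≤ ∑' Q : U, τ Q := ENNReal.tsum_le_tsum fun Q => netContent_le (hU Q.2)
    _ = cost τ U := tsum_subtype U τ

lemma exists_cover_cost_lt {E : Set X} {a : ℝ≥0∞} (h : netContent 𝒟 τ hτ E < a) :
    ∃ U ⊆ 𝒟, E ⊆ ⋃₀ U ∧ cost τ U < a := by
  rw [netContent, OuterMeasure.ofFunction_apply] at h
  simp only [iInf_lt_iff] at h
  obtain ⟨t, ht, hlt⟩ := h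
  have hmem : ∀ i, t i ∈ insert ∅ 𝒟 := by
    intro i
    by_contra hi
    refine (ne_top_of_lt hlt) (ENNReal.tsum_eq_top_of_eq_top ⟨i, ?_⟩)
    simp only [hi, iInf_false]
  refine ⟨range t ∩ 𝒟, inter_subset_right, ?_, lt_of_le_of_lt ?_ hlt⟩
  · intro x hx
    obtain ⟨i, hi⟩ := mem_iUnion.1 (ht hx)
    refine ⟨t i, ⟨mem_range_self i, ?_⟩, hi⟩
    rcases hmem i with h | h
    · rw [h] at hi; exact hi.elim
    · exact h
  · rw [cost, ← tsum_subtype]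
    have hch : ∀ Q : (range t ∩ 𝒟 : Set (Set X)), ∃ i, t i = Q := fun Q => Q.2.1
    choose g hg using hch
    have hginj : Function.Injective g := fun P Q h => by
      apply Subtype.ext; rw [← hg P, ← hg Q, h]
    calc ∑' Q : (range t ∩ 𝒟 : Set (Set X)), τ Q
        = ∑' Q : (range t ∩ 𝒟 : Set (Set X)), ⨅ _ : t (g Q) ∈ insert ∅ 𝒟, τ (t (g Q)) := by
          refine tsum_congr fun Q => ?_
          rw [iInf_pos (hmem _), hg]
      _ ≤ _ := ENNReal.tsum_comp_le_tsum_of_injective hginj _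

/-- Any two members of the family meeting each other are nested, and every member has only
finitely many members above it. -/
structure IsLaminar (𝒟 : Set (Set X)) : Prop where
  nested : ∀ P ∈ 𝒟, ∀ Q ∈ 𝒟, ∀ x, x ∈ P → x ∈ Q → P ⊆ Q ∨ Q ⊆ P
  finite : ∀ Q ∈ 𝒟, {P ∈ 𝒟 | Q ⊆ P}.Finite

/-- The inclusion-maximal members of a family. -/
def maxs (U : Set (Set X)) : Set (Set X) := {Q | Maximal (· ∈ U) Q}

lemma maxs_subset (U : Set (Set X)) : maxs U ⊆ U := fun _ h => h.prop

lemma IsLaminar.exists_maxs (hl : IsLaminar 𝒟) {U : Set (Set X)} (hU : U ⊆ 𝒟) {Q : Set X}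
    (hQ : Q ∈ U) : ∃ P ∈ maxs U, Q ⊆ P := by
  have hfin : {P ∈ U | Q ⊆ P}.Finite :=
    (hl.finite Q (hU hQ)).subset fun P hP => ⟨hU hP.1, hP.2⟩
  obtain ⟨P, hQP, hP⟩ := hfin.exists_le_maximal (a := Q) ⟨hQ, subset_rfl⟩
  exact ⟨P, ⟨hP.prop.1, fun R hR hPR => hP.le_of_ge ⟨hR, hQP.trans hPR⟩ hPR⟩, hQP⟩

/-- Strong subadditivity of the net content, in terms of covers. -/
lemma IsLaminar.cost_maxs_add_le (hl : IsLaminar 𝒟) (h𝒟 : 𝒟.Countable) {U V : Set (Set X)}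
    (hU : U ⊆ 𝒟) (hV : V ⊆ 𝒟) {E : Set X} (hEU : E ⊆ ⋃₀ U) (hEV : E ⊆ ⋃₀ V) :
    cost τ (maxs (V ∪ U)) + netContent 𝒟 τ hτ E ≤ cost τ V + cost τ U := by
  set W := maxs (V ∪ U) with hW
  set J := ((V ∪ U) \ W) ∪ (V ∩ U) with hJ
  have hJ𝒟 : J ⊆ 𝒟 := by
    rintro Q (⟨h | h, -⟩ | h)
    exacts [hV h, hU h, hV h.1]
  have hEJ : E ⊆ ⋃₀ J := by
    intro x hx
    obtain ⟨P, hP, hxP⟩ := hEU hx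
    obtain ⟨Q, hQ, hxQ⟩ := hEV hx
    by_cases hPQ : P = Q
    · subst hPQ
      exact ⟨P, Or.inr ⟨hQ, hP⟩, hxP⟩
    rcases hl.nested P (hU hP) Q (hV hQ) x hxP hxQ with h | h
    · exact ⟨P, Or.inl ⟨Or.inr hP, fun hPW => hPQ (h.antisymm (hPW.le_of_ge (Or.inl hQ) h))⟩, hxP⟩
    · exact ⟨Q, Or.inl ⟨Or.inl hQ, fun hQW =>
        hPQ ((hQW.le_of_ge (Or.inr hP) h).antisymm h)⟩, hxQ⟩
  have hWsub : W ⊆ V ∪ U := maxs_subset _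
  calc cost τ W + netContent 𝒟 τ hτ E ≤ cost τ W + cost τ J := by
        gcongr; exact netContent_le_cost h𝒟 hJ𝒟 hEJ
    _ = ∑' Q, (W.indicator τ Q + J.indicator τ Q) := ENNReal.tsum_add.symm
    _ ≤ ∑' Q, (V.indicator τ Q + U.indicator τ Q) := by
        refine ENNReal.tsum_le_tsum fun Q => ?_
        have := @hWsub Q
        by_cases hQW : Q ∈ W <;> by_cases hQV : Q ∈ V <;> by_cases hQU : Q ∈ U <;>
          simp_all [indicator]
    _ = cost τ V + cost τ U := ENNReal.tsum_add

/-- The net content of a laminar family is continuous along increasing sequences of arbitrary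
sets. -/
theorem IsLaminar.exists_lt_netContent (hl : IsLaminar 𝒟) (h𝒟 : 𝒟.Countable) {E : ℕ → Set X}
    (hE : Monotone E) {a : ℝ≥0∞} (ha : a < netContent 𝒟 τ hτ (⋃ n, E n)) :
    ∃ n, a < netContent 𝒟 τ hτ (E n) := by
  by_contra! hcon
  have hatop : a ≠ ∞ := ne_top_of_lt ha
  obtain ⟨ε', hε', hε'lt⟩ := exists_between ha
  have hεne : ε' - a ≠ 0 := (tsub_pos_of_lt hε').ne'
  obtain ⟨ε, hε, hεsum⟩ := ENNReal.exists_pos_sum_of_countable' hεne ℕ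
  have hfin : ∀ n, netContent 𝒟 τ hτ (E n) ≠ ∞ := fun n => ne_top_of_le_ne_top hatop (hcon n)
  have hcov : ∀ n, ∃ U ⊆ 𝒟, E n ⊆ ⋃₀ U ∧ cost τ U < netContent 𝒟 τ hτ (E n) + ε n := fun n =>
    exists_cover_cost_lt (ENNReal.lt_add_right (hfin n) (hε n).ne')
  choose U hU𝒟 hEU hUcost using hcov
  let V : ℕ → Set (Set X) := fun n => Nat.rec (U 0) (fun n W => maxs (W ∪ U (n + 1))) n
  have hVs : ∀ n, V (n + 1) = maxs (V n ∪ U (n + 1)) := fun n => rfl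
  have hV𝒟 : ∀ n, V n ⊆ 𝒟 := by
    intro n
    induction n with
    | zero => exact hU𝒟 0
    | succ n ih => rw [hVs]; exact (maxs_subset _).trans (union_subset ih (hU𝒟 _))
  have hEV : ∀ n, E n ⊆ ⋃₀ V n := by
    intro n
    cases n with
    | zero => exact hEU 0
    | succ n =>
      intro x hx
      obtain ⟨Q, hQ, hxQ⟩ := hEU (n + 1) hx
      obtain ⟨P, hP, hQP⟩ := hl.exists_maxs (union_subset (hV𝒟 n) (hU𝒟 (n + 1))) (Or.inr hQ)
      exact ⟨P, hP, hQP hxQ⟩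
  have hVcost : ∀ n, cost τ (V n) ≤
      netContent 𝒟 τ hτ (E n) + ∑ i ∈ Finset.range (n + 1), ε i := by
    intro n
    induction n with
    | zero =>
      rw [zero_add, Finset.sum_range_one]
      exact (hUcost 0).le
    | succ n ih =>
      have h1 := hl.cost_maxs_add_le (τ := τ) (hτ := hτ) h𝒟 (hU𝒟 (n + 1)) (hV𝒟 n)
        ((hE n.le_succ).trans (hEU (n + 1))) (hEV n)
      rw [← hVs] at h1
      have h2 : cost τ (V (n + 1)) + netContent 𝒟 τ hτ (E n) ≤
          (netContent 𝒟 τ hτ (E (n + 1)) + ∑ i ∈ Finset.range (n + 1 + 1), ε i) +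
            netContent 𝒟 τ hτ (E n) := by
        refine h1.trans ((add_le_add ih (hUcost (n + 1)).le).trans (le_of_eq ?_))
        rw [Finset.sum_range_succ _ (n + 1)]
        ring
      exact (ENNReal.add_le_add_iff_right (hfin n)).1 h2
  let Vinf : Set (Set X) := {Q | ∃ m, ∀ n ≥ m, Q ∈ V n}
  have hVinf𝒟 : Vinf ⊆ 𝒟 := fun Q ⟨m, hm⟩ => hV𝒟 m (hm m le_rfl)
  have hEVinf : (⋃ n, E n) ⊆ ⋃₀ Vinf := by
    intro x hx
    obtain ⟨n₀, hx⟩ := mem_iUnion.1 hx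
    obtain ⟨Q₀, hQ₀, hxQ₀⟩ := hEV n₀ hx
    have hfinQ : {P | (∃ n ≥ n₀, P ∈ V n) ∧ Q₀ ⊆ P}.Finite :=
      (hl.finite Q₀ (hV𝒟 _ hQ₀)).subset fun P hP =>
        ⟨let ⟨⟨n, _, h⟩, _⟩ := hP; hV𝒟 n h, hP.2⟩
    obtain ⟨P, hQP, hP⟩ := hfinQ.exists_le_maximal (a := Q₀)
      ⟨⟨n₀, le_rfl, hQ₀⟩, subset_rfl⟩
    obtain ⟨⟨⟨m, hm, hPm⟩, -⟩, -⟩ := id hP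
    refine ⟨P, ⟨m, fun n hn => ?_⟩, hQP hxQ₀⟩
    induction n, hn using Nat.le_induction with
    | base => exact hPm
    | succ n hn ih =>
      obtain ⟨R, hR, hPR⟩ := hl.exists_maxs (union_subset (hV𝒟 n) (hU𝒟 (n + 1))) (Or.inl ih)
      have : R ⊆ P := hP.le_of_ge ⟨⟨n + 1, by omega, hR⟩, hQP.trans hPR⟩ hPR
      rw [hPR.antisymm this]
      exact hR
  have hcostinf : cost τ Vinf ≤ a + ∑' i, ε i := by
    refine ENNReal.summable.tsum_le_of_sum_le fun F => ?_
    have hm : ∃ m, ∀ Q ∈ F, Q ∈ Vinf → Q ∈ V m := by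
      have hch : ∀ Q : Set X, ∃ m, Q ∈ Vinf → ∀ n ≥ m, Q ∈ V n := by
        intro Q
        rcases em (Q ∈ Vinf) with ⟨m, hm⟩ | hQ
        · exact ⟨m, fun _ => hm⟩
        · exact ⟨0, fun hQ' => (hQ hQ').elim⟩
      choose g hg using hch
      exact ⟨F.sup g, fun Q hQ hQV => hg Q hQV _ (Finset.le_sup hQ)⟩
    obtain ⟨m, hm⟩ := hm
    calc ∑ Q ∈ F, Vinf.indicator τ Q ≤ ∑ Q ∈ F, (V m).indicator τ Q := by
          refine Finset.sum_le_sum fun Q hQ => ?_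
          by_cases h : Q ∈ Vinf
          · simp [h, hm Q hQ h]
          · simp [h]
      _ ≤ cost τ (V m) := ENNReal.sum_le_tsum _
      _ ≤ _ := (hVcost m).trans (add_le_add (hcon m) (ENNReal.sum_le_tsum _))
  have h1 := (netContent_le_cost (hτ := hτ) h𝒟 hVinf𝒟 hEVinf).trans hcostinf
  have h2 : a + ∑' i, ε i ≤ ε' := by
    calc a + ∑' i, ε i ≤ a + (ε' - a) := by gcongr
      _ = ε' := add_tsub_cancel_of_le hε'.le
  exact absurd (h1.trans h2) (not_le.2 hε'lt)

end NetContent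

/-! ### Cell systems and flows -/

/-- A refining sequence of finite Borel partitions of a metric space into cells, the cells of
generation `n` having size comparable with `2⁻ⁿ`. -/
structure CellSystem (X ι : Type*) [PseudoMetricSpace X] [MeasurableSpace X] where
  /-- the label of the cell of generation `n` containing a given point -/
  code : ℕ → X → ι
  code_refine : ∀ n x y, code (n + 1) x = code (n + 1) y → code n x = code n y
  measurableSet_code : ∀ n d, MeasurableSet (code n ⁻¹' {d})
  finite_range : ∀ n, (range (code n)).Finite
  /-- the diameter bound -/
  D : ℝ
  dist_le : ∀ n x y, code n x = code n y → dist x y ≤ D * (1 / 2) ^ n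
  /-- the number of cells that a small ball may meet -/
  card : ℕ
  exists_finset : ∀ n x, ∃ s : Finset ι, s.card ≤ card ∧
    ∀ y, dist y x < (1 / 2) ^ n → code n y ∈ s

namespace CellSystem

variable {X ι : Type*} [PseudoMetricSpace X] [MeasurableSpace X] (c : CellSystem X ι)

/-- The cell of generation `n` containing `x`. -/
def cell (n : ℕ) (x : X) : Set X := c.code n ⁻¹' {c.code n x}

/-- The family of all cells. -/
def cells : Set (Set X) := {Q | ∃ n x, Q = c.cell n x}

lemma mem_cell {n : ℕ} {x y : X} : y ∈ c.cell n x ↔ c.code n y = c.code n x := Iff.rfl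

lemma self_mem_cell (n : ℕ) (x : X) : x ∈ c.cell n x := rfl

lemma cell_mem_cells (n : ℕ) (x : X) : c.cell n x ∈ c.cells := ⟨n, x, rfl⟩

lemma code_eq_of_le {n m : ℕ} (h : n ≤ m) {x y : X} (hxy : c.code m x = c.code m y) :
    c.code n x = c.code n y := by
  induction m, h using Nat.le_induction with
  | base => exact hxy
  | succ m _ ih => exact ih (c.code_refine m x y hxy)

lemma cell_subset_of_le {n m : ℕ} (h : n ≤ m) {x y z : X} (hn : z ∈ c.cell n x)
    (hm : z ∈ c.cell m y) : c.cell m y ⊆ c.cell n x := fun w hw =>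
  (c.code_eq_of_le h (hw.trans hm.symm) : c.code n w = c.code n z).trans hn

lemma isLaminar : NetContent.IsLaminar c.cells where
  nested := by
    rintro _ ⟨n, x, rfl⟩ _ ⟨m, y, rfl⟩ z hz hz'
    rcases le_total n m with h | h
    · exact Or.inr (c.cell_subset_of_le h hz hz')
    · exact Or.inl (c.cell_subset_of_le h hz' hz)
  finite := by
    rintro _ ⟨m, y, rfl⟩
    refine ((finite_Iic m).image fun n => c.cell n y).subset ?_
    rintro _ ⟨⟨n, x, rfl⟩, hsub⟩
    have hy : y ∈ c.cell n x := hsub (c.self_mem_cell m y)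
    rcases le_total n m with h | h
    · exact ⟨n, h, (c.cell_subset_of_le le_rfl (c.self_mem_cell n y) hy).antisymm'
        (c.cell_subset_of_le le_rfl hy (c.self_mem_cell n y))⟩
    · exact ⟨m, self_mem_Iic, hsub.antisymm (c.cell_subset_of_le h (c.self_mem_cell m y) hy)⟩

lemma countable_cells [Countable ι] : c.cells.Countable := by
  refine (countable_range fun p : ℕ × ι => c.code p.1 ⁻¹' {p.2}).mono ?_
  rintro _ ⟨n, x, rfl⟩
  exact ⟨(n, c.code n x), rfl⟩

lemma ediam_cell_le (n : ℕ) (x : X) :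
    ediam (c.cell n x) ≤ ENNReal.ofReal (c.D * (1 / 2) ^ n) := by
  refine ediam_le fun y hy z hz => ?_
  rw [edist_dist]
  exact ENNReal.ofReal_le_ofReal (c.dist_le n y z (hy.trans hz.symm))

/-- The cost of a set in dimension `σ`. -/
def dcost (σ : ℝ) (Q : Set X) : ℝ≥0∞ := ediam Q ^ σ

/-- The net content in dimension `σ > 0`. -/
def content {σ : ℝ} (hσ : 0 < σ) : OuterMeasure X :=
  NetContent.netContent c.cells (dcost σ) (by simp [dcost, hσ])

lemma dcost_cell_lt_top {σ : ℝ} (hσ : 0 < σ) (n : ℕ) (x : X) : dcost σ (c.cell n x) < ∞ :=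
  ENNReal.rpow_lt_top_of_nonneg hσ.le
    (ne_top_of_le_ne_top ENNReal.ofReal_ne_top (c.ediam_cell_le n x))

lemma content_cell_le {σ : ℝ} (hσ : 0 < σ) {n : ℕ} {x : X} {F : Set X} (h : F ⊆ c.cell n x) :
    c.content hσ F ≤ dcost σ (c.cell n x) :=
  (measure_mono h).trans (NetContent.netContent_le (c.cell_mem_cells n x))

lemma measure_cell_le_of_le {σ : ℝ} (hσ : 0 < σ) {k : ℕ} {F : Set X} {x₀ : X}
    (hF : F ⊆ c.cell k x₀) {μ : Measure X} (hμ : μ univ ≤ c.content hσ F)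
    (hμF : μ Fᶜ = 0) {j : ℕ} (hj : j ≤ k) (x : X) :
    μ (c.cell j x) ≤ dcost σ (c.cell j x) := by
  by_cases h : ∃ z ∈ F, z ∈ c.cell j x
  · obtain ⟨z, hzF, hz⟩ := h
    have : F ⊆ c.cell j x := hF.trans (c.cell_subset_of_le hj hz (hF hzF))
    exact ((measure_mono (subset_univ _)).trans hμ).trans (c.content_cell_le hσ this)
  · push Not at h
    have : c.cell j x ⊆ Fᶜ := fun z hz hzF => h z hzF hz
    rw [measure_mono_null this hμF]
    exact zero_le

/-- Mass can be distributed on a set in such a way that the total mass is the net content, and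
the mass of each cell up to a given generation is bounded by its cost. -/
theorem exists_flow [Countable ι] [MeasurableSingletonClass X] {σ : ℝ} (hσ : 0 < σ) (n k : ℕ)
    (hk : k ≤ n) (F : Set X) (hF : ∀ x ∈ F, ∀ y ∈ F, c.code k x = c.code k y) :
    ∃ μ : Measure X, μ univ = c.content hσ F ∧ μ Fᶜ = 0 ∧
      ∀ j ≤ n, ∀ x, μ (c.cell j x) ≤ dcost σ (c.cell j x) := by
  induction hk using Nat.decreasingInduction generalizing F with
  | self =>
    rcases F.eq_empty_or_nonempty with rfl | ⟨x₀, hx₀⟩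
    · exact ⟨0, by simp, by simp, by simp⟩
    refine ⟨c.content hσ F • Measure.dirac x₀, by simp, by simp [hx₀], fun j hj => ?_⟩
    exact c.measure_cell_le_of_le hσ (fun y hy => hF y hy x₀ hx₀) (by simp) (by simp [hx₀]) hj
  | of_succ k hk ih =>
    rcases F.eq_empty_or_nonempty with rfl | ⟨x₀, hx₀⟩
    · exact ⟨0, by simp, by simp, by simp⟩
    have hFx₀ : F ⊆ c.cell k x₀ := fun y hy => hF y hy x₀ hx₀
    let G : ι → Set X := fun d => F ∩ c.code (k + 1) ⁻¹' {d}
    have hG : ∀ d, ∃ μ : Measure X, μ univ = c.content hσ (G d) ∧ μ (G d)ᶜ = 0 ∧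
        ∀ j ≤ n, ∀ x, μ (c.cell j x) ≤ dcost σ (c.cell j x) := fun d =>
      ih (G d) fun x hx y hy => (hx.2 : c.code (k + 1) x = d).trans hy.2.symm
    choose μ hμu hμG hμc using hG
    set T : ℝ≥0∞ := ∑' d, c.content hσ (G d) with hT
    have hcontF : c.content hσ F ≤ T := by
      have : F = ⋃ d, G d := by
        ext y
        simp [G]
      exact (congrArg (c.content hσ) this).le.trans (measure_iUnion_le G)
    have hTtop : T ≠ ∞ := by
      have hsupp : ∀ d ∉ (c.finite_range (k + 1)).toFinset, c.content hσ (G d) = 0 := by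
        intro d hd
        have : G d = ∅ := by
          refine eq_empty_of_forall_notMem fun y hy => hd ?_
          simpa using ⟨y, hy.2⟩
        rw [this, measure_empty]
      rw [hT, tsum_eq_sum hsupp]
      refine (ENNReal.sum_lt_top.2 fun d _ => ?_).ne
      exact ((measure_mono inter_subset_left).trans (c.content_cell_le hσ hFx₀)).trans_lt
        (dcost_cell_lt_top c hσ _ _)
    set q : ℝ≥0∞ := c.content hσ F / T with hq
    have hq1 : q ≤ 1 := ENNReal.div_le_of_le_mul (by rwa [one_mul])
    have hqT : q * T = c.content hσ F := by
      by_cases hT0 : T = 0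
      · have : c.content hσ F = 0 := le_antisymm (hT0 ▸ hcontF) zero_le
        rw [this, hT0, mul_zero]
      · exact ENNReal.div_mul_cancel hT0 hTtop
    have hsum : ∀ S, (q • Measure.sum μ) S = q * ∑' d, μ d S := fun S => by
      rw [Measure.smul_apply, Measure.sum_apply_of_countable, smul_eq_mul]
    have hμu' : (q • Measure.sum μ) univ = c.content hσ F := by
      rw [hsum, ← hqT, hT]
      simp_rw [hμu]
    have hμF : (q • Measure.sum μ) Fᶜ = 0 := by
      rw [hsum]
      have : ∀ d, μ d Fᶜ = 0 := fun d =>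
        measure_mono_null (compl_subset_compl.2 inter_subset_left) (hμG d)
      simp [this]
    refine ⟨q • Measure.sum μ, hμu', hμF, fun j hj x => ?_⟩
    rcases le_or_gt j k with hjk | hjk
    · exact c.measure_cell_le_of_le hσ hFx₀ hμu'.le hμF hjk x
    · rw [hsum, tsum_eq_single (c.code (k + 1) x)]
      · exact (mul_le_of_le_one_left' hq1).trans (hμc _ j hj x)
      · intro d hd
        have hsub : c.cell j x ⊆ (G d)ᶜ := fun y hy hyG =>
          hd (hyG.2.symm.trans (c.code_eq_of_le hjk hy))
        exact measure_mono_null hsub (hμG d)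

end CellSystem

/-- An analytic set of large capacity, for an outer measure that is continuous along increasing
sequences, can be approximated by sets of large capacity shrinking to a compact subset. -/
theorem _root_.MeasureTheory.AnalyticSet.exists_compact_capacity_lt {X : Type*} [TopologicalSpace X]
    {M : OuterMeasure X} {a : ℝ≥0∞}
    (hM : ∀ E : ℕ → Set X, Monotone E → a < M (⋃ n, E n) → ∃ n, a < M (E n))
    {A : Set X} (hA : AnalyticSet A) (ha : a < M A) :
    ∃ K ⊆ A, IsCompact K ∧ ∃ F : ℕ → Set X, (∀ n, F n ⊆ A) ∧ (∀ n, a < M (F n)) ∧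
      ∀ U, IsOpen U → K ⊆ U → ∃ n, ∀ m ≥ n, F m ⊆ U := by
  rw [AnalyticSet] at hA
  rcases hA with rfl | ⟨f, hf, rfl⟩
  · simp at ha
  have hstep : ∀ (k : ℕ) (S : {S : Set (ℕ → ℕ) // a < M (f '' S)}),
      ∃ m, a < M (f '' (S.1 ∩ {x | x k ≤ m})) := by
    intro k S
    refine hM (fun m => f '' (S.1 ∩ {x | x k ≤ m})) (fun m m' h => ?_) ?_
    · exact image_mono (inter_subset_inter_right _ fun x (hx : x k ≤ m) => hx.trans h)
    · rw [← image_iUnion, ← inter_iUnion]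
      have : ⋃ m, {x : ℕ → ℕ | x k ≤ m} = univ :=
        eq_univ_of_forall fun x => mem_iUnion.2 ⟨x k, le_refl (x k)⟩
      rw [this, inter_univ]
      exact S.2
  choose g hg using hstep
  let T : ℕ → {S : Set (ℕ → ℕ) // a < M (f '' S)} := fun n =>
    Nat.rec ⟨univ, by rwa [image_univ]⟩ (fun k S => ⟨S.1 ∩ {x | x k ≤ g k S}, hg k S⟩) n
  let b : ℕ → ℕ := fun k => g k (T k)
  have hT : ∀ n, (T n).1 = {x | ∀ i < n, x i ≤ b i} := by
    intro n
    induction n with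
    | zero => ext x; simp [T]
    | succ n ih =>
      have : (T (n + 1)).1 = (T n).1 ∩ {x | x n ≤ b n} := rfl
      rw [this, ih]
      ext x
      simp only [mem_inter_iff, mem_ofPred_eq, Nat.lt_succ_iff_lt_or_eq]
      grind
  have hcomp : IsCompact {x : ℕ → ℕ | ∀ i, x i ≤ b i} := by
    have : {x : ℕ → ℕ | ∀ i, x i ≤ b i} = univ.pi fun i => Iic (b i) := by
      ext x; simp [Pi.le_def]
    rw [this]
    exact isCompact_univ_pi fun i => (finite_Iic (b i)).isCompact
  refine ⟨f '' {x | ∀ i, x i ≤ b i}, image_subset_range _ _, hcomp.image hf,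
    fun n => f '' (T n).1, fun n => image_subset_range _ _, fun n => (T n).2, fun U hU hKU => ?_⟩
  have hO : IsOpen (f ⁻¹' U) := hU.preimage hf
  have hev : ∃ n, ∀ x : ℕ → ℕ, (∀ i, x i ≤ b i) → PiNat.cylinder x n ⊆ f ⁻¹' U := by
    have hloc : ∀ x ∈ {x : ℕ → ℕ | ∀ i, x i ≤ b i}, ∃ n, PiNat.cylinder x n ⊆ f ⁻¹' U :=
      fun x hx => by
        obtain ⟨_, ⟨y, n, rfl⟩, hxy, hsub⟩ :=
          (PiNat.isTopologicalBasis_cylinders (fun _ : ℕ => ℕ)).exists_subset_of_mem_open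
            (hKU ⟨x, hx, rfl⟩ : x ∈ f ⁻¹' U) hO
        exact ⟨n, (PiNat.mem_cylinder_iff_eq.1 hxy) ▸ hsub⟩
    choose! N hN using hloc
    obtain ⟨t, ht, hcov⟩ := hcomp.elim_nhds_subcover (fun x => PiNat.cylinder x (N x)) fun x _ =>
      (PiNat.isOpen_cylinder _ x (N x)).mem_nhds (PiNat.self_mem_cylinder x _)
    refine ⟨t.sup N, fun x hx => ?_⟩
    obtain ⟨y, hy, hxy⟩ := mem_iUnion₂.1 (hcov hx)
    refine (PiNat.cylinder_anti x (Finset.le_sup hy)).trans ?_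
    rw [PiNat.mem_cylinder_iff_eq.1 hxy]
    exact hN y (ht y hy)
  obtain ⟨n, hn⟩ := hev
  refine ⟨n, fun m hm => ?_⟩
  rintro _ ⟨x, hx, rfl⟩
  rw [hT] at hx
  have : x ∈ PiNat.cylinder (fun i => if i < n then x i else 0) n := by
    intro i hi
    simp [hi]
  refine hn _ (fun i => ?_) this
  split_ifs with h
  · exact hx i (h.trans_le hm)
  · exact Nat.zero_le _

namespace CellSystem

lemma hausdorffMeasure_eq_zero_of_content_eq_zero {X ι : Type*} [MetricSpace X]
    [MeasurableSpace X] [BorelSpace X] [Countable ι] (c : CellSystem X ι) {σ : ℝ} (hσ : 0 < σ)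
    {A : Set X} (hA : c.content hσ A = 0) : Measure.hausdorffMeasure σ A = 0 := by
  have hcov : ∀ n : ℕ, ∃ U ⊆ c.cells, A ⊆ ⋃₀ U ∧
      NetContent.cost (dcost σ) U < ((n : ℝ≥0∞) + 1)⁻¹ := fun n =>
    NetContent.exists_cover_cost_lt (hτ := by simp [dcost, hσ]) (by
      change c.content hσ A < _
      rw [hA]
      simp)
  choose U hU hAU hUc using hcov
  have : ∀ n, Countable (U n) := fun n => (c.countable_cells.mono (hU n)).to_subtype
  have hcost : ∀ n, ∑' Q : U n, ediam (Q : Set X) ^ σ ≤ ((n : ℝ≥0∞) + 1)⁻¹ := fun n =>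
    (tsum_subtype (U n) (dcost σ)).trans_le (hUc n).le
  have hlim : Filter.Tendsto (fun n : ℕ => ((n : ℝ≥0∞) + 1)⁻¹) Filter.atTop (nhds 0) := by
    have := (Filter.tendsto_add_atTop_iff_nat 1).2 ENNReal.tendsto_inv_nat_nhds_zero
    simpa using this
  have hlim' : Filter.Tendsto (fun n : ℕ => (((n : ℝ≥0∞) + 1)⁻¹) ^ (1 / σ)) Filter.atTop
      (nhds 0) := by
    have := (ENNReal.continuous_rpow_const (y := 1 / σ)).tendsto 0 |>.comp hlim
    rwa [ENNReal.zero_rpow_of_pos (by positivity)] at this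
  have key := Measure.hausdorffMeasure_le_liminf_tsum σ A (l := Filter.atTop)
    (fun n : ℕ => (((n : ℝ≥0∞) + 1)⁻¹) ^ (1 / σ)) hlim' (fun n (Q : U n) => (Q : Set X))
    (Filter.Eventually.of_forall fun n Q => by
      have h1 := (ENNReal.le_tsum (f := fun Q : U n => ediam (Q : Set X) ^ σ) Q).trans (hcost n)
      have h2 := ENNReal.rpow_le_rpow h1 (by positivity : 0 ≤ 1 / σ)
      rwa [← ENNReal.rpow_mul, mul_one_div_cancel hσ.ne', ENNReal.rpow_one] at h2)
    (Filter.Eventually.of_forall fun n => by rw [← sUnion_eq_iUnion]; exact hAU n)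
  refine le_antisymm (key.trans ?_) zero_le
  rw [← hlim.liminf_eq]
  exact Filter.liminf_le_liminf (Filter.Eventually.of_forall hcost)

/-- **Frostman's lemma** for Borel subsets of a compact metric space with a cell system. -/
theorem exists_frostman {X ι : Type*} [MetricSpace X] [CompactSpace X]
    [MeasurableSpace X] [BorelSpace X] [Countable ι] (c : CellSystem X ι) {σ : ℝ} (hσ : 0 < σ)
    {A : Set X} (hA : MeasurableSet A) (hA0 : c.content hσ A ≠ 0) :
    ∃ μ : Measure X, IsProbabilityMeasure μ ∧ μ Aᶜ = 0 ∧ ∃ C : ℝ≥0∞, C ≠ ∞ ∧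
      ∀ x, ∀ r : ℝ, 0 < r → μ (closedBall x r) ≤ C * ENNReal.ofReal r ^ σ := by
  -- localize to one cell of generation zero
  obtain ⟨d, hd⟩ : ∃ d, c.content hσ (A ∩ c.code 0 ⁻¹' {d}) ≠ 0 := by
    by_contra! hcon
    refine hA0 ?_
    have : A = ⋃ d, A ∩ c.code 0 ⁻¹' {d} := by
      ext y; simp
    rw [this]
    exact measure_iUnion_null hcon
  obtain ⟨a, ha0, ha⟩ := exists_between (pos_iff_ne_zero.2 hd)
  have hatop : a ≠ ∞ := ne_top_of_lt ha
  obtain ⟨K, hKA, hK, F, hFA, hF, hFK⟩ := AnalyticSet.exists_compact_capacity_lt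
    (M := c.content hσ) (fun E hE h => c.isLaminar.exists_lt_netContent c.countable_cells hE h)
    (hA.inter (c.measurableSet_code 0 d)).analyticSet ha
  have hcode : ∀ n, ∀ x ∈ F n, c.code 0 x = d := fun n x hx => (hFA n hx).2
  choose μ hμu hμF hμc using fun n => c.exists_flow hσ n 0 n.zero_le (F n)
    fun x hx y hy => (hcode n x hx).trans (hcode n y hy).symm
  have hμtop : ∀ n, μ n univ ≠ ∞ := by
    intro n
    rw [hμu]
    rcases (F n).eq_empty_or_nonempty with h | ⟨x, hx⟩
    · simp [h]
    · exact ne_top_of_le_ne_top (c.dcost_cell_lt_top hσ 0 x).ne (c.content_cell_le hσ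
        fun y hy => (hcode n y hy).trans (hcode n x hx).symm)
  have haμ : ∀ n, a ≤ μ n univ := fun n => (hF n).le.trans_eq (hμu n).symm
  have hprob : ∀ n, IsProbabilityMeasure ((μ n univ)⁻¹ • μ n) := fun n => ⟨by
    rw [Measure.smul_apply, smul_eq_mul,
      ENNReal.inv_mul_cancel (ha0.trans_le (haμ n)).ne' (hμtop n)]⟩
  let p : ℕ → ProbabilityMeasure X := fun n => ⟨(μ n univ)⁻¹ • μ n, hprob n⟩
  have hp : ∀ n S, (p n : Measure X) S ≤ a⁻¹ * μ n S := fun n S => by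
    change ((μ n univ)⁻¹ • μ n) S ≤ _
    rw [Measure.smul_apply, smul_eq_mul]
    gcongr
    exact haμ n
  -- a weak limit along an ultrafilter
  let 𝓤 : Ultrafilter ℕ := Filter.hyperfilter ℕ
  have h𝓤 : (𝓤 : Filter ℕ) ≤ Filter.atTop := by
    rw [← Nat.cofinite_eq_atTop]
    exact Filter.hyperfilter_le_cofinite
  obtain ⟨q, -, hq⟩ := isCompact_univ.ultrafilter_le_nhds (𝓤.map p) (by simp)
  have hopen : ∀ (G : Set X) (b : ℝ≥0∞), IsOpen G →
      (∀ᶠ n in Filter.atTop, (p n : Measure X) G ≤ b) → (q : Measure X) G ≤ b := by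
    intro G b hG hev
    have hq' : Filter.Tendsto p (𝓤 : Filter ℕ) (nhds q) := hq
    refine (ProbabilityMeasure.le_liminf_measure_open_of_tendsto hq' hG).trans ?_
    exact Filter.liminf_le_of_frequently_le' (Filter.Eventually.filter_mono h𝓤 hev).frequently
  have hqK : (q : Measure X) Kᶜ = 0 := by
    refine measure_null_of_locally_null _ fun x hx => ?_
    obtain ⟨V, W, hV, hW, hxV, hKW, hdisj⟩ :=
      SeparatedNhds.of_isCompact_isCompact isCompact_singleton hK
        (disjoint_singleton_left.2 hx)
    refine ⟨V, mem_nhdsWithin_of_mem_nhds (hV.mem_nhds (hxV rfl)), ?_⟩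
    refine le_antisymm (hopen V 0 hV ?_) zero_le
    obtain ⟨n, hn⟩ := hFK W hW hKW
    filter_upwards [Filter.eventually_ge_atTop n] with m hm
    refine (hp m V).trans ?_
    rw [measure_mono_null (fun y hy hyF => hdisj.le_bot ⟨hy, hn m hm hyF⟩ : V ⊆ (F m)ᶜ) (hμF m),
      mul_zero]
  refine ⟨q, inferInstance, ?_, ?_⟩
  · exact measure_mono_null (compl_subset_compl.2 (hKA.trans inter_subset_left)) hqK
  -- balls
  have hball : ∀ x (k : ℕ), (q : Measure X) (ball x ((1 / 2) ^ k)) ≤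
      a⁻¹ * (c.card * ENNReal.ofReal (c.D * (1 / 2) ^ k) ^ σ) := by
    intro x k
    refine hopen _ _ isOpen_ball ?_
    filter_upwards [Filter.eventually_ge_atTop k] with n hn
    refine (hp n _).trans ?_
    gcongr
    obtain ⟨s, hs, hxs⟩ := c.exists_finset k x
    calc μ n (ball x ((1 / 2) ^ k)) ≤ μ n (⋃ e ∈ s, c.code k ⁻¹' {e}) := by
          refine measure_mono fun y hy => mem_iUnion₂.2 ⟨c.code k y, hxs y hy, rfl⟩
      _ ≤ ∑ e ∈ s, μ n (c.code k ⁻¹' {e}) := measure_biUnion_finset_le _ _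
      _ ≤ ∑ e ∈ s, ENNReal.ofReal (c.D * (1 / 2) ^ k) ^ σ := by
          refine Finset.sum_le_sum fun e _ => ?_
          rcases (c.code k ⁻¹' {e}).eq_empty_or_nonempty with h | ⟨y, rfl⟩
          · simp [h]
          · exact (hμc n k hn y).trans (ENNReal.rpow_le_rpow (c.ediam_cell_le k y) hσ.le)
      _ ≤ c.card * ENNReal.ofReal (c.D * (1 / 2) ^ k) ^ σ := by
          rw [Finset.sum_const, nsmul_eq_mul]
          gcongr
  refine ⟨ENNReal.ofReal 2 ^ σ + a⁻¹ * (c.card * ENNReal.ofReal (4 * c.D) ^ σ), ?_,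
    fun x r hr => ?_⟩
  · refine ENNReal.add_ne_top.2 ⟨ENNReal.rpow_ne_top_of_nonneg hσ.le ENNReal.ofReal_ne_top,
      ENNReal.mul_ne_top (ENNReal.inv_ne_top.2 ha0.ne')
        (ENNReal.mul_ne_top (ENNReal.natCast_ne_top _) ?_)⟩
    exact ENNReal.rpow_ne_top_of_nonneg hσ.le ENNReal.ofReal_ne_top
  rw [add_mul]
  rcases le_or_gt 1 (2 * r) with h1 | h1
  · refine le_add_of_le_of_nonneg (prob_le_one.trans ?_) zero_le
    rw [← ENNReal.mul_rpow_of_nonneg _ _ hσ.le, ← ENNReal.ofReal_mul (by norm_num)]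
    refine ENNReal.one_le_rpow ?_ hσ
    rwa [ENNReal.one_le_ofReal]
  · obtain ⟨k, hk, hk'⟩ := exists_nat_pow_near_of_lt_one (by positivity : 0 < 2 * r) h1.le
      (by norm_num : (0 : ℝ) < 1 / 2) (by norm_num)
    rw [pow_succ] at hk
    refine le_add_of_nonneg_of_le zero_le ?_
    refine (measure_mono (closedBall_subset_ball (by linarith))).trans ((hball x k).trans ?_)
    rw [mul_assoc, mul_assoc, ← ENNReal.mul_rpow_of_nonneg _ _ hσ.le,
      ← ENNReal.ofReal_mul' hr.le]
    gcongr _ * (_ * ENNReal.ofReal ?_ ^ σ)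
    have hD : 0 ≤ c.D := by
      have := c.dist_le 0 x x rfl
      simpa using this
    nlinarith

end CellSystem

/-! ### Frostman's lemma in the plane -/

/-- The Euclidean plane. -/
local notation "Plane" => EuclideanSpace ℝ (Fin 2)

lemma floor_eq_of_floor_two_mul_eq {a b : ℝ} (h : ⌊2 * a⌋ = ⌊2 * b⌋) : ⌊a⌋ = ⌊b⌋ := by
  have key : ∀ {a b : ℝ}, ⌊2 * a⌋ = ⌊2 * b⌋ → ⌊a⌋ ≤ ⌊b⌋ := by
    intro a b h
    have h1 : 2 * ⌊a⌋ ≤ ⌊2 * a⌋ := by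
      rw [Int.le_floor]; push_cast; linarith [Int.floor_le a]
    have h2 : ((2 * ⌊a⌋ : ℤ) : ℝ) ≤ 2 * b := (Int.cast_le.2 (h1.trans_eq h)).trans (Int.floor_le _)
    rw [Int.le_floor]
    push_cast at h2
    linarith
  exact (key h).antisymm (key h.symm)

lemma plane_norm_le_two_mul {x : Plane} {r : ℝ} (h0 : |x 0| ≤ r) (h1 : |x 1| ≤ r) :
    ‖x‖ ≤ 2 * r := by
  have hr : 0 ≤ r := (abs_nonneg _).trans h0
  rw [EuclideanSpace.norm_eq, Fin.sum_univ_two, Real.sqrt_le_left (by positivity)]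
  simp only [Real.norm_eq_abs]
  nlinarith [abs_nonneg (x 0), abs_nonneg (x 1)]

lemma abs_apply_le_norm (x : Plane) (i : Fin 2) : |x i| ≤ ‖x‖ := PiLp.norm_apply_le x i

lemma abs_sub_le_of_floor_eq {a b : ℝ} (n : ℕ) (h : ⌊2 ^ n * a⌋ = ⌊2 ^ n * b⌋) :
    |a - b| ≤ (1 / 2) ^ n := by
  have h1 : |2 ^ n * a - 2 ^ n * b| ≤ 1 := (Int.abs_sub_lt_one_of_floor_eq_floor h).le
  rw [← mul_sub, abs_mul, abs_of_pos (by positivity : (0 : ℝ) < 2 ^ n)] at h1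
  rw [one_div, inv_pow, ← one_div, le_div_iff₀ (by positivity)]
  linarith

lemma floor_mem_Icc {a b : ℝ} (n : ℕ) (h : |b - a| ≤ (1 / 2) ^ n) :
    ⌊2 ^ n * b⌋ ∈ Finset.Icc (⌊2 ^ n * a⌋ - 1) (⌊2 ^ n * a⌋ + 1) := by
  have hp : (0 : ℝ) < 2 ^ n := by positivity
  have h1 : |2 ^ n * b - 2 ^ n * a| ≤ 1 := by
    rw [← mul_sub, abs_mul, abs_of_pos hp]
    calc (2 : ℝ) ^ n * |b - a| ≤ 2 ^ n * (1 / 2) ^ n := by gcongr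
      _ = 1 := by rw [← mul_pow]; norm_num
  rw [abs_le] at h1
  rw [Finset.mem_Icc]
  constructor
  · rw [Int.le_floor]; push_cast
    linarith [Int.floor_le ((2 : ℝ) ^ n * a), h1.1]
  · rw [← Int.lt_add_one_iff, Int.floor_lt]; push_cast
    linarith [Int.lt_floor_add_one ((2 : ℝ) ^ n * a), h1.2]

/-- The dyadic squares in a disc. -/
def dyadicCells (R : ℝ) : CellSystem (closedBall (0 : Plane) R) (ℤ × ℤ) where
  code n y := (⌊2 ^ n * (y : Plane) 0⌋, ⌊2 ^ n * (y : Plane) 1⌋)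
  code_refine n x y h := by
    simp only [Prod.mk.injEq, pow_succ', mul_assoc] at h ⊢
    exact ⟨floor_eq_of_floor_two_mul_eq h.1, floor_eq_of_floor_two_mul_eq h.2⟩
  measurableSet_code n d := by
    refine MeasurableSet.preimage (measurableSet_singleton d) ?_
    refine Measurable.prodMk ?_ ?_ <;>
    · refine Int.measurable_floor.comp ?_
      exact (by fun_prop : Continuous _).measurable
  finite_range n := by
    refine ((finite_Icc (-⌈2 ^ n * R⌉ - 1) ⌈2 ^ n * R⌉).prod
      (finite_Icc (-⌈2 ^ n * R⌉ - 1) ⌈2 ^ n * R⌉)).subset ?_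
    have key : ∀ (y : closedBall (0 : Plane) R) (i : Fin 2),
        ⌊2 ^ n * (y : Plane) i⌋ ∈ Icc (-⌈2 ^ n * R⌉ - 1) ⌈2 ^ n * R⌉ := by
      intro y i
      have h1 : |(y : Plane) i| ≤ R :=
        (abs_apply_le_norm _ i).trans (mem_closedBall_zero_iff.1 y.2)
      rw [abs_le] at h1
      have hp : (0 : ℝ) < 2 ^ n := by positivity
      have h2 : 2 ^ n * (y : Plane) i ≤ 2 ^ n * R := by gcongr; exact h1.2
      have h3 : -(2 ^ n * R) ≤ 2 ^ n * (y : Plane) i := by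
        rw [← mul_neg]; gcongr; exact h1.1
      constructor
      · rw [Int.le_floor]; push_cast
        linarith [Int.le_ceil ((2 : ℝ) ^ n * R)]
      · exact Int.cast_le.1 ((Int.floor_le _).trans (h2.trans (Int.le_ceil (2 ^ n * R))))
    rintro _ ⟨y, rfl⟩
    exact ⟨key y 0, key y 1⟩
  D := 2
  dist_le n x y h := by
    rw [Prod.mk.injEq] at h
    rw [Subtype.dist_eq, dist_eq_norm]
    exact plane_norm_le_two_mul (abs_sub_le_of_floor_eq n h.1) (abs_sub_le_of_floor_eq n h.2)
  card := 9
  exists_finset n x := by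
    refine ⟨Finset.Icc (⌊2 ^ n * (x : Plane) 0⌋ - 1) (⌊2 ^ n * (x : Plane) 0⌋ + 1) ×ˢ
      Finset.Icc (⌊2 ^ n * (x : Plane) 1⌋ - 1) (⌊2 ^ n * (x : Plane) 1⌋ + 1), ?_, fun y hy => ?_⟩
    · rw [Finset.card_product, Int.card_Icc, Int.card_Icc]
      have : ∀ z : ℤ, (z + 1 + 1 - (z - 1)).toNat = 3 := by intro z; omega
      rw [this, this]
    · rw [Subtype.dist_eq, dist_eq_norm] at hy
      exact Finset.mk_mem_product (floor_mem_Icc n ((abs_apply_le_norm _ 0).trans hy.le))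
        (floor_mem_Icc n ((abs_apply_le_norm _ 1).trans hy.le))

/-- **Frostman's lemma** for Borel subsets of the plane. -/
theorem exists_frostman_plane {A : Set Plane} (hA : MeasurableSet A) {σ : NNReal} (hσ : 0 < σ)
    (hdim : σ < dimH A) :
    ∃ μ : Measure Plane, IsProbabilityMeasure μ ∧ μ Aᶜ = 0 ∧ ∃ C : ℝ≥0∞, C ≠ ∞ ∧
      ∀ x, ∀ r : ℝ, 0 < r → μ (closedBall x r) ≤ C * ENNReal.ofReal r ^ (σ : ℝ) := by
  obtain ⟨n, hn⟩ : ∃ n : ℕ, σ < dimH (A ∩ closedBall 0 n) := by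
    have : A = ⋃ n : ℕ, A ∩ closedBall 0 n := by
      rw [← inter_iUnion, iUnion_closedBall_nat, inter_univ]
    rw [this, dimH_iUnion] at hdim
    exact lt_iSup_iff.1 hdim
  let Y := closedBall (0 : Plane) (n : ℝ)
  have : CompactSpace Y := isCompact_iff_compactSpace.1 (isCompact_closedBall _ _)
  let A' : Set Y := Subtype.val ⁻¹' A
  have hA' : MeasurableSet A' := hA.preimage measurable_subtype_coe
  have hdimA' : σ < dimH A' := by
    rw [← isometry_subtype_coe.dimH_image, Subtype.image_preimage_coe, inter_comm]
    exact hn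
  have hcont : (dyadicCells n).content (NNReal.coe_pos.2 hσ) A' ≠ 0 := fun h0 => by
    have h1 := (dyadicCells n).hausdorffMeasure_eq_zero_of_content_eq_zero _ h0
    rw [hausdorffMeasure_of_lt_dimH hdimA'] at h1
    exact ENNReal.top_ne_zero h1
  obtain ⟨μ, hμ, hμA, C, hC, hμC⟩ := (dyadicCells n).exists_frostman (NNReal.coe_pos.2 hσ) hA' hcont
  refine ⟨μ.map Subtype.val, Measure.isProbabilityMeasure_map measurable_subtype_coe.aemeasurable,
    ?_, C * ENNReal.ofReal 2 ^ (σ : ℝ), ?_, fun x r hr => ?_⟩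
  · rw [Measure.map_apply measurable_subtype_coe hA.compl]
    exact hμA
  · exact ENNReal.mul_ne_top hC (ENNReal.rpow_ne_top_of_nonneg σ.2 ENNReal.ofReal_ne_top)
  · rw [Measure.map_apply measurable_subtype_coe measurableSet_closedBall]
    rcases (Subtype.val ⁻¹' closedBall x r : Set Y).eq_empty_or_nonempty with h | ⟨y, hy⟩
    · rw [h, measure_empty]; exact zero_le
    rw [mul_assoc, ← ENNReal.mul_rpow_of_nonneg _ _ σ.coe_nonneg, ← ENNReal.ofReal_mul (by norm_num)]
    refine (measure_mono fun z hz => ?_).trans (hμC y (2 * r) (by positivity))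
    have h1 : dist (z : Plane) x ≤ r := hz
    have h2 : dist (y : Plane) x ≤ r := hy
    rw [mem_closedBall, Subtype.dist_eq]
    linarith [dist_triangle_right (z : Plane) y x]

/-! ### Energies -/

lemma ENNReal.rpow_neg_le_one_add_tsum (a : ℝ≥0∞) {t : ℝ} (ht : 0 < t) :
    a ^ (-t) ≤ 1 + ∑' k : ℕ, {b : ℝ≥0∞ | b ≤ 2⁻¹ ^ k}.indicator (fun _ => (2 ^ t) ^ (k + 1)) a := by
  have h2 : (1 : ℝ≥0∞) ≤ 2 ^ t := ENNReal.one_le_rpow (by norm_num) ht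
  rcases le_or_gt 1 a with h1 | h1
  · refine le_add_right ?_
    rw [ENNReal.rpow_neg]
    exact ENNReal.inv_le_one.2 (ENNReal.one_le_rpow h1 ht)
  refine le_add_left ?_
  rcases eq_or_ne a 0 with rfl | h0
  · have h3 : ∀ k : ℕ, (1 : ℝ≥0∞) ≤
        {b : ℝ≥0∞ | b ≤ 2⁻¹ ^ k}.indicator (fun _ => (2 ^ t) ^ (k + 1)) 0 := fun k => by
      rw [indicator_of_mem (by simp)]
      exact one_le_pow₀ h2
    refine le_top.trans (le_trans (le_of_eq ?_) (ENNReal.tsum_le_tsum h3))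
    rw [ENNReal.tsum_const_eq_top_of_ne_zero one_ne_zero]
  · have hex : ∃ k : ℕ, (2⁻¹ : ℝ≥0∞) ^ (k + 1) < a := by
      obtain ⟨k, hk⟩ := ((ENNReal.tendsto_pow_atTop_nhds_zero_of_lt_one
        (r := 2⁻¹) (by norm_num)).eventually_lt_const (pos_iff_ne_zero.2 h0)).exists
      refine ⟨k, lt_of_le_of_lt ?_ hk⟩
      exact pow_le_pow_right_of_le_one' (by norm_num) (Nat.le_succ k)
    classical
    let k := Nat.find hex
    have hk1 : (2⁻¹ : ℝ≥0∞) ^ (k + 1) < a := Nat.find_spec hex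
    have hk2 : a ≤ 2⁻¹ ^ k := by
      rcases Nat.eq_zero_or_pos k with hk | hk
      · rw [hk, pow_zero]; exact h1.le
      · have := Nat.find_min hex (Nat.sub_lt hk one_pos)
        change ¬ (2⁻¹ : ℝ≥0∞) ^ (k - 1 + 1) < a at this
        rwa [Nat.sub_add_cancel hk, not_lt] at this
    refine le_trans ?_ (ENNReal.le_tsum k)
    rw [indicator_of_mem (by exact hk2)]
    calc a ^ (-t) ≤ (2⁻¹ ^ (k + 1)) ^ (-t) := by
          rw [ENNReal.rpow_neg, ENNReal.rpow_neg]
          exact ENNReal.inv_le_inv.2 (ENNReal.rpow_le_rpow hk1.le ht.le)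
      _ = (2 ^ t) ^ (k + 1) := by
          rw [← ENNReal.rpow_natCast, ← ENNReal.rpow_natCast, ENNReal.inv_rpow, ENNReal.inv_rpow,
            ENNReal.rpow_neg, inv_inv, ← ENNReal.rpow_mul, ← ENNReal.rpow_mul, mul_comm]

/-- A measure whose small sublevel sets decay like `r ^ σ` has finite negative moments of every
order `t < σ`, with an explicit bound. -/
lemma lintegral_rpow_neg_le {X : Type*} [MeasurableSpace X] (ρ : Measure X) {g : X → ℝ≥0∞}
    (hg : Measurable g) {t σ : ℝ} (ht : 0 < t) {C : ℝ≥0∞}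
    (h : ∀ k : ℕ, ρ {x | g x ≤ 2⁻¹ ^ k} ≤ C * (2⁻¹ ^ k) ^ σ) :
    ∫⁻ x, g x ^ (-t) ∂ρ ≤ ρ univ + C * 2 ^ t * ∑' k : ℕ, (2 ^ (t - σ)) ^ k := by
  have hm : ∀ k : ℕ, MeasurableSet {x | g x ≤ 2⁻¹ ^ k} := fun k => hg measurableSet_Iic
  have hi : ∀ (k : ℕ) x, {b : ℝ≥0∞ | b ≤ 2⁻¹ ^ k}.indicator (fun _ => ((2 : ℝ≥0∞) ^ t) ^ (k + 1))
      (g x) = {x | g x ≤ 2⁻¹ ^ k}.indicator (fun _ => (2 ^ t) ^ (k + 1)) x := fun k x => rfl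
  calc ∫⁻ x, g x ^ (-t) ∂ρ
      ≤ ∫⁻ x, (1 + ∑' k : ℕ, {x | g x ≤ 2⁻¹ ^ k}.indicator
          (fun _ => ((2 : ℝ≥0∞) ^ t) ^ (k + 1)) x) ∂ρ :=
        lintegral_mono fun x => by
          simpa only [hi] using ENNReal.rpow_neg_le_one_add_tsum (g x) ht
    _ = ρ univ + ∑' k : ℕ, (2 ^ t) ^ (k + 1) * ρ {x | g x ≤ 2⁻¹ ^ k} := by
        rw [lintegral_add_left measurable_const, lintegral_one, lintegral_tsum]
        · simp_rw [lintegral_indicator_const (hm _)]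
        · exact fun k => (measurable_const.indicator (hm k)).aemeasurable
    _ ≤ ρ univ + ∑' k : ℕ, C * 2 ^ t * (2 ^ (t - σ)) ^ k := by
        refine add_le_add le_rfl (ENNReal.tsum_le_tsum fun k => ?_)
        calc ((2 : ℝ≥0∞) ^ t) ^ (k + 1) * ρ {x | g x ≤ 2⁻¹ ^ k}
            ≤ (2 ^ t) ^ (k + 1) * (C * (2⁻¹ ^ k) ^ σ) := by gcongr; exact h k
          _ = C * 2 ^ t * (2 ^ (t - σ)) ^ k := by
            have h1 : ((2⁻¹ : ℝ≥0∞) ^ k) ^ σ = (2 ^ (-σ)) ^ k := by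
              rw [← ENNReal.rpow_natCast, ← ENNReal.rpow_natCast, ← ENNReal.rpow_mul, mul_comm,
                ENNReal.rpow_mul, ENNReal.inv_rpow, ENNReal.rpow_neg]
            rw [sub_eq_add_neg, ENNReal.rpow_add _ _ (by norm_num) (by norm_num), h1, mul_pow,
              pow_succ]
            ring
    _ = ρ univ + C * 2 ^ t * ∑' k : ℕ, (2 ^ (t - σ)) ^ k := by rw [ENNReal.tsum_mul_left]

lemma tsum_two_rpow_pow_ne_top {s : ℝ} (hs : s < 0) : ∑' k : ℕ, ((2 : ℝ≥0∞) ^ s) ^ k ≠ ∞ := by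
  rw [ENNReal.tsum_geometric]
  refine ENNReal.inv_ne_top.2 (tsub_pos_of_lt ?_).ne'
  exact ENNReal.rpow_lt_one_of_one_lt_of_neg (by norm_num) hs

/-- A set carrying the image of a measure with finite `t`-energy has dimension at least `t`. -/
lemma le_dimH_image_of_energy_ne_top {X Y : Type*} [MeasurableSpace X] [MetricSpace Y]
    [SecondCountableTopology Y] [MeasurableSpace Y] [BorelSpace Y] {μ : Measure X}
    [IsProbabilityMeasure μ]
    {A : Set X} (hA : MeasurableSet A) (hμA : μ Aᶜ = 0) {f : X → Y} (hf : Measurable f)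
    {t : NNReal} (ht : 0 < t)
    (hfin : ∫⁻ x, ∫⁻ y, edist (f x) (f y) ^ (-(t : ℝ)) ∂μ ∂μ ≠ ∞) : t ≤ dimH (f '' A) := by
  have ht' : (0 : ℝ) < t := ht
  have hme : Measurable fun p : X × X => edist (f p.1) (f p.2) ^ (-(t : ℝ)) := by fun_prop
  let h : X → ℝ≥0∞ := fun x => ∫⁻ y, edist (f x) (f y) ^ (-(t : ℝ)) ∂μ
  have hh : Measurable h := hme.lintegral_prod_right'
  have hae : ∀ᵐ x ∂μ, h x < ∞ := ae_lt_top hh hfin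
  obtain ⟨n, hn⟩ : ∃ n : ℕ, μ {x | h x ≤ n} ≠ 0 := by
    by_contra! H
    have h1 : μ (⋃ n : ℕ, {x | h x ≤ n}) = 0 := measure_iUnion_null H
    have h2 : μ (⋃ n : ℕ, {x | h x ≤ n})ᶜ = 0 := by
      refine measure_mono_null (fun x hx => ?_) hae
      simp only [mem_compl_iff, mem_iUnion, mem_ofPred_eq, not_exists, not_le] at hx ⊢
      intro hlt
      obtain ⟨m, hm⟩ := ENNReal.exists_nat_gt hlt.ne
      exact (hx m).not_gt hm
    have h3 : μ univ ≤ 0 := by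
      rw [← union_compl_self (⋃ n : ℕ, {x | h x ≤ n})]
      exact (measure_union_le _ _).trans (by rw [h1, h2, add_zero])
    simp at h3
  let K : ℝ≥0∞ := n + 1
  have hK0 : K ≠ 0 := by simp [K]
  have hKt : K ≠ ∞ := by simp [K]
  let B : Set X := {x | h x ≤ n}
  have hB : MeasurableSet B := hh measurableSet_Iic
  have hball : ∀ x ∈ B, ∀ r : ℝ≥0∞, μ {y | edist (f x) (f y) ≤ r} ≤ K * r ^ (t : ℝ) := by
    intro x hx r
    have hms : MeasurableSet {y | edist (f x) (f y) ≤ r} :=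
      (by fun_prop : Measurable fun y => edist (f x) (f y)) measurableSet_Iic
    have h1 : r ^ (-(t : ℝ)) * μ {y | edist (f x) (f y) ≤ r} ≤ K := by
      calc r ^ (-(t : ℝ)) * μ {y | edist (f x) (f y) ≤ r}
          = ∫⁻ y in {y | edist (f x) (f y) ≤ r}, r ^ (-(t : ℝ)) ∂μ := by
            rw [setLIntegral_const]
        _ ≤ ∫⁻ y in {y | edist (f x) (f y) ≤ r}, edist (f x) (f y) ^ (-(t : ℝ)) ∂μ := by
            refine setLIntegral_mono' hms fun y hy => ?_
            rw [ENNReal.rpow_neg, ENNReal.rpow_neg]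
            exact ENNReal.inv_le_inv.2 (ENNReal.rpow_le_rpow hy ht'.le)
        _ ≤ h x := setLIntegral_le_lintegral _ _
        _ ≤ K := le_trans hx le_self_add
    rcases eq_or_ne r ∞ with rfl | hr
    · rw [ENNReal.top_rpow_of_pos ht', ENNReal.mul_top hK0]; exact le_top
    rcases eq_or_ne r 0 with rfl | hr0
    · rw [ENNReal.zero_rpow_of_neg (by linarith)] at h1
      by_contra hne
      have : μ {y | edist (f x) (f y) ≤ 0} ≠ 0 := fun h0 => hne (by rw [h0]; exact zero_le)
      rw [ENNReal.top_mul this] at h1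
      exact hKt (top_le_iff.1 h1)
    · rw [ENNReal.rpow_neg, mul_comm, ← div_eq_mul_inv] at h1
      rwa [ENNReal.div_le_iff] at h1
      · exact (ENNReal.rpow_pos (pos_iff_ne_zero.2 hr0) hr).ne'
      · exact ENNReal.rpow_ne_top_of_nonneg ht'.le hr
  let ρ : Measure Y := K⁻¹ • (μ.restrict B).map f
  have hρ : ∀ s : Set Y, ρ s ≤ ediam s ^ (t : ℝ) := by
    have hcl : ∀ s : Set Y, MeasurableSet s → ρ s ≤ ediam s ^ (t : ℝ) := by
      intro s hs
      have h1 : ρ s = K⁻¹ * μ (f ⁻¹' s ∩ B) := by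
        rw [Measure.smul_apply, smul_eq_mul, Measure.map_apply hf hs,
          Measure.restrict_apply (hf hs)]
      rw [h1]
      rcases (f ⁻¹' s ∩ B).eq_empty_or_nonempty with he | ⟨x, hxs, hxB⟩
      · rw [he, measure_empty, mul_zero]; exact zero_le
      rw [ENNReal.inv_mul_le_iff hK0 hKt]
      exact (measure_mono fun y hy => edist_le_ediam_of_mem (mem_preimage.1 hxs) (mem_preimage.1 hy.1)).trans (hball x hxB _)
    intro s
    calc ρ s ≤ ρ (closure s) := measure_mono subset_closure
      _ ≤ ediam (closure s) ^ (t : ℝ) := hcl _ isClosed_closure.measurableSet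
      _ = ediam s ^ (t : ℝ) := by rw [ediam_closure]
  have hle : ρ ≤ μH[t] := Measure.le_hausdorffMeasure t ρ 1 one_pos fun s _ => hρ s
  refine le_dimH_of_hausdorffMeasure_ne_zero fun h0 => ?_
  have h1 : ρ (f '' A) = 0 := le_antisymm ((hle _).trans_eq h0) zero_le
  rw [Measure.smul_apply, smul_eq_mul, mul_eq_zero] at h1
  have h2 := h1.resolve_left (ENNReal.inv_ne_zero.2 hKt)
  have h3 : μ (B ∩ A) = 0 := by
    have h4 : μ.restrict B (f ⁻¹' (f '' A)) = 0 :=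
      le_antisymm ((Measure.le_map_apply hf.aemeasurable _).trans_eq h2) zero_le
    have h5 := measure_mono_null (subset_preimage_image f A) h4
    rwa [Measure.restrict_apply hA, inter_comm] at h5
  refine hn (le_antisymm ?_ zero_le)
  calc μ B ≤ μ (B ∩ A ∪ Aᶜ) := measure_mono fun x hx => by
        by_cases hxA : x ∈ A
        · exact Or.inl ⟨hx, hxA⟩
        · exact Or.inr hxA
    _ ≤ 0 := (measure_union_le _ _).trans (by rw [h3, hμA, add_zero])

/-! ### Kaufman's exceptional set estimate -/

/-- The determinant of `w` and `x`; for a unit vector `w` this is the orthogonal projection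
along `w`. -/
def wedge (w x : Plane) : ℝ := w 0 * x 1 - w 1 * x 0

lemma wedge_sub (w x y : Plane) : wedge w (x - y) = wedge w x - wedge w y := by
  simp only [wedge, PiLp.sub_apply]; ring

lemma wedge_smul (w : Plane) (c : ℝ) (x : Plane) : wedge w (c • x) = c * wedge w x := by
  simp only [wedge, PiLp.smul_apply, smul_eq_mul]; ring

lemma wedge_self (w : Plane) : wedge w w = 0 := by rw [wedge]; ring

lemma continuous_wedge : Continuous fun p : Plane × Plane => wedge p.1 p.2 := by
  unfold wedge; fun_prop

lemma sq_add_sq_of_norm_eq_one {v : Plane} (hv : ‖v‖ = 1) : v 0 ^ 2 + v 1 ^ 2 = 1 := by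
  rw [← Fin.sum_univ_two (fun i => v i ^ 2), ← EuclideanSpace.real_norm_sq_eq, hv, one_pow]

lemma lipschitzWith_wedge {w : Plane} (hw : ‖w‖ = 1) : LipschitzWith 1 (wedge w) := by
  refine LipschitzWith.of_dist_le_mul fun x y => ?_
  rw [NNReal.coe_one, one_mul, Real.dist_eq, ← wedge_sub, dist_eq_norm]
  refine abs_le_of_sq_le_sq ?_ (norm_nonneg _)
  have h1 := sq_add_sq_of_norm_eq_one hw
  rw [EuclideanSpace.real_norm_sq_eq, Fin.sum_univ_two, wedge]
  nlinarith [sq_nonneg (w 0 * (x - y) 0 + w 1 * (x - y) 1)]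

lemma norm_sub_le_or_norm_add_le {w z : Plane} (hw : ‖w‖ = 1) (hz : ‖z‖ = 1) :
    ‖w - z‖ ≤ 2 * |wedge w z| ∨ ‖w + z‖ ≤ 2 * |wedge w z| := by
  have h1 := sq_add_sq_of_norm_eq_one hw
  have h2 := sq_add_sq_of_norm_eq_one hz
  obtain ⟨c, hc⟩ : ∃ c, c = w 0 * z 0 + w 1 * z 1 := ⟨_, rfl⟩
  have h3 : c ^ 2 + wedge w z ^ 2 = 1 := by
    rw [hc, wedge]
    linear_combination h1 * (z 0 ^ 2 + z 1 ^ 2) + h2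
  have hc1 : |c| ≤ 1 := abs_le_one_iff_mul_self_le_one.2 (by nlinarith [sq_nonneg (wedge w z)])
  rw [abs_le] at hc1
  rcases le_total 0 c with h0 | h0
  · left
    refine le_of_sq_le_sq ?_ (by positivity)
    rw [mul_pow, sq_abs, EuclideanSpace.real_norm_sq_eq, Fin.sum_univ_two, PiLp.sub_apply,
      PiLp.sub_apply]
    nlinarith
  · right
    refine le_of_sq_le_sq ?_ (by positivity)
    rw [mul_pow, sq_abs, EuclideanSpace.real_norm_sq_eq, Fin.sum_univ_two, PiLp.add_apply,
      PiLp.add_apply]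
    nlinarith

lemma ofReal_inv_two_pow (k : ℕ) : ENNReal.ofReal (2⁻¹ ^ k) = 2⁻¹ ^ k := by
  rw [ENNReal.ofReal_pow (by norm_num), ENNReal.ofReal_inv_of_pos (by norm_num)]
  simp

lemma enorm_le_inv_two_pow {E : Type*} [SeminormedAddGroup E] {x : E} {k : ℕ} :
    ‖x‖ₑ ≤ 2⁻¹ ^ k ↔ ‖x‖ ≤ 2⁻¹ ^ k := by
  rw [← ofReal_inv_two_pow, ← ofReal_norm, ENNReal.ofReal_le_ofReal_iff (by positivity)]

/-- A Frostman measure of exponent `σ` on the unit circle has uniformly bounded negative moments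
of order `t < σ` of `w ↦ wedge w z / ‖z‖`. -/
lemma exists_lintegral_wedge_le {ν : Measure Plane} [IsProbabilityMeasure ν]
    (hν : ν (sphere 0 1)ᶜ = 0) {σ t : ℝ} (ht : 0 < t) (htσ : t < σ) {C : ℝ≥0∞} (hC : C ≠ ∞)
    (hνC : ∀ x, ∀ r : ℝ, 0 < r → ν (closedBall x r) ≤ C * ENNReal.ofReal r ^ σ) :
    ∃ K : ℝ≥0∞, K ≠ ∞ ∧ ∀ z : Plane,
      ∫⁻ w, ‖wedge w z‖ₑ ^ (-t) ∂ν ≤ K * ‖z‖ₑ ^ (-t) := by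
  have hσ : 0 < σ := ht.trans htσ
  have hmeas : ∀ z : Plane, Measurable fun w => ‖wedge w z‖ₑ := fun z =>
    (continuous_wedge.comp (Continuous.prodMk_left z)).measurable.enorm
  let C' : ℝ≥0∞ := 2 * (C * 2 ^ σ)
  have hC' : C' ≠ ∞ := ENNReal.mul_ne_top (by norm_num)
    (ENNReal.mul_ne_top hC (ENNReal.rpow_ne_top_of_nonneg hσ.le (by norm_num)))
  let K : ℝ≥0∞ := ν univ + C' * 2 ^ t * ∑' k : ℕ, (2 ^ (t - σ)) ^ k
  have hK : K ≠ ∞ := ENNReal.add_ne_top.2 ⟨measure_ne_top _ _, ENNReal.mul_ne_top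
    (ENNReal.mul_ne_top hC' (ENNReal.rpow_ne_top_of_nonneg ht.le (by norm_num)))
    (tsum_two_rpow_pow_ne_top (by linarith))⟩
  have hK0 : K ≠ 0 := by simp [K]
  have hunit : ∀ z : Plane, ‖z‖ = 1 → ∫⁻ w, ‖wedge w z‖ₑ ^ (-t) ∂ν ≤ K := by
    intro z hz
    refine lintegral_rpow_neg_le ν (hmeas z) ht fun k => ?_
    have hb : ∀ x : Plane, ν (closedBall x (2 * 2⁻¹ ^ k)) ≤ C * 2 ^ σ * (2⁻¹ ^ k) ^ σ := by
      intro x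
      refine (hνC x _ (by positivity)).trans_eq ?_
      rw [ENNReal.ofReal_mul (by norm_num), ENNReal.mul_rpow_of_nonneg _ _ hσ.le,
        ofReal_inv_two_pow, mul_assoc]
      simp
    calc ν {w | ‖wedge w z‖ₑ ≤ 2⁻¹ ^ k}
        ≤ ν ((sphere 0 1)ᶜ ∪
            (closedBall z (2 * 2⁻¹ ^ k) ∪ closedBall (-z) (2 * 2⁻¹ ^ k))) := by
          refine measure_mono fun w hw => ?_
          by_cases hws : w ∈ sphere (0 : Plane) 1
          · have h1 : |wedge w z| ≤ 2⁻¹ ^ k := enorm_le_inv_two_pow.1 hw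
            right
            rcases norm_sub_le_or_norm_add_le (mem_sphere_zero_iff_norm.1 hws) hz with h | h
            · left
              rw [mem_closedBall, dist_eq_norm]
              linarith
            · right
              rw [mem_closedBall, dist_eq_norm, sub_neg_eq_add]
              linarith
          · exact Or.inl hws
      _ ≤ 0 + (C * 2 ^ σ * (2⁻¹ ^ k) ^ σ + C * 2 ^ σ * (2⁻¹ ^ k) ^ σ) :=
          (measure_union_le _ _).trans (add_le_add hν.le
            ((measure_union_le _ _).trans (add_le_add (hb _) (hb _))))
      _ = C' * (2⁻¹ ^ k) ^ σ := by simp only [C']; ring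
  refine ⟨K, hK, fun z => ?_⟩
  rcases eq_or_ne z 0 with rfl | hz
  · rw [enorm_zero, ENNReal.zero_rpow_of_neg (by linarith), ENNReal.mul_top hK0]
    exact le_top
  have hz0 : ‖z‖ ≠ 0 := norm_ne_zero_iff.2 hz
  have hzu : ‖‖z‖⁻¹ • z‖ = 1 := by
    rw [norm_smul, norm_inv, norm_norm, inv_mul_cancel₀ hz0]
  have heq : ∀ w, ‖wedge w z‖ₑ ^ (-t) = ‖z‖ₑ ^ (-t) * ‖wedge w (‖z‖⁻¹ • z)‖ₑ ^ (-t) := by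
    intro w
    have h1 : ‖wedge w z‖ₑ = ‖z‖ₑ * ‖wedge w (‖z‖⁻¹ • z)‖ₑ := by
      rw [← enorm_norm z, ← enorm_mul, ← wedge_smul, smul_inv_smul₀ hz0]
    rw [h1, ENNReal.rpow_neg, ENNReal.mul_rpow_of_nonneg _ _ ht.le, ENNReal.mul_inv,
      ENNReal.rpow_neg, ENNReal.rpow_neg]
    · exact Or.inl (ENNReal.rpow_pos (enorm_pos.2 hz) enorm_ne_top).ne'
    · exact Or.inl (ENNReal.rpow_ne_top_of_nonneg ht.le enorm_ne_top)
  simp_rw [heq]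
  rw [lintegral_const_mul _ ((hmeas _).pow_const _), mul_comm]
  gcongr
  exact hunit _ hzu

/-- A Frostman measure of exponent `σ` has finite `t`-energy for `t < σ`. -/
lemma energy_ne_top {μ : Measure Plane} [IsProbabilityMeasure μ]
    {σ t : ℝ} (ht : 0 < t) (htσ : t < σ) {C : ℝ≥0∞} (hC : C ≠ ∞)
    (hμC : ∀ x, ∀ r : ℝ, 0 < r → μ (closedBall x r) ≤ C * ENNReal.ofReal r ^ σ) :
    ∫⁻ x, ∫⁻ y, ‖x - y‖ₑ ^ (-t) ∂μ ∂μ ≠ ∞ := by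
  let K : ℝ≥0∞ := μ univ + C * 2 ^ t * ∑' k : ℕ, (2 ^ (t - σ)) ^ k
  have hK : K ≠ ∞ := ENNReal.add_ne_top.2 ⟨measure_ne_top _ _, ENNReal.mul_ne_top
    (ENNReal.mul_ne_top hC (ENNReal.rpow_ne_top_of_nonneg ht.le (by norm_num)))
    (tsum_two_rpow_pow_ne_top (by linarith))⟩
  have h1 : ∀ x, ∫⁻ y, ‖x - y‖ₑ ^ (-t) ∂μ ≤ K := by
    intro x
    refine lintegral_rpow_neg_le μ (by fun_prop) ht fun k => ?_
    rw [← ofReal_inv_two_pow]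
    refine (measure_mono fun y hy => ?_).trans (hμC x (2⁻¹ ^ k) (by positivity))
    rw [mem_closedBall', dist_eq_norm]
    exact enorm_le_inv_two_pow.1 (by rwa [← ofReal_inv_two_pow])
  refine ((lintegral_mono h1).trans_lt ?_).ne
  rw [lintegral_const, measure_univ, mul_one]
  exact hK.lt_top

lemma dimH_wedge_image_lt_le {A : Set Plane} (hA : MeasurableSet A) {t : NNReal} (ht : 0 < t)
    (htA : t < dimH A) :
    dimH {w ∈ sphere (0 : Plane) 1 | dimH (wedge w '' A) < t} ≤ t := by
  obtain ⟨σ, htσ, hσA⟩ := ENNReal.lt_iff_exists_nnreal_btwn.1 htA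
  rw [ENNReal.coe_lt_coe] at htσ
  have ht' : (0 : ℝ) < t := ht
  obtain ⟨μ, hμ, hμA, C, hC, hμC⟩ := exists_frostman_plane hA (ht.trans htσ) hσA
  have hμE := energy_ne_top ht' (NNReal.coe_lt_coe.2 htσ) hC hμC
  have hm3 : Measurable fun p : (Plane × Plane) × Plane =>
      ‖wedge p.1.1 (p.1.2 - p.2)‖ₑ ^ (-(t : ℝ)) := by
    refine Measurable.pow_const (Measurable.enorm (Continuous.measurable ?_)) _
    exact continuous_wedge.comp
      (by fun_prop : Continuous fun p : (Plane × Plane) × Plane => (p.1.1, p.1.2 - p.2))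
  have hm2 : Measurable fun p : Plane × Plane =>
      ∫⁻ y, ‖wedge p.1 (p.2 - y)‖ₑ ^ (-(t : ℝ)) ∂μ := hm3.lintegral_prod_right'
  let E : Plane → ℝ≥0∞ := fun w => ∫⁻ x, ∫⁻ y, ‖wedge w (x - y)‖ₑ ^ (-(t : ℝ)) ∂μ ∂μ
  have hE : Measurable E := hm2.lintegral_prod_right'
  let G : Set Plane := sphere 0 1 ∩ {w | E w = ∞}
  have hG : MeasurableSet G := isClosed_sphere.measurableSet.inter (hE (measurableSet_singleton ∞))
  have hsub : {w ∈ sphere (0 : Plane) 1 | dimH (wedge w '' A) < t} ⊆ G := by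
    rintro w ⟨hw, hlt⟩
    refine ⟨hw, ?_⟩
    by_contra hne
    refine hlt.not_ge (le_dimH_image_of_energy_ne_top hA hμA
      (lipschitzWith_wedge (mem_sphere_zero_iff_norm.1 hw)).continuous.measurable ht ?_)
    simp_rw [edist_eq_enorm_sub, ← wedge_sub]
    exact hne
  refine (dimH_mono hsub).trans ?_
  by_contra! hlt
  obtain ⟨τ, htτ, hτG⟩ := ENNReal.lt_iff_exists_nnreal_btwn.1 hlt
  rw [ENNReal.coe_lt_coe] at htτ
  obtain ⟨ν, hν, hνG, C', hC', hνC⟩ := exists_frostman_plane hG (ht.trans htτ) hτG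
  obtain ⟨K, hK, hνK⟩ := exists_lintegral_wedge_le
    (measure_mono_null (compl_subset_compl.2 inter_subset_left) hνG) ht'
    (NNReal.coe_lt_coe.2 htτ) hC' hνC
  have h1 : ∫⁻ w, E w ∂ν ≠ ∞ := by
    have h2 : ∫⁻ w, E w ∂ν = ∫⁻ x, ∫⁻ y, ∫⁻ w, ‖wedge w (x - y)‖ₑ ^ (-(t : ℝ)) ∂ν ∂μ ∂μ := by
      rw [lintegral_lintegral_swap hm2.aemeasurable]
      refine lintegral_congr fun x => ?_
      exact lintegral_lintegral_swap (Measurable.aemeasurable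
        (hm3.comp (by fun_prop : Measurable fun p : Plane × Plane => ((p.1, x), p.2))))
    rw [h2]
    refine ne_top_of_le_ne_top (ENNReal.mul_ne_top hK hμE) ?_
    rw [← lintegral_const_mul' _ _ hK]
    refine lintegral_mono fun x => ?_
    rw [← lintegral_const_mul' _ _ hK]
    exact lintegral_mono fun y => hνK _
  have h2 : ν univ ≤ 0 := by
    rw [← union_compl_self G]
    refine (measure_union_le _ _).trans ?_
    rw [hνG, add_zero]
    refine (measure_mono_null (fun w hw => ?_) (ae_lt_top hE h1)).le
    exact fun hlt => hlt.ne hw.2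
  simp at h2

/-- **Kaufman's theorem**: the set of directions for which the projection drops the dimension of
`A` has dimension at most `dimH A`. -/
theorem dimH_wedge_image_lt_dimH_le {A : Set Plane} (hA : MeasurableSet A) :
    dimH {w ∈ sphere (0 : Plane) 1 | dimH (wedge w '' A) < dimH A} ≤ dimH A := by
  have hsub : {w ∈ sphere (0 : Plane) 1 | dimH (wedge w '' A) < dimH A} ⊆
      ⋃ q : {q : ℚ // (0 : ℝ) < q ∧ ((q : ℝ).toNNReal : ℝ≥0∞) < dimH A},
        {w ∈ sphere (0 : Plane) 1 | dimH (wedge w '' A) < ((q : ℚ) : ℝ).toNNReal} := by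
    rintro w ⟨hw, hlt⟩
    obtain ⟨q, -, h1, h2⟩ := ENNReal.lt_iff_exists_rat_btwn.1 hlt
    have hq : (0 : ℝ) < q := by
      by_contra! hq
      rw [Real.toNNReal_of_nonpos hq] at h1
      simp at h1
    exact mem_iUnion.2 ⟨⟨q, hq, h2⟩, hw, h1⟩
  refine (dimH_mono hsub).trans ?_
  rw [dimH_iUnion]
  exact iSup_le fun q =>
    (dimH_wedge_image_lt_le hA (Real.toNNReal_pos.2 q.2.1) q.2.2).trans q.2.2.le

/-! ### Closest-point projections -/

/-- The rotation by a right angle. -/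
def perp (v : Plane) : Plane := !₂[-v 1, v 0]

lemma plane_inner_eq (x y : Plane) : ⟪x, y⟫ = x 0 * y 0 + x 1 * y 1 := by
  simp [PiLp.inner_apply, Fin.sum_univ_two, mul_comm]

lemma eq_inner_smul_add_wedge_smul {v : Plane} (hv : ‖v‖ = 1) (x : Plane) :
    x = ⟪v, x⟫ • v + wedge v x • perp v := by
  have h := sq_add_sq_of_norm_eq_one hv
  ext i
  fin_cases i
  · simp [plane_inner_eq, wedge, perp]
    linear_combination -(x 0) * h
  · simp [plane_inner_eq, wedge, perp]
    linear_combination -(x 1) * h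

lemma inner_perp_left (v x : Plane) : ⟪perp v, x⟫ = wedge v x := by
  simp [plane_inner_eq, wedge, perp]; ring

lemma inner_perp_self (v : Plane) : ⟪v, perp v⟫ = 0 := by
  simp [plane_inner_eq, perp]; ring

section NormGeometry

variable {N : Plane → ℝ}

lemma norm_fn_nonneg (hN_add : ∀ x y, N (x + y) ≤ N x + N y)
    (hN_smul : ∀ (c : ℝ) x, N (c • x) = |c| * N x) (x : Plane) : 0 ≤ N x := by
  have h0 : N 0 = 0 := by simpa using hN_smul 0 0
  have h1 : N (-x) = N x := by simpa using hN_smul (-1) x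
  have h2 := hN_add x (-x)
  rw [add_neg_cancel, h0, h1] at h2
  linarith

lemma norm_fn_pos (hN_add : ∀ x y, N (x + y) ≤ N x + N y)
    (hN_smul : ∀ (c : ℝ) x, N (c • x) = |c| * N x)
    (hN_zero : ∀ x, N x = 0 → x = 0) {x : Plane} (hx : x ≠ 0) : 0 < N x :=
  (norm_fn_nonneg hN_add hN_smul x).lt_of_ne' fun h => hx (hN_zero x h)

/-- Positive curvature of the unit circle of `N` makes the minimizer of `N` on an affine line
unique. -/
lemma minimizer_unique (hN_add : ∀ x y, N (x + y) ≤ N x + N y)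
    (hN_smul : ∀ (c : ℝ) x, N (c • x) = |c| * N x)
    (hN_zero : ∀ x, N x = 0 → x = 0)
    {γ : ℝ → Plane} (hγ_C2 : ContDiff ℝ 2 γ) (hγ_range : range γ = {x : Plane | N x = 1})
    (hγ_unit : ∀ t, ‖deriv γ t‖ = 1) (hγ_curv : ∀ t, deriv (deriv γ) t ≠ 0)
    {v : Plane} (hv : ‖v‖ = 1) {u₁ u₂ : Plane} (h₁ : ⟪v, u₁⟫ = 1) (h₂ : ⟪v, u₂⟫ = 1)
    (hmin₁ : ∀ x, ⟪v, x⟫ = 1 → N u₁ ≤ N x) (hmin₂ : ∀ x, ⟪v, x⟫ = 1 → N u₂ ≤ N x) :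
    u₁ = u₂ := by
  by_contra hne
  obtain ⟨m, hm⟩ : ∃ m, m = N u₁ := ⟨_, rfl⟩
  have hm₂ : N u₂ = m := by rw [hm]; exact (hmin₂ _ h₁).antisymm (hmin₁ _ h₂)
  have hu₁ : u₁ ≠ 0 := by rintro rfl; simp at h₁
  have hmpos : 0 < m := hm ▸ norm_fn_pos hN_add hN_smul hN_zero hu₁
  obtain ⟨c, hc⟩ : ∃ c : Plane, c = (1 / 2 : ℝ) • (u₁ + u₂) := ⟨_, rfl⟩
  obtain ⟨e, he⟩ : ∃ e : Plane, e = (1 / 2 : ℝ) • (u₂ - u₁) := ⟨_, rfl⟩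
  have hvc : ⟪v, c⟫ = 1 := by rw [hc, inner_smul_right, inner_add_right, h₁, h₂]; norm_num
  have hve : ⟪v, e⟫ = 0 := by rw [he, inner_smul_right, inner_sub_right, h₁, h₂]; norm_num
  have he0 : e ≠ 0 := by
    rw [he]
    exact smul_ne_zero (by norm_num) (sub_ne_zero.2 (Ne.symm hne))
  have heq := eq_inner_smul_add_wedge_smul hv e
  rw [hve, zero_smul, zero_add] at heq
  have hk : wedge v e ≠ 0 := fun h => he0 (by rw [heq, h, zero_smul])
  have hseg : ∀ s : ℝ, |s| < 1 → N (c + s • e) = m := by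
    intro s hs
    rw [abs_lt] at hs
    refine le_antisymm ?_ ?_
    · have h3 : c + s • e = ((1 - s) / 2) • u₁ + ((1 + s) / 2) • u₂ := by
        rw [hc, he]; module
      rw [h3]
      refine (hN_add _ _).trans_eq ?_
      rw [hN_smul, hN_smul, abs_of_pos (by linarith), abs_of_pos (by linarith), hm₂, ← hm]
      ring
    · rw [hm]
      refine hmin₁ _ ?_
      rw [inner_add_right, inner_smul_right, hvc, hve, mul_zero, add_zero]
  have hNc : N c = m := by simpa using hseg 0 (by simp)
  obtain ⟨t₀, ht₀⟩ : ∃ t, γ t = m⁻¹ • c := by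
    have : m⁻¹ • c ∈ range γ := by
      rw [hγ_range, mem_ofPred_eq, hN_smul, hNc, abs_of_pos (inv_pos.2 hmpos),
        inv_mul_cancel₀ hmpos.ne']
    exact this
  have hγN : ∀ t, N (γ t) = 1 := fun t => by
    have : γ t ∈ {x : Plane | N x = 1} := hγ_range ▸ mem_range_self t
    exact this
  have hγd : Differentiable ℝ γ := hγ_C2.differentiable (by norm_num)
  have hγ' : ContDiff ℝ 1 (deriv γ) := ((contDiff_succ_iff_deriv (n := 1)).1 hγ_C2).2.2
  have hγ'd : Differentiable ℝ (deriv γ) := hγ'.differentiable (by norm_num)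
  let a : ℝ → ℝ := fun t => ⟪v, γ t⟫
  have ha : Continuous a := continuous_const.inner hγ_C2.continuous
  have ha₀ : a t₀ = m⁻¹ := by
    change ⟪v, γ t₀⟫ = m⁻¹
    rw [ht₀, inner_smul_right, hvc, mul_one]
  have hapos : ∀ᶠ t in nhds t₀, 0 < a t :=
    ha.continuousAt.eventually (lt_mem_nhds (by rw [ha₀]; exact inv_pos.2 hmpos))
  let s : ℝ → ℝ := fun t => wedge v ((a t)⁻¹ • γ t - c) / wedge v e
  have hs₀ : s t₀ = 0 := by
    have : (a t₀)⁻¹ • γ t₀ - c = 0 := by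
      rw [ha₀, ht₀, inv_inv, smul_inv_smul₀ hmpos.ne', sub_self]
    simp only [s, this]
    simp [wedge]
  have hs : ContinuousAt s t₀ := by
    refine ContinuousAt.div_const ?_ _
    refine (lipschitzWith_wedge hv).continuous.continuousAt.comp ?_
    refine ContinuousAt.sub (ContinuousAt.smul (ha.continuousAt.inv₀ ?_)
      hγ_C2.continuous.continuousAt) continuousAt_const
    rw [ha₀]
    exact (inv_pos.2 hmpos).ne'
  have hslt : ∀ᶠ t in nhds t₀, |s t| < 1 :=
    hs.abs.eventually (gt_mem_nhds (by simp only [hs₀, abs_zero, one_pos]))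
  have hconst : a =ᶠ[nhds t₀] fun _ => m⁻¹ := by
    filter_upwards [hapos, hslt] with t hat hst
    have h3 : (a t)⁻¹ • γ t = c + s t • e := by
      have h4 := eq_inner_smul_add_wedge_smul hv ((a t)⁻¹ • γ t - c)
      have h5 : ⟪v, (a t)⁻¹ • γ t - c⟫ = 0 := by
        rw [inner_sub_right, inner_smul_right, hvc]
        change (a t)⁻¹ * a t - 1 = 0
        rw [inv_mul_cancel₀ hat.ne', sub_self]
      rw [h5, zero_smul, zero_add] at h4
      rw [← sub_eq_iff_eq_add', h4, heq, smul_smul]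
      simp only [s]
      rw [div_mul_cancel₀ _ hk]
    have h4 := hseg _ hst
    rw [← h3, hN_smul, hγN, mul_one, abs_of_pos (inv_pos.2 hat)] at h4
    rw [← h4, inv_inv]
  have hda : ∀ t, HasDerivAt a ⟪v, deriv γ t⟫ t := fun t => by
    simpa using (hasDerivAt_const t v).inner ℝ (hγd t).hasDerivAt
  have hda' : ∀ᶠ t in nhds t₀, ⟪v, deriv γ t⟫ = 0 := by
    filter_upwards [hconst.eventuallyEq_nhds] with t ht
    rw [← (hda t).deriv, ht.deriv_eq, deriv_const]
  have hdda : ⟪v, deriv (deriv γ) t₀⟫ = 0 := by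
    have h3 : HasDerivAt (fun t => ⟪v, deriv γ t⟫) ⟪v, deriv (deriv γ) t₀⟫ t₀ := by
      simpa using (hasDerivAt_const t₀ v).inner ℝ (hγ'd t₀).hasDerivAt
    rw [← h3.deriv, Filter.EventuallyEq.deriv_eq (f := fun _ => (0 : ℝ)) hda', deriv_const]
  have horth : ⟪deriv γ t₀, deriv (deriv γ) t₀⟫ = 0 := by
    have h3 : HasDerivAt (fun t => ⟪deriv γ t, deriv γ t⟫) _ t₀ :=
      (hγ'd t₀).hasDerivAt.inner ℝ (hγ'd t₀).hasDerivAt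
    have h4 : (fun t => ⟪deriv γ t, deriv γ t⟫) = fun _ => (1 : ℝ) := by
      funext t
      rw [real_inner_self_eq_norm_sq, hγ_unit, one_pow]
    rw [h4] at h3
    have h5 := h3.unique (hasDerivAt_const t₀ (1 : ℝ))
    rw [real_inner_comm (deriv γ t₀)] at h5
    rw [real_inner_comm] at h5 ⊢
    linarith
  have h3 := eq_inner_smul_add_wedge_smul hv (deriv γ t₀)
  have h4 := eq_inner_smul_add_wedge_smul hv (deriv (deriv γ) t₀)
  rw [hda'.self_of_nhds, zero_smul, zero_add] at h3
  rw [hdda, zero_smul, zero_add] at h4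
  have h5 : wedge v (deriv γ t₀) ≠ 0 := fun h => by
    have := hγ_unit t₀
    rw [h3, h, zero_smul, norm_zero] at this
    exact zero_ne_one this
  rw [h3, inner_smul_left, inner_perp_left] at horth
  have h6 : wedge v (deriv (deriv γ) t₀) = 0 := (mul_eq_zero.1 horth).resolve_left h5
  rw [h6, zero_smul] at h4
  exact hγ_curv t₀ h4

/-- The gradient of `N`, in coordinates. -/
def grad (N : Plane → ℝ) (x : Plane) : Plane :=
  !₂[fderiv ℝ N x (EuclideanSpace.single 0 1), fderiv ℝ N x (EuclideanSpace.single 1 1)]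

lemma inner_grad (N : Plane → ℝ) (x h : Plane) : ⟪grad N x, h⟫ = fderiv ℝ N x h := by
  have h1 : h = h 0 • EuclideanSpace.single 0 1 + h 1 • EuclideanSpace.single 1 1 := by
    ext i; fin_cases i <;> simp
  conv_rhs => rw [h1, map_add, map_smul, map_smul]
  simp [plane_inner_eq, grad, mul_comm]

/-- The Gauss map of the level sets of `N`. -/
def gauss (N : Plane → ℝ) (x : Plane) : Plane := ‖grad N x‖⁻¹ • grad N x

lemma contDiffAt_of_contDiffOn_compl_zero (hN_C2 : ContDiffOn ℝ 2 N ({0}ᶜ : Set Plane))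
    {x : Plane} (hx : x ≠ 0) : ContDiffAt ℝ 2 N x :=
  hN_C2.contDiffAt (isOpen_compl_singleton.mem_nhds hx)

/-- Euler's identity. -/
lemma inner_grad_self (hN_smul : ∀ (c : ℝ) x, N (c • x) = |c| * N x)
    {x : Plane} (hd : DifferentiableAt ℝ N x) : ⟪grad N x, x⟫ = N x := by
  rw [inner_grad]
  have h1 : HasDerivAt (fun s : ℝ => N (s • x)) (fderiv ℝ N x x) 1 := by
    have h2 : HasDerivAt (fun s : ℝ => s • x) x 1 := by
      simpa using (hasDerivAt_id (1 : ℝ)).smul_const x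
    have h3 : HasFDerivAt N (fderiv ℝ N x) ((1 : ℝ) • x) := by
      rw [one_smul]; exact hd.hasFDerivAt
    exact h3.comp_hasDerivAt 1 h2
  have h2 : HasDerivAt (fun s : ℝ => N (s • x)) (N x) 1 := by
    have h3 : HasDerivAt (fun s : ℝ => s * N x) (N x) 1 := by
      simpa using (hasDerivAt_id (1 : ℝ)).mul_const (N x)
    refine h3.congr_of_eventuallyEq ?_
    filter_upwards [lt_mem_nhds (one_pos : (0 : ℝ) < 1)] with s hs
    rw [hN_smul, abs_of_pos hs]
  exact h1.unique h2

lemma grad_ne_zero (hN_add : ∀ x y, N (x + y) ≤ N x + N y)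
    (hN_smul : ∀ (c : ℝ) x, N (c • x) = |c| * N x)
    (hN_zero : ∀ x, N x = 0 → x = 0) (hN_C2 : ContDiffOn ℝ 2 N ({0}ᶜ : Set Plane))
    {x : Plane} (hx : x ≠ 0) : grad N x ≠ 0 := fun h => by
  have h1 := inner_grad_self hN_smul
    ((contDiffAt_of_contDiffOn_compl_zero hN_C2 hx).differentiableAt (by norm_num))
  rw [h, inner_zero_left] at h1
  exact (norm_fn_pos hN_add hN_smul hN_zero hx).ne h1

lemma contDiffAt_gauss (hN_add : ∀ x y, N (x + y) ≤ N x + N y)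
    (hN_smul : ∀ (c : ℝ) x, N (c • x) = |c| * N x)
    (hN_zero : ∀ x, N x = 0 → x = 0) (hN_C2 : ContDiffOn ℝ 2 N ({0}ᶜ : Set Plane))
    {x : Plane} (hx : x ≠ 0) : ContDiffAt ℝ 1 (gauss N) x := by
  have h1 : ContDiffAt ℝ 1 (fderiv ℝ N) x :=
    (contDiffAt_of_contDiffOn_compl_zero hN_C2 hx).fderiv_right (by norm_num)
  have h2 : ContDiffAt ℝ 1 (grad N) x := by
    rw [contDiffAt_euclidean]
    intro i
    fin_cases i
    · exact h1.clm_apply contDiffAt_const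
    · exact h1.clm_apply contDiffAt_const
  have h3 := grad_ne_zero hN_add hN_smul hN_zero hN_C2 hx
  exact ((h2.norm ℝ h3).inv (norm_ne_zero_iff.2 h3)).smul h2

/-- The Gauss map recovers the normal of a line from the direction in which `N` projects
onto it. -/
lemma gauss_eq_of_minimizer (hN_add : ∀ x y, N (x + y) ≤ N x + N y)
    (hN_smul : ∀ (c : ℝ) x, N (c • x) = |c| * N x)
    (hN_zero : ∀ x, N x = 0 → x = 0) (hN_C2 : ContDiffOn ℝ 2 N ({0}ᶜ : Set Plane))
    {v : Plane} (hv : ‖v‖ = 1) {u : Plane} (hu : ⟪v, u⟫ = 1)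
    (hmin : ∀ x, ⟪v, x⟫ = 1 → N u ≤ N x) : gauss N (‖u‖⁻¹ • u) = v := by
  have hu0 : u ≠ 0 := by rintro rfl; simp at hu
  have hupos : 0 < ‖u‖ := norm_pos_iff.2 hu0
  obtain ⟨w, hw⟩ : ∃ w, w = ‖u‖⁻¹ • u := ⟨_, rfl⟩
  have hw0 : w ≠ 0 := by rw [hw]; exact smul_ne_zero (inv_pos.2 hupos).ne' hu0
  have hd : DifferentiableAt ℝ N w :=
    (contDiffAt_of_contDiffOn_compl_zero hN_C2 hw0).differentiableAt (by norm_num)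
  have hperp : wedge v (grad N w) = 0 := by
    rw [← inner_perp_left, real_inner_comm, inner_grad]
    have h1 : HasDerivAt (fun s : ℝ => N (w + s • perp v)) (fderiv ℝ N w (perp v)) 0 := by
      have h2 : HasDerivAt (fun s : ℝ => w + s • perp v) (perp v) 0 := by
        simpa using ((hasDerivAt_id (0 : ℝ)).smul_const (perp v)).const_add w
      have h3 : HasFDerivAt N (fderiv ℝ N w) (w + (0 : ℝ) • perp v) := by
        rw [zero_smul, add_zero]; exact hd.hasFDerivAt
      exact h3.comp_hasDerivAt 0 h2
    refine IsLocalMin.hasDerivAt_eq_zero (Filter.Eventually.of_forall fun s => ?_) h1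
    have h2 : w + s • perp v = ‖u‖⁻¹ • (u + (‖u‖ * s) • perp v) := by
      rw [smul_add, ← hw, smul_smul, inv_mul_cancel_left₀ hupos.ne']
    simp only [zero_smul, add_zero]
    rw [h2, hw, hN_smul, hN_smul]
    gcongr
    refine hmin _ ?_
    rw [inner_add_right, inner_smul_right, inner_perp_self, hu, mul_zero, add_zero]
  have hg := eq_inner_smul_add_wedge_smul hv (grad N w)
  rw [hperp, zero_smul, add_zero] at hg
  have hpos : 0 < ⟪v, grad N w⟫ := by
    have h1 := inner_grad_self hN_smul hd
    have h2 := norm_fn_pos hN_add hN_smul hN_zero hw0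
    rw [← h1, hg, inner_smul_left, hw, inner_smul_right, hu, mul_one, ← hw] at h2
    exact pos_of_mul_pos_left h2 (inv_pos.2 hupos).le
  rw [← hw, gauss, hg, norm_smul, hv, mul_one, Real.norm_of_nonneg hpos.le, smul_smul,
    inv_mul_cancel₀ hpos.ne', one_smul]

end NormGeometry

/-- for `s := dim A ≤ 1`, the set of exceptional directions `v ∈ S¹`,
i.e. those with `dim (P_v(A)) < s`, has Hausdorff dimension at most `s`. -/
theorem marstrand_projection_exceptional_set_dim_le
    (N : EuclideanSpace ℝ (Fin 2) → ℝ)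
    (hN_add : ∀ x y : EuclideanSpace ℝ (Fin 2), N (x + y) ≤ N x + N y)
    (hN_smul : ∀ (c : ℝ) (x : EuclideanSpace ℝ (Fin 2)), N (c • x) = |c| * N x)
    (hN_zero : ∀ x : EuclideanSpace ℝ (Fin 2), N x = 0 → x = 0)
    -- `N` restricted to `ℝ² \ {0}` is of class `C^{2,δ}` for some `δ ∈ (0,1)`:
    (δ : ℝ) (hδ0 : 0 < δ) (hδ1 : δ < 1)
    (hN_C2 : ContDiffOn ℝ 2 N ({0}ᶜ : Set (EuclideanSpace ℝ (Fin 2))))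
    (hN_holder : ∀ K : Set (EuclideanSpace ℝ (Fin 2)), K ⊆ {0}ᶜ → IsCompact K →
      ∃ M : ℝ, ∀ x ∈ K, ∀ y ∈ K,
        ‖iteratedFDerivWithin ℝ 2 N ({0}ᶜ : Set (EuclideanSpace ℝ (Fin 2))) x -
          iteratedFDerivWithin ℝ 2 N ({0}ᶜ : Set (EuclideanSpace ℝ (Fin 2))) y‖ ≤
            M * ‖x - y‖ ^ δ)
    -- the N-unit circle has an arc-length parametrization with everywhere
    -- nonvanishing second derivative (strictly positive curvature):
    (γ : ℝ → EuclideanSpace ℝ (Fin 2)) (L : ℝ) (hL : 0 < L)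
    (hγ_C2 : ContDiff ℝ 2 γ)
    (hγ_per : ∀ t, γ (t + L) = γ t)
    (hγ_range : Set.range γ = {x : EuclideanSpace ℝ (Fin 2) | N x = 1})
    (hγ_unit : ∀ t, ‖deriv γ t‖ = 1)
    (hγ_curv : ∀ t, deriv (deriv γ) t ≠ 0)
    -- `P v` is the closest-point projection (w.r.t. `N`) onto the line `H_v`:
    (P : EuclideanSpace ℝ (Fin 2) → EuclideanSpace ℝ (Fin 2) → EuclideanSpace ℝ (Fin 2))
    (hP : ∀ v ∈ sphere (0 : EuclideanSpace ℝ (Fin 2)) 1, ∀ x : EuclideanSpace ℝ (Fin 2),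
      ⟪v, P v x⟫ = 0 ∧
        ∀ q : EuclideanSpace ℝ (Fin 2), ⟪v, q⟫ = 0 → N (x - P v x) ≤ N (x - q))
    (A : Set (EuclideanSpace ℝ (Fin 2))) (hA : MeasurableSet A)
    (hdimA : dimH A ≤ 1) :
    dimH {v ∈ sphere (0 : EuclideanSpace ℝ (Fin 2)) 1 |
        dimH (P v '' A) < dimH A} ≤ dimH A := by
  have hmin : ∀ v ∈ sphere (0 : Plane) 1, ⟪v, v - P v v⟫ = 1 ∧
      ∀ x, ⟪v, x⟫ = 1 → N (v - P v v) ≤ N x := by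
    intro v hv
    have hvv : ⟪v, v⟫ = 1 := by
      rw [real_inner_self_eq_norm_sq, mem_sphere_zero_iff_norm.1 hv, one_pow]
    refine ⟨by rw [inner_sub_right, (hP v hv v).1, hvv, sub_zero], fun x hx => ?_⟩
    have h := (hP v hv v).2 (v - x) (by rw [inner_sub_right, hvv, hx, sub_self])
    rwa [sub_sub_cancel] at h
  have hproj : ∀ v ∈ sphere (0 : Plane) 1, ∀ x, x - P v x = ⟪v, x⟫ • (v - P v v) := by
    intro v hv x
    rcases eq_or_ne ⟪v, x⟫ 0 with hx | hx
    · have h0 : N 0 = 0 := by simpa using hN_smul 0 0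
      have h := (hP v hv x).2 x hx
      rw [sub_self, h0] at h
      rw [hx, zero_smul]
      exact hN_zero _ (h.antisymm (norm_fn_nonneg hN_add hN_smul _))
    · have h1 : ⟪v, ⟪v, x⟫⁻¹ • (x - P v x)⟫ = 1 := by
        rw [inner_smul_right, inner_sub_right, (hP v hv x).1, sub_zero, inv_mul_cancel₀ hx]
      have h2 : ∀ y, ⟪v, y⟫ = 1 → N (⟪v, x⟫⁻¹ • (x - P v x)) ≤ N y := by
        intro y hy
        have h3 := (hP v hv x).2 (x - ⟪v, x⟫ • y)
          (by rw [inner_sub_right, inner_smul_right, hy, mul_one, sub_self])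
        rw [sub_sub_cancel, hN_smul] at h3
        rwa [hN_smul, abs_inv, inv_mul_le_iff₀ (abs_pos.2 hx)]
      rw [← minimizer_unique hN_add hN_smul hN_zero hγ_C2 hγ_range hγ_unit hγ_curv
        (mem_sphere_zero_iff_norm.1 hv) h1 (hmin v hv).1 h2 (hmin v hv).2, smul_inv_smul₀ hx]
  have hsub : {v ∈ sphere (0 : Plane) 1 | dimH (P v '' A) < dimH A} ⊆
      gauss N '' {w ∈ sphere (0 : Plane) 1 | dimH (wedge w '' A) < dimH A} := by
    rintro v ⟨hv, hlt⟩
    obtain ⟨hu, humin⟩ := hmin v hv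
    obtain ⟨u, hudef⟩ : ∃ u, u = v - P v v := ⟨_, rfl⟩
    rw [← hudef] at hu humin
    have hu0 : ‖u‖ ≠ 0 := norm_ne_zero_iff.2 (by rintro rfl; simp at hu)
    have hw : ‖‖u‖⁻¹ • u‖ = 1 := by rw [norm_smul, norm_inv, norm_norm, inv_mul_cancel₀ hu0]
    refine ⟨‖u‖⁻¹ • u, ⟨mem_sphere_zero_iff_norm.2 hw, ?_⟩,
      gauss_eq_of_minimizer hN_add hN_smul hN_zero hN_C2 (mem_sphere_zero_iff_norm.1 hv) hu humin⟩
    have himage : wedge (‖u‖⁻¹ • u) '' A = wedge (‖u‖⁻¹ • u) '' (P v '' A) := by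
      rw [image_image]
      refine image_congr fun x _ => ?_
      rw [← sub_eq_zero, ← wedge_sub, hproj v hv x, ← hudef, ← smul_inv_smul₀ hu0 u, wedge_smul,
        wedge_smul, smul_inv_smul₀ hu0 u, wedge_self, mul_zero, mul_zero]
    rw [himage]
    exact ((lipschitzWith_wedge hw).dimH_image_le _).trans_lt hlt
  refine (dimH_mono hsub).trans ((dimH_image_le_of_locally_lipschitzOn ?_).trans
    (dimH_wedge_image_lt_dimH_le hA))
  rintro w ⟨hw, -⟩
  have hw0 : w ≠ 0 := by rintro rfl; simp at hw
  obtain ⟨K, s, hs, hK⟩ :=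
    (contDiffAt_gauss hN_add hN_smul hN_zero hN_C2 hw0).exists_lipschitzOnWith
  exact ⟨K, s, mem_nhdsWithin_of_mem_nhds hs, hK⟩
end
end
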